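/- There exist a compact set K ⊆ ℍ with nonempty interior and a distance d on K with d ≤ d_b (restricted to K) such that: (1) (K, d) is an Ahlfors 4-regular BPI space; (2) for every subset A ⊆ K and every map f : A → ℍ that is Lipschitz from (A, d) to (ℍ, d_b), the image f(A) has Hausdorff 4-measure zero with respect to d_b. (In particular, the identity map exhibits (ℍ, d_b) looking down on (K, d), while (K, d) does not look down on (ℍ, d_b), so (ℍ, d_b) is not minimal in looking down.) -/

import Mathlib

open scoped ENNReal

namespace Heis

/-- The underlying set of the Heisenberg group: `ℝ³`. -/
abbrev H : Type := ℝ × ℝ × ℝ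

/-- Heisenberg group multiplication. -/
noncomputable def Hmul (p q : H) : H :=
  (p.1 + q.1, p.2.1 + q.2.1, p.2.2 + q.2.2 + (p.1 * q.2.1 - p.2.1 * q.1) / 2)

/-- Heisenberg group inverse. -/
def Hinv (p : H) : H := (-p.1, -p.2.1, -p.2.2)

/-- The box norm `‖p‖ = max {|x|, |y|, √|z|}`. -/
noncomputable def boxNorm (p : H) : ℝ :=
  max |p.1| (max |p.2.1| (Real.sqrt |p.2.2|))

/-- The box distance `d_b(p,q) = ‖p⁻¹·q‖`. -/
noncomputable def dbox (p q : H) : ℝ := boxNorm (Hmul (Hinv p) q)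

/-- The dilations `δ_λ(x,y,z) = (λx, λy, λ²z)`. -/
noncomputable def dil (lam : ℝ) (p : H) : H := (lam * p.1, lam * p.2.1, lam ^ 2 * p.2.2)

/-- `d` is a distance (metric) on `X`. -/
def IsDistance {X : Type*} (d : X → X → ℝ) : Prop :=
  (∀ x y, d x y = d y x) ∧ (∀ x, d x x = 0) ∧
  (∀ x y, d x y = 0 → x = y) ∧ (∀ x y z, d x z ≤ d x y + d y z)

/-- The open ball of the distance function `d`. -/
def ballOf {X : Type*} (d : X → X → ℝ) (x : X) (r : ℝ) : Set X := {y | d x y < r}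

/-- The (extended) diameter of a set with respect to a distance function `d`. -/
noncomputable def ediamOf {X : Type*} (d : X → X → ℝ) (E : Set X) : ℝ≥0∞ :=
  ⨆ (x ∈ E) (y ∈ E), ENNReal.ofReal (d x y)

/-- The Hausdorff `Q`-measure of `A` with respect to the distance function `d`:
`H^Q_d(A) = lim_{ε→0} inf { Σᵢ (diam Eᵢ)^Q : A ⊆ ⋃ᵢ Eᵢ, diam Eᵢ ≤ ε }`. -/
noncomputable def hausdorffOf {X : Type*} (d : X → X → ℝ) (Q : ℝ) (A : Set X) : ℝ≥0∞ :=
  ⨆ (ε : ℝ≥0∞) (_ : 0 < ε),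
    ⨅ (E : ℕ → Set X) (_ : A ⊆ ⋃ n, E n) (_ : ∀ n, ediamOf d (E n) ≤ ε),
      ∑' n, ediamOf d (E n) ^ Q

/-- `(X, d)` is Ahlfors `Q`-regular: there is `C ≥ 1` with
`C⁻¹ r^Q ≤ H^Q_d(B_d(x,r)) ≤ C r^Q` for all `x` and `0 < r < diam X`. -/
def AhlforsRegularOf {X : Type*} (d : X → X → ℝ) (Q : ℝ) : Prop :=
  ∃ C : ℝ, 1 ≤ C ∧ ∀ (x : X) (r : ℝ), 0 < r → ENNReal.ofReal r < ediamOf d Set.univ →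
    ENNReal.ofReal (C⁻¹ * r ^ Q) ≤ hausdorffOf d Q (ballOf d x r) ∧
    hausdorffOf d Q (ballOf d x r) ≤ ENNReal.ofReal (C * r ^ Q)

/-- The distances `d` and `ρ` are biLipschitz equivalent on the set `A`. -/
def BiLipOn {X : Type*} (d ρ : X → X → ℝ) (A : Set X) : Prop :=
  ∃ L : ℝ, 1 ≤ L ∧ ∀ x ∈ A, ∀ y ∈ A, L⁻¹ * ρ x y ≤ d x y ∧ d x y ≤ L * ρ x y


/-- A set is closed with respect to the distance function `d`. -/
def IsClosedIn {X : Type*} (d : X → X → ℝ) (A : Set X) : Prop :=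
  ∀ x : X, (∀ ε : ℝ, 0 < ε → ∃ y ∈ A, d x y < ε) → x ∈ A

/-- `(X, d)` is a BPI ("big pieces of itself") space of dimension `Q`. -/
def IsBPI {X : Type*} (d : X → X → ℝ) (Q : ℝ) : Prop :=
  AhlforsRegularOf d Q ∧
  ∃ C θ : ℝ, 1 ≤ C ∧ 0 < θ ∧
    ∀ (x₁ x₂ : X) (r₁ r₂ : ℝ),
      0 < r₁ → ENNReal.ofReal r₁ < ediamOf d Set.univ →
      0 < r₂ → ENNReal.ofReal r₂ < ediamOf d Set.univ →
      ∃ A : Set X, A ⊆ ballOf d x₁ r₁ ∧ IsClosedIn d A ∧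
        ENNReal.ofReal (θ * r₁ ^ Q) ≤ hausdorffOf d Q A ∧
        ∃ f : X → X, (∀ a ∈ A, f a ∈ ballOf d x₂ r₂) ∧
          ∀ a ∈ A, ∀ b ∈ A,
            C⁻¹ * ((r₂ / r₁) * d a b) ≤ d (f a) (f b) ∧
            d (f a) (f b) ≤ C * ((r₂ / r₁) * d a b)

open Filter Topology MeasureTheory

/-! ### The group structure and the box distance -/

/-- The vertical coordinate of `p⁻¹ q`. -/
noncomputable def vert (p q : H) : ℝ := q.2.2 - p.2.2 - (p.1 * q.2.1 - p.2.1 * q.1) / 2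

/-- `q` differs from `p` by a horizontal amount `ω` and an additional vertical amount `θ`. -/
def Near (ω θ : ℝ) (p q : H) : Prop :=
  |q.1 - p.1| ≤ ω ∧ |q.2.1 - p.2.1| ≤ ω ∧ |vert p q| ≤ ω ^ 2 + θ

lemma dbox_eq (p q : H) :
    dbox p q = max |q.1 - p.1| (max |q.2.1 - p.2.1| (Real.sqrt |vert p q|)) := by
  have h1 : -p.1 + q.1 = q.1 - p.1 := by ring
  have h2 : -p.2.1 + q.2.1 = q.2.1 - p.2.1 := by ring
  have h3 : -p.2.2 + q.2.2 + (-p.1 * q.2.1 - -p.2.1 * q.1) / 2 = vert p q := by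
    unfold vert; ring
  simp only [dbox, boxNorm, Hmul, Hinv, h1, h2, h3]

lemma dbox_nonneg (p q : H) : 0 ≤ dbox p q := by
  rw [dbox_eq]; exact le_max_of_le_left (abs_nonneg _)

lemma dbox_le_iff {p q : H} {r : ℝ} (hr : 0 ≤ r) : dbox p q ≤ r ↔ Near r 0 p q := by
  rw [dbox_eq, Near, max_le_iff, max_le_iff, Real.sqrt_le_left hr, add_zero]

lemma near_dbox (p q : H) : Near (dbox p q) 0 p q := (dbox_le_iff (dbox_nonneg p q)).1 le_rfl

lemma Near.mono {ω θ ω' θ' : ℝ} {p q : H} (h : Near ω θ p q) (hω : ω ≤ ω') (hθ : θ ≤ θ') :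
    Near ω' θ' p q := by
  have h0 : 0 ≤ ω := (abs_nonneg _).trans h.1
  exact ⟨h.1.trans hω, h.2.1.trans hω, h.2.2.trans (by gcongr)⟩

lemma Near.symm {ω θ : ℝ} {p q : H} (h : Near ω θ p q) : Near ω θ q p := by
  refine ⟨by rw [abs_sub_comm]; exact h.1, by rw [abs_sub_comm]; exact h.2.1, ?_⟩
  have : vert q p = - vert p q := by unfold vert; ring
  rw [this, abs_neg]; exact h.2.2

lemma Near.trans {ω θ ω' θ' : ℝ} {p q r : H} (h : Near ω θ p q) (h' : Near ω' θ' q r) :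
    Near (ω + ω') (θ + θ') p r := by
  obtain ⟨a1, a2, a3⟩ := h
  obtain ⟨b1, b2, b3⟩ := h'
  have e : vert p r = vert p q + vert q r +
      ((q.1 - p.1) * (r.2.1 - q.2.1) - (q.2.1 - p.2.1) * (r.1 - q.1)) / 2 := by
    unfold vert; ring
  refine ⟨?_, ?_, ?_⟩
  · have : r.1 - p.1 = (q.1 - p.1) + (r.1 - q.1) := by ring
    rw [this]; exact (abs_add_le _ _).trans (by linarith)
  · have : r.2.1 - p.2.1 = (q.2.1 - p.2.1) + (r.2.1 - q.2.1) := by ring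
    rw [this]; exact (abs_add_le _ _).trans (by linarith)
  · have m1 : |(q.1 - p.1) * (r.2.1 - q.2.1)| ≤ ω * ω' := by
      rw [abs_mul]; exact mul_le_mul a1 b2 (abs_nonneg _) ((abs_nonneg _).trans a1)
    have m2 : |(q.2.1 - p.2.1) * (r.1 - q.1)| ≤ ω * ω' := by
      rw [abs_mul]; exact mul_le_mul a2 b1 (abs_nonneg _) ((abs_nonneg _).trans a1)
    have hω : 0 ≤ ω * ω' := (abs_nonneg _).trans m1
    rw [e]
    rw [abs_le] at *
    constructor <;> nlinarith

lemma dbox_self (p : H) : dbox p p = 0 := by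
  simp [dbox_eq, vert]; ring

lemma dbox_comm (p q : H) : dbox p q = dbox q p :=
  le_antisymm ((dbox_le_iff (dbox_nonneg _ _)).2 (near_dbox q p).symm)
    ((dbox_le_iff (dbox_nonneg _ _)).2 (near_dbox p q).symm)

lemma dbox_triangle (p q r : H) : dbox p r ≤ dbox p q + dbox q r := by
  rw [dbox_le_iff (add_nonneg (dbox_nonneg _ _) (dbox_nonneg _ _))]
  simpa using (near_dbox p q).trans (near_dbox q r)

lemma Near.dbox_le {ω θ r : ℝ} {p q : H} (h : Near ω θ p q) (hr : ω ≤ r)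
    (h2 : ω ^ 2 + θ ≤ r ^ 2) : dbox p q ≤ r := by
  rw [dbox_le_iff ((abs_nonneg _).trans (h.1.trans hr))]
  exact ⟨h.1.trans hr, h.2.1.trans hr, by rw [add_zero]; exact h.2.2.trans h2⟩

lemma eq_of_dbox_eq_zero {p q : H} (h : dbox p q = 0) : p = q := by
  have := near_dbox p q
  rw [h] at this
  obtain ⟨h1, h2, h3⟩ := this
  simp only [abs_nonpos_iff, sub_eq_zero, ne_eq, OfNat.ofNat_ne_zero, not_false_eq_true, zero_pow,
    add_zero, vert] at h1 h2 h3
  rw [h1, h2] at h3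
  ext
  · exact h1.symm
  · exact h2.symm
  · linarith

lemma Hmul_assoc (p q r : H) : Hmul (Hmul p q) r = Hmul p (Hmul q r) := by
  ext <;> simp only [Hmul] <;> ring

@[simp] lemma Hmul_zero (p : H) : Hmul p 0 = p := by ext <;> simp [Hmul]

@[simp] lemma zero_Hmul (p : H) : Hmul 0 p = p := by ext <;> simp [Hmul]

@[simp] lemma Hinv_Hmul_self (p : H) : Hmul (Hinv p) p = 0 := by
  ext <;> simp [Hmul, Hinv]; ring

@[simp] lemma Hmul_Hinv_self (p : H) : Hmul p (Hinv p) = 0 := by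
  ext <;> simp [Hmul, Hinv]; ring

@[simp] lemma Hinv_Hmul_cancel (p q : H) : Hmul (Hinv p) (Hmul p q) = q := by
  rw [← Hmul_assoc]; simp

@[simp] lemma Hmul_Hinv_cancel (p q : H) : Hmul p (Hmul (Hinv p) q) = q := by
  rw [← Hmul_assoc]; simp

lemma dil_Hmul (t : ℝ) (p q : H) : dil t (Hmul p q) = Hmul (dil t p) (dil t q) := by
  ext <;> simp only [Hmul, dil] <;> ring

lemma dil_dil (s t : ℝ) (p : H) : dil s (dil t p) = dil (s * t) p := by
  ext <;> simp only [dil] <;> ring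

@[simp] lemma dil_one (p : H) : dil 1 p = p := by ext <;> simp [dil]

@[simp] lemma dil_zero (t : ℝ) : dil t (0 : H) = 0 := by ext <;> simp [dil]

lemma dil_dil_inv {t : ℝ} (ht : t ≠ 0) (p : H) : dil t (dil t⁻¹ p) = p := by
  rw [dil_dil, mul_inv_cancel₀ ht, dil_one]

lemma vert_Hmul (g p q : H) : vert (Hmul g p) (Hmul g q) = vert p q := by
  simp only [vert, Hmul]; ring

@[simp] lemma dbox_Hmul (g p q : H) : dbox (Hmul g p) (Hmul g q) = dbox p q := by
  rw [dbox_eq, dbox_eq, vert_Hmul]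
  simp [Hmul]

lemma dbox_dil {t : ℝ} (ht : 0 ≤ t) (p q : H) : dbox (dil t p) (dil t q) = t * dbox p q := by
  have hv : vert (dil t p) (dil t q) = t ^ 2 * vert p q := by simp only [vert, dil]; ring
  have h1 : (dil t q).1 - (dil t p).1 = t * (q.1 - p.1) := by simp only [dil]; ring
  have h2 : (dil t q).2.1 - (dil t p).2.1 = t * (q.2.1 - p.2.1) := by simp only [dil]; ring
  rw [dbox_eq, dbox_eq, hv, h1, h2, abs_mul, abs_mul, abs_mul, abs_of_nonneg ht,
    abs_of_nonneg (sq_nonneg t), Real.sqrt_mul (sq_nonneg t), Real.sqrt_sq ht,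
    mul_max_of_nonneg _ _ ht, mul_max_of_nonneg _ _ ht]

/-- The vertical element of height `t`. -/
def zel (t : ℝ) : H := (0, 0, t)

lemma dbox_Hmul_zel (p : H) (t : ℝ) : dbox p (Hmul p (zel t)) = Real.sqrt |t| := by
  have hv : vert p (Hmul p (zel t)) = t := by simp only [vert, Hmul, zel]; ring
  have h1 : (Hmul p (zel t)).1 - p.1 = 0 := by simp [Hmul, zel]
  have h2 : (Hmul p (zel t)).2.1 - p.2.1 = 0 := by simp [Hmul, zel]
  rw [dbox_eq, hv, h1, h2]
  simp

/-! ### Topology -/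

lemma continuous_Hmul : Continuous fun x : H × H => Hmul x.1 x.2 := by unfold Hmul; fun_prop

lemma continuous_dil : Continuous fun x : ℝ × H => dil x.1 x.2 := by unfold dil; fun_prop

lemma continuous_dbox : Continuous fun x : H × H => dbox x.1 x.2 := by
  simp only [dbox_eq, vert]; fun_prop

lemma tendsto_zero_of_dbox {ι : Type*} {l : Filter ι} {u : ι → H}
    (h : Tendsto (fun j => dbox 0 (u j)) l (𝓝 0)) : Tendsto u l (𝓝 0) := by
  have hn : ∀ j, |(u j).1| ≤ dbox 0 (u j) ∧ |(u j).2.1| ≤ dbox 0 (u j) ∧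
      |(u j).2.2| ≤ dbox 0 (u j) ^ 2 := by
    intro j
    simpa [Near, vert] using near_dbox 0 (u j)
  have h2 : Tendsto (fun j => dbox 0 (u j) ^ 2) l (𝓝 0) := by simpa using h.pow 2
  refine (squeeze_zero_norm (fun j => (hn j).1) h).prodMk_nhds
    ((squeeze_zero_norm (fun j => (hn j).2.1) h).prodMk_nhds
      (squeeze_zero_norm (fun j => (hn j).2.2) h2))

lemma Hmul_Hinv_dbox (p q : H) : dbox 0 (Hmul (Hinv p) q) = dbox p q := by
  rw [← dbox_Hmul p, Hmul_zero, Hmul_Hinv_cancel]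

lemma tendsto_dbox {ι : Type*} {l : Filter ι} {u v : ι → H} {p q : H}
    (hu : Tendsto u l (𝓝 p)) (hv : Tendsto v l (𝓝 q)) :
    Tendsto (fun j => dbox (u j) (v j)) l (𝓝 (dbox p q)) := by
  have h : Tendsto (fun x : H × H => dbox x.1 x.2) (𝓝 (p, q)) (𝓝 (dbox p q)) :=
    continuous_dbox.tendsto' _ _ rfl
  have h2 := h.comp (hu.prodMk_nhds hv)
  simpa only [Function.comp_def] using h2

lemma tendsto_Hmul {ι : Type*} {l : Filter ι} {u v : ι → H} {p q : H}
    (hu : Tendsto u l (𝓝 p)) (hv : Tendsto v l (𝓝 q)) :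
    Tendsto (fun j => Hmul (u j) (v j)) l (𝓝 (Hmul p q)) :=
  Tendsto.comp (g := fun x : H × H => Hmul x.1 x.2) (continuous_Hmul.tendsto (p, q))
    (hu.prodMk_nhds hv)

lemma tendsto_of_dbox {ι : Type*} {l : Filter ι} {u v : ι → H} {p : H}
    (hv : Tendsto v l (𝓝 p)) (h : Tendsto (fun j => dbox (v j) (u j)) l (𝓝 0)) :
    Tendsto u l (𝓝 p) := by
  have h0 : Tendsto (fun j => Hmul (Hinv (v j)) (u j)) l (𝓝 0) :=
    tendsto_zero_of_dbox (by simpa only [Hmul_Hinv_dbox] using h)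
  have h1 : Tendsto (fun j => Hmul (v j) (Hmul (Hinv (v j)) (u j))) l (𝓝 (Hmul p 0)) :=
    tendsto_Hmul hv h0
  simpa only [Hmul_Hinv_cancel, Hmul_zero] using h1

lemma tendsto_dil {ι : Type*} {l : Filter ι} {t : ι → ℝ} {v : ι → H} {s : ℝ} {q : H}
    (hu : Tendsto t l (𝓝 s)) (hv : Tendsto v l (𝓝 q)) :
    Tendsto (fun j => dil (t j) (v j)) l (𝓝 (dil s q)) :=
  Tendsto.comp (g := fun x : ℝ × H => dil x.1 x.2) (continuous_dil.tendsto (s, q))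
    (hu.prodMk_nhds hv)

/-- The closed ball of the box distance. -/
def cball (p : H) (r : ℝ) : Set H := {q | dbox p q ≤ r}

lemma isClosed_cball (p : H) (r : ℝ) : IsClosed (cball p r) :=
  isClosed_le (continuous_dbox.comp (Continuous.prodMk_right p)) continuous_const

lemma isOpen_oball (p : H) (r : ℝ) : IsOpen {q | dbox p q < r} :=
  isOpen_lt (continuous_dbox.comp (Continuous.prodMk_right p)) continuous_const

lemma isCompact_cball (p : H) (r : ℝ) : IsCompact (cball p r) := by
  have h0 : IsCompact (cball 0 r) := by
    refine (((isCompact_Icc (a := -r) (b := r)).prod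
      ((isCompact_Icc (a := -r) (b := r)).prod
        (isCompact_Icc (a := -r ^ 2) (b := r ^ 2))))).of_isClosed_subset (isClosed_cball 0 r) ?_
    intro q hq
    have hr : 0 ≤ r := (dbox_nonneg _ _).trans hq
    have := (dbox_le_iff hr).1 hq
    simp only [Near, vert, Prod.fst_zero, sub_zero, Prod.snd_zero, zero_mul, zero_div, abs_le,
      add_zero] at this
    exact ⟨this.1, this.2.1, this.2.2⟩
  have : cball p r = Hmul p '' cball 0 r := by
    ext q
    constructor
    · intro hq
      exact ⟨Hmul (Hinv p) q, by simpa only [cball, Set.mem_ofPred_eq, Hmul_Hinv_dbox] using hq,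
        by simp⟩
    · rintro ⟨u, hu, rfl⟩
      have := dbox_Hmul p 0 u
      rw [Hmul_zero] at this
      simpa only [cball, Set.mem_ofPred_eq, this] using hu
  rw [this]
  exact h0.image (continuous_Hmul.comp (Continuous.prodMk_right p))

/-! ### Lattice similarities and the shortcut distance -/

/-- The elements of the lattice `ℤ × ℤ × ½ℤ`. -/
def IsLat (g : H) : Prop := ∃ a b c : ℤ, g = ((a : ℝ), (b : ℝ), (c : ℝ) / 2)

lemma IsLat.zero : IsLat 0 := ⟨0, 0, 0, by ext <;> simp⟩

lemma IsLat.mul {g h : H} (hg : IsLat g) (hh : IsLat h) : IsLat (Hmul g h) := by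
  obtain ⟨a, b, c, rfl⟩ := hg
  obtain ⟨a', b', c', rfl⟩ := hh
  refine ⟨a + a', b + b', c + c' + (a * b' - b * a'), ?_⟩
  ext
  · simp [Hmul]
  · simp [Hmul]
  · simp only [Hmul]; push_cast; ring

lemma IsLat.dil {g : H} (hg : IsLat g) (k : ℕ) : IsLat (dil (2 ^ k) g) := by
  obtain ⟨a, b, c, rfl⟩ := hg
  refine ⟨2 ^ k * a, 2 ^ k * b, (2 ^ k) ^ 2 * c, ?_⟩
  ext <;> simp only [Heis.dil] <;> push_cast <;> ring

/-- The similarity `x ↦ δ_{2^{-N}}(g x)`. -/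
noncomputable def Phi (N : ℕ) (g x : H) : H := dil ((1 / 2) ^ N) (Hmul g x)

lemma half_pow_mul_two_pow (n : ℕ) : (1 / 2 : ℝ) ^ n * 2 ^ n = 1 := by
  rw [← mul_pow]; norm_num

lemma dbox_Phi (N : ℕ) (g x y : H) : dbox (Phi N g x) (Phi N g y) = (1 / 2) ^ N * dbox x y := by
  rw [Phi, Phi, dbox_dil (by positivity), dbox_Hmul]

lemma Phi_Phi (N l : ℕ) (g h x : H) :
    Phi N g (Phi l h x) = Phi (N + l) (Hmul (dil (2 ^ l) g) h) x := by
  have e : Hmul g (dil ((1 / 2) ^ l) (Hmul h x)) =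
      dil ((1 / 2) ^ l) (Hmul (Hmul (dil (2 ^ l) g) h) x) := by
    rw [Hmul_assoc, dil_Hmul _ (dil (2 ^ l) g), dil_dil, half_pow_mul_two_pow, dil_one]
  rw [Phi, Phi, Phi, e, dil_dil, pow_add]

lemma Phi_zero (x : H) : Phi 0 0 x = x := by simp [Phi]

lemma continuous_Phi (N : ℕ) (g : H) : Continuous (Phi N g) := by
  unfold Phi Hmul dil; fun_prop

/-- The inverse of `Phi`. -/
noncomputable def PhiInv (N : ℕ) (g x : H) : H := Hmul (Hinv g) (dil (2 ^ N) x)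

lemma PhiInv_Phi (N : ℕ) (g x : H) : PhiInv N g (Phi N g x) = x := by
  rw [PhiInv, Phi, dil_dil, mul_comm, half_pow_mul_two_pow, dil_one, Hinv_Hmul_cancel]

/-- The two basic points joined by a shortcut. -/
noncomputable def bp (e : Bool) : H := (1 / 2, 1 / 2, 1 / 2 + if e then 1 / 64 else 0)

/-- A shortcut from `x` to `y` of cost at most `c`. -/
def Jump (c : ℝ) (x y : H) : Prop :=
  ∃ (l m : ℕ) (g : H) (e : Bool), IsLat g ∧ x = Phi l g (dil ((1 / 2) ^ m) (bp e)) ∧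
    y = Phi l g (dil ((1 / 2) ^ m) (bp !e)) ∧ (1 / 2) ^ l * (1 / 4) ^ m ≤ c

/-- A single step of a chain. -/
def Step (c : ℝ) (x y : H) : Prop := dbox x y ≤ c ∨ Jump c x y

/-- Chains with a given number of steps and a given total cost. -/
inductive Chain : ℕ → ℝ → H → H → Prop
  | nil (x : H) : Chain 0 0 x x
  | cons {n : ℕ} {c c' : ℝ} {x y z : H} : Step c x y → Chain n c' y z → Chain (n + 1) (c + c') x z

/-- The shortcut distance. -/
noncomputable def sdist (x y : H) : ℝ := sInf {c | ∃ n, Chain n c x y}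

lemma Jump.symm {c : ℝ} {x y : H} (h : Jump c x y) : Jump c y x := by
  obtain ⟨l, m, g, e, hg, hx, hy, hc⟩ := h
  exact ⟨l, m, g, !e, hg, hy, by simpa using hx, hc⟩

lemma Jump.pos {c : ℝ} {x y : H} (h : Jump c x y) : 0 < c := by
  obtain ⟨l, m, g, e, hg, hx, hy, hc⟩ := h
  exact lt_of_lt_of_le (by positivity) hc

lemma Step.symm {c : ℝ} {x y : H} (h : Step c x y) : Step c y x :=
  h.imp (fun h => by rwa [dbox_comm]) Jump.symm

lemma Step.nonneg {c : ℝ} {x y : H} (h : Step c x y) : 0 ≤ c :=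
  h.elim (fun h => (dbox_nonneg _ _).trans h) fun h => h.pos.le

lemma Jump.phi {c : ℝ} {x y : H} (h : Jump c x y) (N : ℕ) {g : H} (hg : IsLat g) :
    Jump ((1 / 2) ^ N * c) (Phi N g x) (Phi N g y) := by
  obtain ⟨l, m, g', e, hg', rfl, rfl, hc⟩ := h
  refine ⟨N + l, m, _, e, (hg.dil l).mul hg', Phi_Phi .., Phi_Phi .., ?_⟩
  rw [pow_add, mul_assoc]
  gcongr

lemma Step.phi {c : ℝ} {x y : H} (h : Step c x y) (N : ℕ) {g : H} (hg : IsLat g) :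
    Step ((1 / 2) ^ N * c) (Phi N g x) (Phi N g y) :=
  h.imp (fun h => by rw [dbox_Phi]; gcongr) fun h => h.phi N hg

namespace Chain

lemma nonneg {n : ℕ} {c : ℝ} {x y : H} (h : Chain n c x y) : 0 ≤ c := by
  induction h with
  | nil => exact le_rfl
  | cons hs _ ih => exact add_nonneg hs.nonneg ih

lemma append {n m : ℕ} {c c' : ℝ} {x y z : H} (h : Chain n c x y) (h' : Chain m c' y z) :
    ∃ k, Chain k (c + c') x z := by
  induction h with
  | nil => exact ⟨m, by simpa using h'⟩
  | cons hs _ ih =>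
    obtain ⟨k, hk⟩ := ih h'
    exact ⟨k + 1, by rw [add_assoc]; exact .cons hs hk⟩

lemma single {c : ℝ} {x y : H} (h : Step c x y) : Chain 1 c x y := by
  simpa using Chain.cons h (.nil y)

lemma symm {n : ℕ} {c : ℝ} {x y : H} (h : Chain n c x y) : ∃ k, Chain k c y x := by
  induction h with
  | nil x => exact ⟨0, .nil x⟩
  | cons hs _ ih =>
    obtain ⟨k, hk⟩ := ih
    rw [add_comm]
    exact hk.append (single hs.symm)

lemma phi {n : ℕ} {c : ℝ} {x y : H} (h : Chain n c x y) (N : ℕ) {g : H} (hg : IsLat g) :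
    Chain n ((1 / 2) ^ N * c) (Phi N g x) (Phi N g y) := by
  induction h with
  | nil x => rw [mul_zero]; exact .nil _
  | cons hs _ ih => rw [mul_add]; exact .cons (hs.phi N hg) ih

lemma split {n : ℕ} {c : ℝ} {x y : H} (h : Chain n c x y) {a : ℝ} (ha : 0 ≤ a) (hn : n ≠ 0) :
    ∃ (n₁ n₂ : ℕ) (c₁ c₀ c₂ : ℝ) (u v : H), Chain n₁ c₁ x u ∧ Step c₀ u v ∧ Chain n₂ c₂ v y ∧
      n₁ < n ∧ n₂ < n ∧ c₁ + c₀ + c₂ = c ∧ c₁ ≤ a ∧ (a ≤ c₁ + c₀ ∨ c₂ = 0) := by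
  induction h generalizing a with
  | nil => exact absurd rfl hn
  | @cons n c c' x y z hs hc ih =>
    by_cases hac : a ≤ c
    · exact ⟨0, n, 0, c, c', x, y, .nil x, hs, hc, by omega, by omega, by ring, ha,
        Or.inl (by simpa using hac)⟩
    · by_cases hn0 : n = 0
      · subst hn0
        have hc0 : c' = 0 := by cases hc; rfl
        exact ⟨0, 0, 0, c, c', x, y, .nil x, hs, hc, by omega, by omega, by ring, ha,
          Or.inr hc0⟩
      · obtain ⟨n₁, n₂, c₁, c₀, c₂, u, v, h1, h2, h3, h4, h5, h6, h7, h8⟩ :=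
          ih (a := a - c) (by linarith) hn0
        refine ⟨n₁ + 1, n₂, c + c₁, c₀, c₂, u, v, .cons hs h1, h2, h3, by omega, by omega,
          by linarith, by linarith, h8.imp (fun h => by linarith) id⟩

end Chain

lemma sdist_set_nonempty (x y : H) : {c | ∃ n, Chain n c x y}.Nonempty :=
  ⟨dbox x y, 1, .single (Or.inl le_rfl)⟩

lemma sdist_set_bddBelow (x y : H) : BddBelow {c | ∃ n, Chain n c x y} :=
  ⟨0, by rintro c ⟨n, h⟩; exact h.nonneg⟩

lemma Chain.sdist_le {n : ℕ} {c : ℝ} {x y : H} (h : Chain n c x y) : sdist x y ≤ c :=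
  csInf_le (sdist_set_bddBelow x y) ⟨n, h⟩

lemma sdist_nonneg (x y : H) : 0 ≤ sdist x y :=
  le_csInf (sdist_set_nonempty x y) (by rintro c ⟨n, h⟩; exact h.nonneg)

lemma exists_chain_lt {x y : H} {r : ℝ} (h : sdist x y < r) : ∃ n c, c < r ∧ Chain n c x y := by
  obtain ⟨c, ⟨n, hc⟩, hr⟩ := exists_lt_of_csInf_lt (sdist_set_nonempty x y) h
  exact ⟨n, c, hr, hc⟩

lemma sdist_le_dbox (x y : H) : sdist x y ≤ dbox x y :=
  (Chain.single (Or.inl le_rfl)).sdist_le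

lemma sdist_self (x : H) : sdist x x = 0 :=
  le_antisymm ((sdist_le_dbox x x).trans (dbox_self x).le) (sdist_nonneg x x)

lemma sdist_comm (x y : H) : sdist x y = sdist y x := by
  have : ∀ x y, sdist x y ≤ sdist y x := fun x y => by
    refine le_csInf (sdist_set_nonempty y x) ?_
    rintro c ⟨n, h⟩
    obtain ⟨k, hk⟩ := h.symm
    exact hk.sdist_le
  exact le_antisymm (this _ _) (this _ _)

lemma sdist_triangle (x y z : H) : sdist x z ≤ sdist x y + sdist y z := by
  refine le_of_forall_pos_lt_add fun ε hε => ?_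
  obtain ⟨n, c, hc, h⟩ := exists_chain_lt (show sdist x y < sdist x y + ε / 2 by linarith)
  obtain ⟨n', c', hc', h'⟩ := exists_chain_lt (show sdist y z < sdist y z + ε / 2 by linarith)
  obtain ⟨k, hk⟩ := h.append h'
  linarith [hk.sdist_le]

lemma sdist_Phi_le (N : ℕ) {g : H} (hg : IsLat g) (x y : H) :
    sdist (Phi N g x) (Phi N g y) ≤ (1 / 2) ^ N * sdist x y := by
  rw [← div_le_iff₀' (by positivity)]
  refine le_csInf (sdist_set_nonempty x y) ?_
  rintro c ⟨n, h⟩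
  rw [div_le_iff₀' (by positivity)]
  exact (h.phi N hg).sdist_le

lemma sdist_shortcut (m : ℕ) :
    sdist (dil ((1 / 2) ^ m) (bp false)) (dil ((1 / 2) ^ m) (bp true)) ≤ (1 / 4) ^ m :=
  (Chain.single (Or.inr ⟨0, m, 0, false, IsLat.zero, (Phi_zero _).symm, (Phi_zero _).symm,
    by simp⟩)).sdist_le

/-! ### Separation of shortcuts and comparison with the box distance -/

lemma half_pow_sq (k : ℕ) : ((1 / 2 : ℝ) ^ k) ^ 2 = (1 / 4) ^ k := by
  rw [← pow_mul, mul_comm, pow_mul]; norm_num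

lemma one_le_abs_of_ne_zero {n : ℤ} (h : n ≠ 0) : (1 : ℝ) ≤ |(n : ℝ)| := by
  have := Int.one_le_abs h
  exact_mod_cast this

lemma site_sep_lt {k k' : ℕ} {γ γ' : H} {e e' : Bool} {ℓ : ℝ} (hγ : IsLat γ) (hγ' : IsLat γ')
    (hk : k < k') (h : |(Phi k' γ' (bp e')).1 - (Phi k γ (bp e)).1| ≤ ℓ) :
    (1 / 64) * (1 / 4) ^ k' ≤ ℓ ^ 2 / 6 := by
  obtain ⟨j, rfl⟩ := Nat.exists_eq_add_of_lt hk
  obtain ⟨a, b, c, rfl⟩ := hγ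
  obtain ⟨a', b', c', rfl⟩ := hγ'
  have e1 : (Phi (k + j + 1) ((a' : ℝ), (b' : ℝ), (c' : ℝ) / 2) (bp e')).1 -
      (Phi k ((a : ℝ), (b : ℝ), (c : ℝ) / 2) (bp e)).1 =
      (1 / 2) ^ (k + j + 1) / 2 * ((2 * (a' - 2 ^ j * (2 * a + 1)) + 1 : ℤ) : ℝ) := by
    simp only [Phi, dil, Hmul, bp]
    have : (1 / 2 : ℝ) ^ k = (1 / 2) ^ (k + j + 1) * 2 ^ (j + 1) := by
      rw [add_assoc, pow_add, mul_assoc, half_pow_mul_two_pow, mul_one]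
    rw [this]; push_cast; ring
  rw [e1, abs_mul, abs_of_nonneg (by positivity)] at h
  have h1 : (1 : ℝ) ≤ |((2 * (a' - 2 ^ j * (2 * a + 1)) + 1 : ℤ) : ℝ)| :=
    one_le_abs_of_ne_zero (by omega)
  have hs : 0 < (1 / 2 : ℝ) ^ (k + j + 1) := by positivity
  rw [← half_pow_sq]
  have h2 : (1 / 2 : ℝ) ^ (k + j + 1) ≤ 2 * ℓ := by nlinarith
  nlinarith

lemma site_sep_eq {k : ℕ} {γ γ' : H} {e e' : Bool} {ℓ : ℝ} (hγ : IsLat γ) (hγ' : IsLat γ')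
    (hne : γ ≠ γ') (h : Near ℓ (ℓ ^ 2) (Phi k γ (bp e)) (Phi k γ' (bp e'))) :
    (1 / 64) * (1 / 4) ^ k ≤ ℓ ^ 2 / 6 := by
  obtain ⟨a, b, c, rfl⟩ := hγ
  obtain ⟨a', b', c', rfl⟩ := hγ'
  obtain ⟨h1, h2, h3⟩ := h
  have hs : 0 < (1 / 2 : ℝ) ^ k := by positivity
  rw [← half_pow_sq]
  set s := (1 / 2 : ℝ) ^ k with hsd
  by_cases ha : a = a'
  · by_cases hb : b = b'
    · subst ha hb
      have hc : c' - c ≠ 0 := by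
        intro h; apply hne; rw [show c' = c by omega]
      have e1 : vert (Phi k ((a : ℝ), (b : ℝ), (c : ℝ) / 2) (bp e))
          (Phi k ((a : ℝ), (b : ℝ), (c' : ℝ) / 2) (bp e')) = s ^ 2 * (((c' - c : ℤ) : ℝ) / 2 +
            ((if e' then 1 / 64 else 0) - (if e then 1 / 64 else 0))) := by
        simp only [vert, Phi, dil, Hmul, bp, ← hsd]; push_cast; ring
      rw [e1, abs_mul, abs_of_nonneg (by positivity)] at h3
      have h4 := one_le_abs_of_ne_zero hc
      have h5 : (31 / 64 : ℝ) ≤ |((c' - c : ℤ) : ℝ) / 2 +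
            ((if e' then 1 / 64 else 0) - (if e then 1 / 64 else 0))| := by
        have h6 : |((if e' then 1 / 64 else 0) - (if e then 1 / 64 else 0) : ℝ)| ≤ 1 / 64 := by
          split_ifs <;> norm_num
        rw [abs_le] at h6
        rw [le_abs] at h4 ⊢
        rcases h4 with h4 | h4
        · left; linarith
        · right; linarith
      have := mul_le_mul_of_nonneg_left h5 (sq_nonneg s)
      nlinarith
    · have e1 : (Phi k ((a' : ℝ), (b' : ℝ), (c' : ℝ) / 2) (bp e')).2.1 -
          (Phi k ((a : ℝ), (b : ℝ), (c : ℝ) / 2) (bp e)).2.1 = s * ((b' - b : ℤ) : ℝ) := by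
        simp only [Phi, dil, Hmul, bp, ← hsd]; push_cast; ring
      rw [e1, abs_mul, abs_of_nonneg hs.le] at h2
      have h4 := one_le_abs_of_ne_zero (show b' - b ≠ 0 by omega)
      have h5 : s ≤ ℓ := by nlinarith
      nlinarith
  · have e1 : (Phi k ((a' : ℝ), (b' : ℝ), (c' : ℝ) / 2) (bp e')).1 -
        (Phi k ((a : ℝ), (b : ℝ), (c : ℝ) / 2) (bp e)).1 = s * ((a' - a : ℤ) : ℝ) := by
      simp only [Phi, dil, Hmul, bp, ← hsd]; push_cast; ring
    rw [e1, abs_mul, abs_of_nonneg hs.le] at h1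
    have h4 := one_le_abs_of_ne_zero (show a' - a ≠ 0 by omega)
    have h5 : s ≤ ℓ := by nlinarith
    nlinarith

lemma site_sep {k k' : ℕ} {γ γ' : H} {e e' : Bool} {ℓ : ℝ} (hγ : IsLat γ) (hγ' : IsLat γ')
    (hne : ¬(k = k' ∧ γ = γ')) (h : Near ℓ (ℓ ^ 2) (Phi k γ (bp e)) (Phi k' γ' (bp e'))) :
    (1 / 64) * (1 / 4) ^ k ≤ ℓ ^ 2 / 6 ∧ k' ≤ k ∨ (1 / 64) * (1 / 4) ^ k' ≤ ℓ ^ 2 / 6 ∧ k ≤ k' := by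
  rcases lt_trichotomy k k' with hk | rfl | hk
  · exact Or.inr ⟨site_sep_lt hγ hγ' hk h.1, hk.le⟩
  · exact Or.inl ⟨site_sep_eq hγ hγ' (fun h => hne ⟨rfl, h⟩) h, le_rfl⟩
  · exact Or.inl ⟨site_sep_lt hγ' hγ hk h.symm.1, hk.le⟩

lemma near_site (k : ℕ) (γ : H) (e e' : Bool) :
    Near 0 (1 / 64 * (1 / 4) ^ k) (Phi k γ (bp e)) (Phi k γ (bp e')) := by
  refine ⟨by simp [Phi, dil, Hmul, bp], by simp [Phi, dil, Hmul, bp], ?_⟩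
  have : vert (Phi k γ (bp e)) (Phi k γ (bp e')) =
      (1 / 4) ^ k * ((if e' then 1 / 64 else 0) - (if e then 1 / 64 else 0)) := by
    rw [← half_pow_sq]; simp only [vert, Phi, dil, Hmul, bp]; ring
  rw [this, abs_mul, abs_of_nonneg (by positivity), mul_comm]
  have h6 : |((if e' then 1 / 64 else 0) - (if e then 1 / 64 else 0) : ℝ)| ≤ 1 / 64 := by
    split_ifs <;> norm_num
  have : (0 : ℝ) ≤ (1 / 4) ^ k := by positivity
  nlinarith

/-- `y` can be reached from `x` by a short move, or by two short moves and one shortcut. -/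
def Reach (cap ω θ : ℝ) (x y : H) : Prop :=
  Near ω θ x y ∨ ∃ (k : ℕ) (γ : H) (e : Bool) (ω₁ θ₁ ω₂ θ₂ : ℝ), IsLat γ ∧ (1 / 4) ^ k ≤ cap ∧
    Near ω₁ θ₁ x (Phi k γ (bp e)) ∧ Near ω₂ θ₂ (Phi k γ (bp !e)) y ∧ ω₁ + ω₂ ≤ ω ∧ θ₁ + θ₂ ≤ θ ∧
    0 ≤ θ₁ ∧ 0 ≤ θ₂

lemma Near.nonneg {ω θ : ℝ} {x y : H} (h : Near ω θ x y) : 0 ≤ ω := (abs_nonneg _).trans h.1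

lemma Reach.mono {cap ω θ cap' ω' θ' : ℝ} {x y : H} (h : Reach cap ω θ x y) (hc : cap ≤ cap')
    (hω : ω ≤ ω') (hθ : θ ≤ θ') : Reach cap' ω' θ' x y := by
  rcases h with h | ⟨k, γ, e, ω₁, θ₁, ω₂, θ₂, h1, h2, h3, h4, h5, h6, h7⟩
  · exact Or.inl (h.mono hω hθ)
  · exact Or.inr ⟨k, γ, e, ω₁, θ₁, ω₂, θ₂, h1, h2.trans hc, h3, h4, h5.trans hω, h6.trans hθ, h7⟩

lemma Reach.trans {cap ω θ ω' θ' ℓ : ℝ} {x y z : H} (h : Reach cap ω θ x y)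
    (h' : Reach cap ω' θ' y z) (hω : ω + ω' ≤ ℓ) (hθ : θ + θ' ≤ ℓ ^ 2) (hθ0 : 0 ≤ θ)
    (hθ0' : 0 ≤ θ') : Reach cap (ω + ω') (θ + θ' + ℓ ^ 2 / 6) x z := by
  have hℓ := sq_nonneg ℓ
  rcases h with h | ⟨k, γ, e, ω₁, θ₁, ω₂, θ₂, h1, h2, h3, h4, h5, h6, h7, h8⟩
  · rcases h' with h' | ⟨k', γ', e', ω₁', θ₁', ω₂', θ₂', h1', h2', h3', h4', h5', h6', h7', h8'⟩
    · exact Or.inl ((h.trans h').mono le_rfl (by linarith))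
    · exact Or.inr ⟨k', γ', e', _, _, _, _, h1', h2', h.trans h3', h4', by linarith, by linarith,
        by linarith, h8'⟩
  · rcases h' with h' | ⟨k', γ', e', ω₁', θ₁', ω₂', θ₂', h1', h2', h3', h4', h5', h6', h7', h8'⟩
    · exact Or.inr ⟨k, γ, e, _, _, _, _, h1, h2, h3, h4.trans h', by linarith, by linarith,
        h7, by linarith⟩
    · have n3 := h3.nonneg
      have n4 := h4.nonneg
      have n3' := h3'.nonneg
      have n4' := h4'.nonneg
      have hm := h4.trans h3'
      by_cases heq : k = k' ∧ γ = γ'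
      · obtain ⟨rfl, rfl⟩ := heq
        by_cases hee : e' = e
        · subst hee
          exact Or.inr ⟨k, γ, e', _, _, _, _, h1, h2, h3, h4', by linarith, by linarith, h7, h8'⟩
        · have : (!e') = e := by revert hee; cases e <;> cases e' <;> simp
          rw [this] at h4'
          exact Or.inl ((h3.trans h4').mono (by linarith) (by linarith))
      · have hm' := hm.mono (show _ ≤ ℓ by linarith) (show _ ≤ ℓ ^ 2 by linarith)
        rcases site_sep h1 h1' heq hm' with ⟨hs, -⟩ | ⟨hs, -⟩
        · refine Or.inr ⟨k', γ', e', _, _, _, _, h1', h2',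
            (h3.trans ((near_site k γ e (!e)).trans hm)), h4', by linarith, by linarith, ?_, h8'⟩
          have : (0 : ℝ) ≤ 1 / 64 * (1 / 4) ^ k := by positivity
          linarith
        · refine Or.inr ⟨k, γ, e, _, _, _, _, h1, h2, h3,
            (hm.trans (near_site k' γ' e' (!e'))).trans h4', by linarith, by linarith, h7, ?_⟩
          have : (0 : ℝ) ≤ 1 / 64 * (1 / 4) ^ k' := by positivity
          linarith

lemma Jump.site {c : ℝ} {x y : H} (h : Jump c x y) : ∃ (k : ℕ) (γ : H) (e : Bool), IsLat γ ∧
    (1 / 4) ^ k ≤ c ∧ x = Phi k γ (bp e) ∧ y = Phi k γ (bp !e) := by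
  obtain ⟨l, m, g, e, hg, rfl, rfl, hc⟩ := h
  have e1 : ∀ p, Phi l g (dil ((1 / 2) ^ m) p) = Phi (l + m) (dil (2 ^ m) g) p := by
    intro p
    have := Phi_Phi l m g 0 p
    rw [Hmul_zero] at this
    rw [← this]
    simp [Phi]
  refine ⟨l + m, _, e, hg.dil m, ?_, e1 _, e1 _⟩
  refine le_trans ?_ hc
  rw [pow_add]
  gcongr
  norm_num

lemma Step.reach {c : ℝ} {x y : H} (h : Step c x y) : Reach c c 0 x y := by
  rcases h with h | h
  · exact Or.inl ((dbox_le_iff ((dbox_nonneg _ _).trans h)).1 h)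
  · have hc := h.pos
    obtain ⟨k, γ, e, hγ, hk, rfl, rfl⟩ := h.site
    have hr : ∀ p : H, Near 0 0 p p := fun p => by simp [Near, vert, mul_comm]
    exact Or.inr ⟨k, γ, e, 0, 0, 0, 0, hγ, hk, hr _, hr _, by linarith, by linarith, le_rfl, le_rfl⟩

lemma Chain.reach {n : ℕ} {ℓ : ℝ} {x y : H} (h : Chain n ℓ x y) : Reach ℓ ℓ (ℓ ^ 2) x y := by
  induction n using Nat.strong_induction_on generalizing ℓ x y with
  | _ n ih =>
    have hℓ := h.nonneg
    by_cases hn : n = 0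
    · subst hn
      cases h
      exact Or.inl (by simp [Near, vert, mul_comm])
    obtain ⟨n₁, n₂, c₁, c₀, c₂, u, v, h1, h2, h3, h4, h5, h6, h7, h8⟩ :=
      h.split (a := ℓ / 2) (by linarith) hn
    have p1 := h1.nonneg
    have p2 := h2.nonneg
    have p3 := h3.nonneg
    have hc2 : c₂ ≤ ℓ / 2 := by rcases h8 with h8 | h8 <;> linarith
    have r1 := (ih n₁ h4 h1).mono (show c₁ ≤ ℓ by linarith) le_rfl le_rfl
    have r2 := (ih n₂ h5 h3).mono (show c₂ ≤ ℓ by linarith) le_rfl le_rfl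
    have r0 := h2.reach.mono (show c₀ ≤ ℓ by linarith) le_rfl le_rfl
    have r3 := r1.trans r0 (ℓ := ℓ) (by linarith) (by nlinarith) (sq_nonneg _) le_rfl
    have r4 := r3.trans r2 (ℓ := ℓ) (by linarith) (by nlinarith) (by positivity) (sq_nonneg _)
    exact r4.mono le_rfl (by linarith) (by nlinarith)

lemma reach_of_sdist_lt {x y : H} {r : ℝ} (h : sdist x y < r) :
    ∃ ℓ, 0 ≤ ℓ ∧ ℓ < r ∧ Reach ℓ ℓ (ℓ ^ 2) x y := by
  obtain ⟨n, c, hc, h⟩ := exists_chain_lt h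
  exact ⟨c, h.nonneg, hc, h.reach⟩

lemma dbox_le_of_sdist_lt {x y : H} {r : ℝ} (h : sdist x y < r) :
    dbox x y ≤ 2 * r + Real.sqrt r := by
  obtain ⟨ℓ, h0, hr, h⟩ := reach_of_sdist_lt h
  have hs := Real.sq_sqrt (h0.trans hr.le)
  have hs0 := Real.sqrt_nonneg r
  rcases h with h | ⟨k, γ, e, ω₁, θ₁, ω₂, θ₂, h1, h2, h3, h4, h5, h6, h7, h8⟩
  · exact h.dbox_le (by linarith) (by nlinarith)
  · refine ((h3.trans (near_site k γ e (!e))).trans h4).dbox_le (by linarith) ?_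
    have n3 := h3.nonneg
    have n4 := h4.nonneg
    have : (ω₁ + 0 + ω₂) ^ 2 ≤ ℓ ^ 2 := by
      gcongr; linarith
    nlinarith

lemma eq_of_sdist_eq_zero {x y : H} (h : sdist x y = 0) : x = y := by
  apply eq_of_dbox_eq_zero
  refine le_antisymm ?_ (dbox_nonneg x y)
  have h1 : Tendsto (fun r : ℝ => 2 * r + Real.sqrt r) (𝓝[>] 0) (𝓝 0) := by
    have : Continuous fun r : ℝ => 2 * r + Real.sqrt r := by fun_prop
    have h2 := (this.tendsto 0).mono_left (nhdsWithin_le_nhds (s := Set.Ioi 0))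
    simpa using h2
  refine ge_of_tendsto h1 ?_
  filter_upwards [self_mem_nhdsWithin] with r hr
  exact dbox_le_of_sdist_lt (by rw [h]; exact hr)

/-- Balls of the shortcut distance are covered by three comparable balls of the box distance. -/
lemma exists_three_balls (x : H) {r : ℝ} (hr : 0 < r) : ∃ y₁ y₂ : H, ∀ y, sdist x y < r →
    dbox x y ≤ 2 * r ∨ dbox y₁ y ≤ 2 * r ∨ dbox y₂ y ≤ 2 * r := by
  by_cases hbig : ∃ (k : ℕ) (γ : H) (e : Bool) (ω θ : ℝ), IsLat γ ∧ ω ≤ r ∧ θ ≤ r ^ 2 ∧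
      Near ω θ x (Phi k γ (bp e)) ∧ (2 * r) ^ 2 / 6 < 1 / 64 * (1 / 4) ^ k
  · obtain ⟨k, γ, e, ω, θ, hγ, hω, hθ, hn, hk⟩ := hbig
    refine ⟨Phi k γ (bp true), Phi k γ (bp false), fun y hy => ?_⟩
    obtain ⟨ℓ, h0, hr, h⟩ := reach_of_sdist_lt hy
    rcases h with h | ⟨k', γ', e', ω₁, θ₁, ω₂, θ₂, h1, h2, h3, h4, h5, h6, h7, h8⟩
    · exact Or.inl (h.dbox_le (by linarith) (by nlinarith))
    have n3 := h3.nonneg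
    have n4 := h4.nonneg
    by_cases hk' : (2 * r) ^ 2 / 6 < 1 / 64 * (1 / 4) ^ k'
    · by_cases heq : k = k' ∧ γ = γ'
      · obtain ⟨rfl, rfl⟩ := heq
        have : dbox (Phi k γ (bp !e')) y ≤ 2 * r := h4.dbox_le (by linarith) (by nlinarith)
        cases e'
        · exact Or.inr (Or.inl this)
        · exact Or.inr (Or.inr this)
      · have := (hn.symm.trans h3).mono (show _ ≤ 2 * r by linarith)
          (show _ ≤ (2 * r) ^ 2 by nlinarith)
        rcases site_sep hγ h1 heq this with ⟨h, -⟩ | ⟨h, -⟩ <;> linarith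
    · left
      refine ((h3.trans (near_site k' γ' e' (!e'))).trans h4).dbox_le (by linarith) ?_
      have : (ω₁ + 0 + ω₂) ^ 2 ≤ ℓ ^ 2 := by
        gcongr; linarith
      nlinarith
  · refine ⟨x, x, fun y hy => ?_⟩
    obtain ⟨ℓ, h0, hr, h⟩ := reach_of_sdist_lt hy
    left
    rcases h with h | ⟨k', γ', e', ω₁, θ₁, ω₂, θ₂, h1, h2, h3, h4, h5, h6, h7, h8⟩
    · exact h.dbox_le (by linarith) (by nlinarith)
    have n3 := h3.nonneg
    have n4 := h4.nonneg
    have hk' : 1 / 64 * (1 / 4) ^ k' ≤ (2 * r) ^ 2 / 6 := by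
      by_contra hcon
      exact hbig ⟨k', γ', e', ω₁, θ₁, h1, by linarith, by nlinarith, h3, not_le.1 hcon⟩
    refine ((h3.trans (near_site k' γ' e' (!e'))).trans h4).dbox_le (by linarith) ?_
    have : (ω₁ + 0 + ω₂) ^ 2 ≤ ℓ ^ 2 := by
      gcongr; linarith
    nlinarith

/-! ### The self-similar tile -/

/-- The sixteen digits of the tile. -/
noncomputable def dig (i : Fin 2 × Fin 2 × Fin 4) : H :=
  (((i.1 : ℕ) : ℝ), ((i.2.1 : ℕ) : ℝ), ((i.2.2 : ℕ) : ℝ))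

lemma IsLat_dig (i : Fin 2 × Fin 2 × Fin 4) : IsLat (dig i) :=
  ⟨(i.1 : ℕ), (i.2.1 : ℕ), 2 * (i.2.2 : ℕ), by ext <;> simp [dig]⟩

/-- A box containing the tile. -/
def tbox : Set H := Set.Icc 0 1 ×ˢ (Set.Icc 0 1 ×ˢ Set.Icc (-1 / 6) (7 / 6))

lemma isCompact_tbox : IsCompact tbox :=
  isCompact_Icc.prod (isCompact_Icc.prod isCompact_Icc)

/-- The tile: the largest set contained in `tbox` which is covered by its sixteen small copies. -/
def tile : Set H := ⋃₀ {S | S ⊆ tbox ∧ S ⊆ ⋃ i, Phi 1 (dig i) '' S}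

lemma tile_subset_tbox : tile ⊆ tbox := Set.sUnion_subset fun _ hS => hS.1

lemma subset_tile {S : Set H} (h : S ⊆ tbox) (h' : S ⊆ ⋃ i, Phi 1 (dig i) '' S) : S ⊆ tile :=
  Set.subset_sUnion_of_mem ⟨h, h'⟩

lemma tile_subset_iUnion : tile ⊆ ⋃ i, Phi 1 (dig i) '' tile := by
  refine Set.sUnion_subset fun S hS => hS.2.trans ?_
  gcongr
  exact subset_tile hS.1 hS.2

lemma Phi_dig_mem_tbox (i : Fin 2 × Fin 2 × Fin 4) {p : H} (hp : p ∈ tbox) :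
    Phi 1 (dig i) p ∈ tbox := by
  obtain ⟨a, b, c⟩ := i
  obtain ⟨⟨h1, h2⟩, ⟨h3, h4⟩, ⟨h5, h6⟩⟩ := hp
  have key : ∀ a b c : ℝ, 0 ≤ a → a ≤ 1 → 0 ≤ b → b ≤ 1 → 0 ≤ c → c ≤ 3 →
      Phi 1 (a, b, c) p ∈ tbox := by
    intro a b c ha ha' hb hb' hc hc'
    have m1 : 0 ≤ a * p.2.1 := mul_nonneg ha h3
    have m2 : a * p.2.1 ≤ 1 := mul_le_one₀ ha' h3 h4
    have m3 : 0 ≤ b * p.1 := mul_nonneg hb h1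
    have m4 : b * p.1 ≤ 1 := mul_le_one₀ hb' h1 h2
    refine ⟨⟨?_, ?_⟩, ⟨?_, ?_⟩, ⟨?_, ?_⟩⟩ <;> simp only [Phi, dil, Hmul] <;> linarith
  have ha : (a : ℕ) ≤ 1 := by omega
  have hb : (b : ℕ) ≤ 1 := by omega
  have hc : (c : ℕ) ≤ 3 := by omega
  exact key _ _ _ (by positivity) (by exact_mod_cast ha) (by positivity) (by exact_mod_cast hb)
    (by positivity) (by exact_mod_cast hc)

lemma Phi_dig_mem_tile (i : Fin 2 × Fin 2 × Fin 4) {p : H} (hp : p ∈ tile) :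
    Phi 1 (dig i) p ∈ tile := by
  have h1 : (⋃ i, Phi 1 (dig i) '' tile) ⊆ tile := by
    refine subset_tile ?_ ?_
    · refine Set.iUnion_subset fun i => ?_
      rintro _ ⟨p, hp, rfl⟩
      exact Phi_dig_mem_tbox i (tile_subset_tbox hp)
    · refine Set.iUnion_mono fun i => Set.image_mono tile_subset_iUnion
  exact h1 (Set.mem_iUnion_of_mem i ⟨p, hp, rfl⟩)

lemma isClosed_tile : IsClosed tile := by
  have hc : closure tile ⊆ tbox := closure_minimal tile_subset_tbox isCompact_tbox.isClosed
  have hK : IsCompact (closure tile) := isCompact_tbox.of_isClosed_subset isClosed_closure hc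
  refine isClosed_of_closure_subset (subset_tile hc (closure_minimal ?_ ?_))
  · refine tile_subset_iUnion.trans ?_
    gcongr
    exact subset_closure
  · exact isClosed_iUnion_of_finite fun i => (hK.image (continuous_Phi 1 (dig i))).isClosed

lemma isCompact_tile : IsCompact tile :=
  isCompact_tbox.of_isClosed_subset isClosed_tile tile_subset_tbox

lemma dbox_le_two_of_tile {p q : H} (hp : p ∈ tile) (hq : q ∈ tile) : dbox p q ≤ 2 := by
  obtain ⟨⟨h1, h2⟩, ⟨h3, h4⟩, ⟨h5, h6⟩⟩ := tile_subset_tbox hp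
  obtain ⟨⟨k1, k2⟩, ⟨k3, k4⟩, ⟨k5, k6⟩⟩ := tile_subset_tbox hq
  rw [dbox_le_iff (by norm_num)]
  have m1 : 0 ≤ p.1 * q.2.1 := mul_nonneg h1 k3
  have m2 : p.1 * q.2.1 ≤ 1 := mul_le_one₀ h2 k3 k4
  have m3 : 0 ≤ p.2.1 * q.1 := mul_nonneg h3 k1
  have m4 : p.2.1 * q.1 ≤ 1 := mul_le_one₀ h4 k1 k2
  refine ⟨?_, ?_, ?_⟩ <;> rw [abs_le] <;> constructor <;> (try unfold vert) <;> linarith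

lemma exists_quarter_fixed {X : Type*} (F : X → X) (h : X → ℝ) (hb : ∀ v, |h v| ≤ 1 / 2) :
    ∃ ψ : X → ℝ, (∀ v, |ψ v| ≤ 1 / 6) ∧ ∀ v, ψ v = (h v + ψ (F v)) / 4 := by
  have hg : HasSum (fun k : ℕ => (1 / 4 : ℝ) ^ k * (1 / 8)) (1 / 6) := by
    have := (hasSum_geometric_of_lt_one (r := (1 / 4 : ℝ)) (by norm_num) (by norm_num)).mul_right
      (1 / 8)
    norm_num at this ⊢
    exact this
  have hle : ∀ v k, ‖(1 / 4 : ℝ) ^ (k + 1) * h (F^[k] v)‖ ≤ (1 / 4 : ℝ) ^ k * (1 / 8) := by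
    intro v k
    rw [norm_mul, Real.norm_of_nonneg (by positivity), Real.norm_eq_abs, pow_succ, mul_assoc]
    gcongr
    linarith [hb (F^[k] v)]
  refine ⟨fun v => ∑' k : ℕ, (1 / 4) ^ (k + 1) * h (F^[k] v), fun v => ?_, fun v => ?_⟩
  · rw [← Real.norm_eq_abs]
    exact tsum_of_norm_bounded hg (hle v)
  · have hs : Summable fun k : ℕ => (1 / 4 : ℝ) ^ (k + 1) * h (F^[k] v) :=
      Summable.of_norm_bounded hg.summable (hle v)
    simp only
    rw [hs.tsum_eq_zero_add, add_div, ← tsum_div_const]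
    congr 1
    · simp; ring
    · congr 1; ext k
      rw [Function.iterate_succ_apply, pow_succ]; ring

lemma interior_tile_aux : Set.Ioo 0 1 ×ˢ (Set.Ioo 0 1 ×ˢ Set.Ioo (1 / 6) (5 / 6)) ⊆ tile := by
  classical
  let F : ℝ × ℝ → ℝ × ℝ := fun v => (Int.fract (2 * v.1), Int.fract (2 * v.2))
  let h : ℝ × ℝ → ℝ := fun v => if v ∈ Set.Ico (0 : ℝ) 1 ×ˢ Set.Ico (0 : ℝ) 1 then
    (⌊2 * v.1⌋ * Int.fract (2 * v.2) - ⌊2 * v.2⌋ * Int.fract (2 * v.1)) / 2 else 0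
  have hfl : ∀ t : ℝ, t ∈ Set.Ico (0 : ℝ) 1 → ⌊2 * t⌋ = 0 ∨ ⌊2 * t⌋ = 1 := by
    intro t ht
    have h1 : 0 ≤ ⌊2 * t⌋ := Int.floor_nonneg.2 (by linarith [ht.1])
    have h2 : ⌊2 * t⌋ < 2 := Int.floor_lt.2 (by push_cast; linarith [ht.2])
    omega
  have hfr : ∀ t : ℝ, Int.fract t ∈ Set.Ico (0 : ℝ) 1 := fun t =>
    ⟨Int.fract_nonneg t, Int.fract_lt_one t⟩
  have hb : ∀ v, |h v| ≤ 1 / 2 := by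
    intro v
    simp only [h]
    split_ifs with hv
    · have f1 := hfr (2 * v.1)
      have f2 := hfr (2 * v.2)
      rcases hfl _ hv.1 with h1 | h1 <;> rcases hfl _ hv.2 with h2 | h2 <;> rw [h1, h2, abs_le] <;>
        constructor <;> push_cast <;> linarith [f1.1, f1.2, f2.1, f2.2]
    · norm_num
  obtain ⟨ψ, hψ1, hψ2⟩ := exists_quarter_fixed F h hb
  let S : Set H := {p | p.1 ∈ Set.Ico (0 : ℝ) 1 ∧ p.2.1 ∈ Set.Ico (0 : ℝ) 1 ∧
    ψ (p.1, p.2.1) ≤ p.2.2 ∧ p.2.2 ≤ ψ (p.1, p.2.1) + 1}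
  have hS : S ⊆ tile := by
    refine subset_tile ?_ ?_
    · rintro ⟨x, y, z⟩ ⟨⟨h1, h2⟩, ⟨h3, h4⟩, h5, h6⟩
      have := abs_le.1 (hψ1 (x, y))
      simp only at h1 h2 h3 h4 h5 h6
      refine ⟨⟨h1, h2.le⟩, ⟨h3, h4.le⟩, ?_, ?_⟩ <;> simp only <;> linarith
    · rintro ⟨x, y, z⟩ ⟨h12, h34, h5, h6⟩
      simp only at h12 h34 h5 h6
      have e := hψ2 (x, y)
      have eh : h (x, y) = (⌊2 * x⌋ * Int.fract (2 * y) - ⌊2 * y⌋ * Int.fract (2 * x)) / 2 :=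
        if_pos ⟨h12, h34⟩
      obtain ⟨a, ha⟩ : ∃ a : Fin 2, (⌊2 * x⌋ : ℝ) = ((a : ℕ) : ℝ) := by
        rcases hfl x h12 with h | h
        · exact ⟨0, by simp [h]⟩
        · exact ⟨1, by simp [h]⟩
      obtain ⟨b, hb⟩ : ∃ b : Fin 2, (⌊2 * y⌋ : ℝ) = ((b : ℕ) : ℝ) := by
        rcases hfl y h34 with h | h
        · exact ⟨0, by simp [h]⟩
        · exact ⟨1, by simp [h]⟩
      obtain ⟨c, hc1, hc2⟩ : ∃ c : Fin 4, ((c : ℕ) : ℝ) ≤ 4 * (z - ψ (x, y)) ∧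
          4 * (z - ψ (x, y)) ≤ ((c : ℕ) : ℝ) + 1 := by
        rcases le_total (4 * (z - ψ (x, y))) 1 with q | q
        · exact ⟨0, by simp; linarith, by simpa using q⟩
        rcases le_total (4 * (z - ψ (x, y))) 2 with q' | q'
        · exact ⟨1, by simpa using q, by norm_num; linarith⟩
        rcases le_total (4 * (z - ψ (x, y))) 3 with q'' | q''
        · exact ⟨2, by simpa using q', by norm_num; linarith⟩
        · exact ⟨3, by norm_num; linarith, by norm_num; linarith⟩
      refine Set.mem_iUnion.2 ⟨(a, b, c), (Int.fract (2 * x), Int.fract (2 * y),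
        4 * z - ((c : ℕ) : ℝ) - h (x, y)), ⟨hfr _, hfr _, ?_, ?_⟩, ?_⟩
      · simp only; change ψ (F (x, y)) ≤ _; linarith
      · simp only; change _ ≤ ψ (F (x, y)) + 1; linarith
      · have f1 := Int.fract_add_floor (2 * x)
        have f2 := Int.fract_add_floor (2 * y)
        rw [ha] at f1
        rw [hb] at f2
        rw [ha, hb] at eh
        ext
        · simp only [Phi, dil, Hmul, dig]; linarith
        · simp only [Phi, dil, Hmul, dig]; linarith
        · simp only [Phi, dil, Hmul, dig]; rw [eh]; ring
  rintro ⟨x, y, z⟩ ⟨h1, h2, h3, h4⟩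
  have := abs_le.1 (hψ1 (x, y))
  exact hS ⟨⟨h1.1.le, h1.2⟩, ⟨h2.1.le, h2.2⟩, by simp only at h3 ⊢; linarith,
    by simp only at h4 ⊢; linarith⟩

lemma tile_mem_nhds : tile ∈ 𝓝 ((1 / 2, 1 / 2, 1 / 2) : H) := by
  refine mem_of_superset (IsOpen.mem_nhds (isOpen_Ioo.prod (isOpen_Ioo.prod isOpen_Ioo)) ?_)
    interior_tile_aux
  refine ⟨⟨?_, ?_⟩, ⟨?_, ?_⟩, ?_, ?_⟩ <;> norm_num

/-- The elements `g` for which `Phi N g` maps the tile onto a subtile of level `N`. -/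
inductive Addr : ℕ → H → Prop
  | zero : Addr 0 0
  | succ {N : ℕ} {g : H} (i : Fin 2 × Fin 2 × Fin 4) : Addr N g →
      Addr (N + 1) (Hmul (dil (2 ^ 1) g) (dig i))

lemma Addr.isLat {N : ℕ} {g : H} (h : Addr N g) : IsLat g := by
  induction h with
  | zero => exact IsLat.zero
  | succ i _ ih => exact (ih.dil 1).mul (IsLat_dig i)

lemma Addr.mem_tile {N : ℕ} {g : H} (h : Addr N g) {p : H} (hp : p ∈ tile) : Phi N g p ∈ tile := by
  induction h generalizing p with
  | zero => rwa [Phi_zero]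
  | succ i _ ih => rw [← Phi_Phi]; exact ih (Phi_dig_mem_tile i hp)

lemma exists_addr (N : ℕ) {x : H} (hx : x ∈ tile) : ∃ g, Addr N g ∧ ∃ p ∈ tile, Phi N g p = x := by
  induction N with
  | zero => exact ⟨0, .zero, x, hx, Phi_zero x⟩
  | succ N ih =>
    obtain ⟨g, hg, p, hp, rfl⟩ := ih
    obtain ⟨i, q, hq, rfl⟩ := Set.mem_iUnion.1 (tile_subset_iUnion hp)
    exact ⟨_, .succ i hg, q, hq, (Phi_Phi ..).symm⟩

/-! ### Volume -/

lemma measurePreserving_Hmul (g : H) : MeasurePreserving (Hmul g) volume volume := by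
  have h1 : ∀ x : ℝ, MeasurePreserving
      (fun q : ℝ × ℝ => (g.2.1 + q.1, g.2.2 + (g.1 * q.1 - g.2.1 * x) / 2 + q.2)) volume volume := by
    intro x
    have := MeasurePreserving.skew_product (μa := (volume : Measure ℝ)) (μb := (volume : Measure ℝ))
      (μc := (volume : Measure ℝ)) (μd := (volume : Measure ℝ)) (f := fun y => g.2.1 + y)
      (measurePreserving_add_left volume g.2.1)
      (g := fun y z => g.2.2 + (g.1 * y - g.2.1 * x) / 2 + z) (by fun_prop)
      (ae_of_all _ fun y => (measurePreserving_add_left volume _).map_eq)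
    exact this
  have := MeasurePreserving.skew_product (μa := (volume : Measure ℝ))
      (μb := (volume : Measure ℝ))
      (μc := (volume : Measure (ℝ × ℝ))) (μd := (volume : Measure (ℝ × ℝ))) (f := fun y => g.1 + y)
      (measurePreserving_add_left volume g.1)
      (g := fun x q => (g.2.1 + q.1, g.2.2 + (g.1 * q.1 - g.2.1 * x) / 2 + q.2)) (by fun_prop)
      (ae_of_all _ fun x => (h1 x).map_eq)
  have e : Hmul g = fun q : H => (g.1 + q.1, (g.2.1 + q.2.1,
      g.2.2 + (g.1 * q.2.1 - g.2.1 * q.1) / 2 + q.2.2)) := by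
    ext q
    · rfl
    · rfl
    · simp only [Hmul]; ring
  rw [e]
  exact this

lemma volume_Hmul_image (g : H) {S : Set H} (hS : IsCompact S) :
    volume (Hmul g '' S) = volume S := by
  have : Hmul g '' S = Hmul (Hinv g) ⁻¹' S := by
    ext q
    constructor
    · rintro ⟨p, hp, rfl⟩
      simpa using hp
    · intro hq
      exact ⟨_, hq, by simp⟩
  rw [this, (measurePreserving_Hmul (Hinv g)).measure_preimage hS.measurableSet.nullMeasurableSet]

lemma volume_dil_image (t : ℝ) (S : Set H) :
    volume (dil t '' S) = ENNReal.ofReal (t ^ 4) * volume S := by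
  let L : H →ₗ[ℝ] H := (t • LinearMap.id).prodMap ((t • LinearMap.id).prodMap (t ^ 2 • LinearMap.id))
  have hL : dil t = L := by ext q <;> simp [L, dil]
  have hd : LinearMap.det L = t ^ 4 := by
    simp only [L, LinearMap.det_prodMap, LinearMap.det_smul, LinearMap.det_id]
    simp; ring
  have : (volume : Measure H).IsAddHaarMeasure :=
    Measure.prod.instIsAddHaarMeasure (volume : Measure ℝ) (volume : Measure (ℝ × ℝ))
  rw [hL, Measure.addHaar_image_linearMap, hd, abs_of_nonneg (by positivity)]

lemma volume_Phi_image (N : ℕ) (g : H) {S : Set H} (hS : IsCompact S) :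
    volume (Phi N g '' S) = ENNReal.ofReal (((1 / 2) ^ N) ^ 4) * volume S := by
  have : Phi N g '' S = dil ((1 / 2) ^ N) '' (Hmul g '' S) := by
    rw [Set.image_image]; rfl
  rw [this, volume_dil_image, volume_Hmul_image g hS]

lemma cball_eq_image (p : H) (r : ℝ) : cball p r = Hmul p '' cball 0 r := by
  ext q
  constructor
  · intro hq
    exact ⟨Hmul (Hinv p) q, by simpa only [cball, Set.mem_ofPred_eq, Hmul_Hinv_dbox] using hq,
      by simp⟩
  · rintro ⟨u, hu, rfl⟩
    have := dbox_Hmul p 0 u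
    rw [Hmul_zero] at this
    simpa only [cball, Set.mem_ofPred_eq, this] using hu

lemma volume_cball (p : H) {r : ℝ} (hr : 0 ≤ r) :
    volume (cball p r) = ENNReal.ofReal (8 * r ^ 4) := by
  have h0 : cball 0 r = Set.Icc (-r) r ×ˢ (Set.Icc (-r) r ×ˢ Set.Icc (-r ^ 2) (r ^ 2)) := by
    ext q
    simp only [cball, Set.mem_ofPred_eq, dbox_le_iff hr, Near, vert, Prod.fst_zero, sub_zero,
      Prod.snd_zero, zero_mul, zero_div, abs_le, add_zero, Set.mem_prod, Set.mem_Icc]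
  rw [cball_eq_image, volume_Hmul_image p (isCompact_cball 0 r), h0, Measure.volume_eq_prod,
    Measure.prod_prod, Measure.volume_eq_prod, Measure.prod_prod, Real.volume_Icc, Real.volume_Icc,
    ← ENNReal.ofReal_mul (by linarith), ← ENNReal.ofReal_mul (by linarith)]
  congr 1; ring

lemma volume_tile_pos : 0 < volume tile := Measure.measure_pos_of_mem_nhds _ tile_mem_nhds

lemma volume_tile_lt_top : volume tile < ⊤ := isCompact_tile.measure_lt_top

/-! ### Hausdorff measure estimates -/

section Hausdorff

variable {X : Type*} {d : X → X → ℝ} {π : X → H}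

lemma le_ediamOf {E : Set X} {x y : X} (hx : x ∈ E) (hy : y ∈ E) :
    ENNReal.ofReal (d x y) ≤ ediamOf d E :=
  le_iSup₂_of_le x hx (le_iSup₂_of_le y hy le_rfl)

lemma ediamOf_le {E : Set X} {r : ℝ≥0∞} (h : ∀ x ∈ E, ∀ y ∈ E, ENNReal.ofReal (d x y) ≤ r) :
    ediamOf d E ≤ r :=
  iSup₂_le fun x hx => iSup₂_le fun y hy => h x hx y hy

lemma hausdorffOf_mono {Q : ℝ} {A B : Set X} (h : A ⊆ B) :
    hausdorffOf d Q A ≤ hausdorffOf d Q B :=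
  iSup₂_mono fun _ _ => iInf_mono fun _ => le_iInf₂ fun hA hd =>
    (iInf₂_le (h.trans hA) hd)

lemma volume_le_of_ediamOf {E : Set X}
    (hd : ∀ x y, d x y = sdist (π x) (π y)) (hE : ediamOf d E ≤ 1) :
    volume (π '' E) ≤ ENNReal.ofReal 6144 * ediamOf d E ^ (4 : ℝ) := by
  rcases E.eq_empty_or_nonempty with rfl | ⟨x, hx⟩
  · simp
  have hfin : ediamOf d E ≠ ⊤ := ne_top_of_le_ne_top ENNReal.one_ne_top hE
  set δ := (ediamOf d E).toReal with hδ
  have hδe : ediamOf d E = ENNReal.ofReal δ := (ENNReal.ofReal_toReal hfin).symm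
  have hle : ∀ y ∈ E, sdist (π x) (π y) ≤ δ := by
    intro y hy
    have := le_ediamOf (d := d) hx hy
    rwa [hδe, hd, ENNReal.ofReal_le_ofReal_iff ENNReal.toReal_nonneg] at this
  rcases (ENNReal.toReal_nonneg : 0 ≤ δ).eq_or_lt with h0 | h0
  · have h0' : 0 = δ := h0
    have : π '' E ⊆ {π x} := by
      rintro _ ⟨y, hy, rfl⟩
      have := hle y hy
      rw [← h0'] at this
      exact (eq_of_sdist_eq_zero (le_antisymm this (sdist_nonneg _ _))).symm
    calc volume (π '' E) ≤ volume (cball (π x) 0) :=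
          measure_mono (this.trans (Set.singleton_subset_iff.2 (dbox_self _).le))
      _ = 0 := by rw [volume_cball _ le_rfl]; simp
      _ ≤ _ := zero_le
  · obtain ⟨y₁, y₂, hy⟩ := exists_three_balls (π x) (show 0 < 2 * δ by linarith)
    have hsub : π '' E ⊆ cball (π x) (4 * δ) ∪ (cball y₁ (4 * δ) ∪ cball y₂ (4 * δ)) := by
      rintro _ ⟨y, hyE, rfl⟩
      have := hy (π y) (by linarith [hle y hyE])
      rw [show 2 * (2 * δ) = 4 * δ by ring] at this
      exact this
    calc volume (π '' E) ≤ volume (cball (π x) (4 * δ)) + (volume (cball y₁ (4 * δ)) +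
          volume (cball y₂ (4 * δ))) :=
          (measure_mono hsub).trans ((measure_union_le _ _).trans
            (by gcongr; exact measure_union_le _ _))
      _ = ENNReal.ofReal 6144 * ediamOf d E ^ (4 : ℝ) := by
          rw [volume_cball _ (by linarith), volume_cball _ (by linarith),
            volume_cball _ (by linarith), hδe, ENNReal.ofReal_rpow_of_pos h0,
            ← ENNReal.ofReal_mul (by norm_num), ← ENNReal.ofReal_add (by positivity) (by positivity),
            ← ENNReal.ofReal_add (by positivity) (by positivity)]
          congr 1
          rw [show (4 : ℝ) = ((4 : ℕ) : ℝ) by norm_num, Real.rpow_natCast]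
          push_cast
          ring

lemma volume_le_hausdorffOf (S : Set X)
    (hd : ∀ x y, d x y = sdist (π x) (π y)) :
    volume (π '' S) ≤ ENNReal.ofReal 6144 * hausdorffOf d 4 S := by
  have h1 : (⨅ (E : ℕ → Set X) (_ : S ⊆ ⋃ n, E n) (_ : ∀ n, ediamOf d (E n) ≤ 1),
      ∑' n, ediamOf d (E n) ^ (4 : ℝ)) ≤ hausdorffOf d 4 S :=
    le_iSup₂_of_le (f := fun (ε : ℝ≥0∞) (_ : 0 < ε) => ⨅ (E : ℕ → Set X) (_ : S ⊆ ⋃ n, E n)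
      (_ : ∀ n, ediamOf d (E n) ≤ ε), ∑' n, ediamOf d (E n) ^ (4 : ℝ)) 1 one_pos le_rfl
  refine le_trans ?_ (mul_le_mul_right h1 _)
  rw [mul_comm, ← ENNReal.div_le_iff_le_mul (Or.inl (by simp)) (Or.inl (by simp))]
  refine le_iInf fun E => le_iInf₂ fun hS hE => ?_
  rw [ENNReal.div_le_iff_le_mul (Or.inl (by simp)) (Or.inl (by simp)), mul_comm,
    ← ENNReal.tsum_mul_left]
  calc volume (π '' S) ≤ volume (⋃ n, π '' E n) := by
        rw [← Set.image_iUnion]; exact measure_mono (Set.image_mono hS)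
    _ ≤ ∑' n, volume (π '' E n) := measure_iUnion_le _
    _ ≤ _ := ENNReal.tsum_le_tsum fun n => volume_le_of_ediamOf hd (hE n)

lemma dbox_le_of_same_cell {u w : H} {η : ℝ} (hη : 0 < η) (h1 : ⌊u.1 / η⌋ = ⌊w.1 / η⌋)
    (h2 : ⌊u.2.1 / η⌋ = ⌊w.2.1 / η⌋)
    (h3 : ⌊(u.2.2 - (⌊u.1 / η⌋ * η * u.2.1 - ⌊u.2.1 / η⌋ * η * u.1) / 2) / η ^ 2⌋ =
      ⌊(w.2.2 - (⌊w.1 / η⌋ * η * w.2.1 - ⌊w.2.1 / η⌋ * η * w.1) / 2) / η ^ 2⌋) :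
    dbox u w ≤ 2 * η := by
  have key : ∀ (t s : ℝ) (n : ℤ), 0 < s → ⌊t / s⌋ = n → n * s ≤ t ∧ t ≤ n * s + s := by
    intro t s n hs hn
    have a1 := Int.floor_le (t / s)
    have a2 := (Int.lt_floor_add_one (t / s)).le
    rw [hn] at a1 a2
    rw [le_div_iff₀ hs] at a1
    rw [div_le_iff₀ hs] at a2
    exact ⟨a1, by linarith⟩
  obtain ⟨a1, a2⟩ := key _ _ _ hη h1
  obtain ⟨a3, a4⟩ := key _ _ _ hη (Eq.refl ⌊w.1 / η⌋)
  obtain ⟨b1, b2⟩ := key _ _ _ hη h2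
  obtain ⟨b3, b4⟩ := key _ _ _ hη (Eq.refl ⌊w.2.1 / η⌋)
  obtain ⟨c1, c2⟩ := key _ _ _ (by positivity) h3
  obtain ⟨c3, c4⟩ := key _ _ _ (by positivity) (Eq.refl ⌊(w.2.2 - (⌊w.1 / η⌋ * η * w.2.1 -
    ⌊w.2.1 / η⌋ * η * w.1) / 2) / η ^ 2⌋)
  rw [h1, h2] at c1 c2
  generalize (⌊w.1 / η⌋ : ℝ) * η = i at *
  generalize (⌊w.2.1 / η⌋ : ℝ) * η = j at *
  generalize (⌊(w.2.2 - (i * w.2.1 - j * w.1) / 2) / η ^ 2⌋ : ℝ) * η ^ 2 = l at *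
  have m : ∀ a b : ℝ, 0 ≤ a → a ≤ η → 0 ≤ b → b ≤ η → 0 ≤ a * b ∧ a * b ≤ η ^ 2 := by
    intro a b h1 h2 h3 h4
    exact ⟨mul_nonneg h1 h3, by rw [sq]; gcongr⟩
  have m1 := m (u.1 - i) (w.2.1 - j) (by linarith) (by linarith) (by linarith) (by linarith)
  have m2 := m (u.2.1 - j) (w.1 - i) (by linarith) (by linarith) (by linarith) (by linarith)
  have e : vert u w = (w.2.2 - (i * w.2.1 - j * w.1) / 2) - (u.2.2 - (i * u.2.1 - j * u.1) / 2) -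
      ((u.1 - i) * (w.2.1 - j) - (u.2.1 - j) * (w.1 - i)) / 2 := by unfold vert; ring
  have hv : |vert u w| ≤ 4 * η ^ 2 := by
    rw [e, abs_le]
    constructor <;> nlinarith
  rw [dbox_le_iff (by linarith)]
  refine ⟨?_, ?_, by linarith⟩ <;> rw [abs_le] <;> constructor <;> linarith

lemma exists_nat_grid {R : ℝ} (ε : ℝ≥0∞) (hε : 0 < ε) :
    ∃ M : ℕ, 1 ≤ M ∧ ENNReal.ofReal (2 * (R / M)) ≤ ε := by
  rcases eq_or_ne ε ⊤ with rfl | hε'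
  · exact ⟨1, le_rfl, le_top⟩
  have h0 : 0 < ε.toReal := ENNReal.toReal_pos hε.ne' hε'
  obtain ⟨M, hM⟩ := exists_nat_ge (2 * R / ε.toReal)
  refine ⟨M + 1, by omega, ?_⟩
  rw [← ENNReal.ofReal_toReal hε']
  apply ENNReal.ofReal_le_ofReal
  rw [div_le_iff₀ h0] at hM
  rw [← mul_div_assoc, div_le_iff₀ (by positivity)]
  push_cast
  nlinarith

lemma hausdorffOf_le (S : Set X) (hd : ∀ x y, d x y ≤ dbox (π x) (π y)) (Y : ℤ → H)
    {R : ℝ} (hR : 0 < R) (hS : ∀ x ∈ S, ∃ i : ℤ, i ∈ Finset.Icc 0 2 ∧ dbox (Y i) (π x) ≤ R) :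
    hausdorffOf d 4 S ≤ ENNReal.ofReal (2160 * R ^ 4) := by
  choose! b hbI hbR using hS
  refine iSup₂_le fun ε hε => ?_
  obtain ⟨M, hM1, hM⟩ := exists_nat_grid (R := R) ε hε
  have hM0 : (0 : ℝ) < M := by exact_mod_cast hM1
  set η := R / M with hη
  have hη0 : 0 < η := by positivity
  have hRη : R = M * η := by rw [hη]; field_simp
  let U : X → H := fun x => Hmul (Hinv (Y (b x))) (π x)
  let cell : X → ℤ × ℤ × ℤ × ℤ := fun x => (b x, ⌊(U x).1 / η⌋, ⌊(U x).2.1 / η⌋,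
    ⌊((U x).2.2 - (⌊(U x).1 / η⌋ * η * (U x).2.1 - ⌊(U x).2.1 / η⌋ * η * (U x).1) / 2) / η ^ 2⌋)
  let E : ℤ × ℤ × ℤ × ℤ → Set X := fun c => {x | x ∈ S ∧ cell x = c}
  have hdiam : ∀ c, ediamOf d (E c) ≤ ENNReal.ofReal (2 * η) := by
    intro c
    refine ediamOf_le ?_
    rintro p ⟨-, hp⟩ q ⟨-, hq⟩
    have h := hp.trans hq.symm
    simp only [cell, Prod.mk.injEq] at h
    have h2 : dbox (U p) (U q) ≤ 2 * η := dbox_le_of_same_cell hη0 h.2.1 h.2.2.1 h.2.2.2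
    simp only [U, h.1] at h2
    rw [dbox_Hmul] at h2
    exact ENNReal.ofReal_le_ofReal ((hd p q).trans h2)
  let F : Finset (ℤ × ℤ × ℤ × ℤ) := Finset.Icc (0 : ℤ) 2 ×ˢ (Finset.Icc (-M : ℤ) M ×ˢ
    (Finset.Icc (-M : ℤ) M ×ˢ Finset.Icc (-(2 * M ^ 2) : ℤ) (2 * M ^ 2)))
  have hF : ∀ c, c ∉ F → E c = ∅ := by
    intro c hc
    by_contra hne
    obtain ⟨x, hx, rfl⟩ := Set.nonempty_iff_ne_empty.2 hne
    apply hc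
    have hb : Near R 0 0 (U x) := by
      rw [← dbox_le_iff hR.le, Hmul_Hinv_dbox]
      exact hbR x hx
    obtain ⟨b1, b2, b3⟩ := hb
    have hbx := hbI x hx
    rw [Finset.mem_Icc] at hbx
    simp only [vert, Prod.fst_zero, sub_zero, Prod.snd_zero, zero_mul, zero_div, add_zero] at b1 b2 b3
    have key : ∀ (t s : ℝ) (n : ℕ), 0 < s → |t| ≤ n * s → -(n : ℤ) ≤ ⌊t / s⌋ ∧ ⌊t / s⌋ ≤ n := by
      intro t s n hs ht
      rw [abs_le] at ht
      constructor
      · rw [Int.le_floor, le_div_iff₀ hs]; push_cast; linarith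
      · have : (⌊t / s⌋ : ℝ) ≤ (n : ℝ) :=
          (Int.floor_le _).trans ((div_le_iff₀ hs).2 ht.2)
        exact_mod_cast this
    have k1 := key _ _ M hη0 (hRη ▸ b1)
    have k2 := key _ _ M hη0 (hRη ▸ b2)
    have kη : ∀ n : ℤ, -(M : ℤ) ≤ n ∧ n ≤ M → |n * η| ≤ R := by
      rintro n ⟨h1, h2⟩
      rw [hRη, abs_mul, abs_of_pos hη0]
      gcongr
      rw [abs_le]
      exact ⟨by exact_mod_cast h1, by exact_mod_cast h2⟩
    have k3 : |(U x).2.2 - (⌊(U x).1 / η⌋ * η * (U x).2.1 - ⌊(U x).2.1 / η⌋ * η * (U x).1) / 2| ≤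
        (2 * M ^ 2 : ℕ) * η ^ 2 := by
      have m1 : |⌊(U x).1 / η⌋ * η * (U x).2.1| ≤ R * R := by
        rw [abs_mul]; exact mul_le_mul (kη _ k1) b2 (abs_nonneg _) hR.le
      have m2 : |⌊(U x).2.1 / η⌋ * η * (U x).1| ≤ R * R := by
        rw [abs_mul]; exact mul_le_mul (kη _ k2) b1 (abs_nonneg _) hR.le
      have e : ((2 * M ^ 2 : ℕ) : ℝ) * η ^ 2 = 2 * R ^ 2 := by rw [hRη]; push_cast; ring
      rw [e]
      rw [abs_le] at *
      constructor <;> nlinarith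
    have k4 := key _ _ (2 * M ^ 2) (by positivity) k3
    simp only [F, cell, Finset.mem_product, Finset.mem_Icc]
    refine ⟨hbx, k1, k2, ?_⟩
    exact_mod_cast k4
  have e : ℕ ≃ ℤ × ℤ × ℤ × ℤ := (Denumerable.eqv _).symm
  refine iInf_le_of_le (fun n => E (e n)) (iInf_le_of_le ?_ (iInf_le_of_le ?_ ?_))
  · intro x hx
    exact Set.mem_iUnion.2 ⟨e.symm (cell x), hx, by simp⟩
  · exact fun n => (hdiam _).trans hM
  rw [e.tsum_eq (fun c => ediamOf d (E c) ^ (4 : ℝ)), tsum_eq_sum (s := F)]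
  · calc ∑ c ∈ F, ediamOf d (E c) ^ (4 : ℝ) ≤ ∑ c ∈ F, ENNReal.ofReal (16 * η ^ 4) := by
          refine Finset.sum_le_sum fun c _ => ?_
          refine (ENNReal.rpow_le_rpow (hdiam c) (by norm_num)).trans ?_
          rw [ENNReal.ofReal_rpow_of_pos (by positivity)]
          apply ENNReal.ofReal_le_ofReal
          rw [show (4 : ℝ) = ((4 : ℕ) : ℝ) by norm_num, Real.rpow_natCast]
          apply le_of_eq
          ring
      _ = ENNReal.ofReal (F.card * (16 * η ^ 4)) := by
          rw [Finset.sum_const, nsmul_eq_mul, ENNReal.ofReal_mul (by positivity)]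
          simp
      _ ≤ ENNReal.ofReal (2160 * R ^ 4) := by
          apply ENNReal.ofReal_le_ofReal
          have hcard : F.card ≤ 135 * M ^ 4 := by
            have : F.card = 3 * ((2 * M + 1) * ((2 * M + 1) * (4 * M ^ 2 + 1))) := by
              simp only [F, Finset.card_product, Int.card_Icc]
              congr 1
              congr 1
              · omega
              · congr 1
                · omega
                · have : ((2 * M ^ 2 : ℤ) + 1 - -(2 * M ^ 2)) = ((4 * M ^ 2 + 1 : ℕ) : ℤ) := by
                    push_cast; ring
                  rw [this, Int.toNat_natCast]
            rw [this]
            calc _ ≤ 3 * ((3 * M) * ((3 * M) * (5 * M ^ 2))) := by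
                  gcongr
                  · omega
                  · omega
                  · nlinarith
              _ = _ := by ring
          have hcard' : (F.card : ℝ) ≤ 135 * M ^ 4 := by exact_mod_cast hcard
          rw [hRη]
          calc (F.card : ℝ) * (16 * η ^ 4) ≤ (135 * M ^ 4) * (16 * η ^ 4) := by gcongr
            _ = _ := by ring
  · intro c hc
    rw [hF c hc]
    simp [ediamOf]

end Hausdorff

/-! ### Self-similarity of the shortcut distance on the core of the tile -/

/-- The projection onto the plane (with the supremum distance). -/
def pl (p : H) : ℝ × ℝ := (p.1, p.2.1)

lemma dist_pl_le_iff {p q : H} {c : ℝ} :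
    dist (pl p) (pl q) ≤ c ↔ |q.1 - p.1| ≤ c ∧ |q.2.1 - p.2.1| ≤ c := by
  rw [dist_comm, Prod.dist_eq, max_le_iff, Real.dist_eq, Real.dist_eq]
  rfl

lemma dist_pl_le_dbox (p q : H) : dist (pl p) (pl q) ≤ dbox p q := by
  rw [dist_pl_le_iff]
  have h : boxNorm (Hmul (Hinv p) q) = dbox p q := rfl
  have h1 : |(Hmul (Hinv p) q).1| ≤ dbox p q := h ▸ le_max_left _ _
  have h2 : |(Hmul (Hinv p) q).2.1| ≤ dbox p q :=
    h ▸ (le_max_left _ _).trans (le_max_right _ _)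
  simp only [Hmul, Hinv] at h1 h2
  exact ⟨by rwa [sub_eq_neg_add], by rwa [sub_eq_neg_add]⟩

lemma Jump.pl_eq {c : ℝ} {x y : H} (h : Jump c x y) : pl x = pl y := by
  obtain ⟨l, m, g, e, hg, rfl, rfl, hc⟩ := h
  simp [pl, Phi, dil, Hmul, bp]

lemma Step.dist_pl_le {c : ℝ} {x y : H} (h : Step c x y) : dist (pl x) (pl y) ≤ c :=
  h.elim (fun h => (dist_pl_le_dbox x y).trans h) fun h => by
    rw [h.pl_eq, dist_self]; exact h.pos.le

lemma Chain.dist_pl_le {n : ℕ} {c : ℝ} {x y : H} (h : Chain n c x y) :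
    dist (pl x) (pl y) ≤ c := by
  induction h with
  | nil => simp
  | cons hs _ ih => exact (dist_triangle _ _ _).trans (add_le_add hs.dist_pl_le ih)

lemma dbox_PhiInv (N : ℕ) (g x y : H) :
    dbox (PhiInv N g x) (PhiInv N g y) = 2 ^ N * dbox x y := by
  rw [PhiInv, PhiInv, dbox_Hmul, dbox_dil (by positivity)]

lemma dist_pl_PhiInv_le {N : ℕ} {g x y : H} {c : ℝ} (h : dist (pl x) (pl y) ≤ c) :
    dist (pl (PhiInv N g x)) (pl (PhiInv N g y)) ≤ 2 ^ N * c := by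
  rw [dist_pl_le_iff] at h ⊢
  have key : ∀ a b w : ℝ, |b - a| ≤ c → |(-w + 2 ^ N * b) - (-w + 2 ^ N * a)| ≤ 2 ^ N * c := by
    intro a b w hab
    rw [show (-w + 2 ^ N * b) - (-w + 2 ^ N * a) = 2 ^ N * (b - a) by ring, abs_mul,
      abs_of_pos (by positivity)]
    gcongr
  exact ⟨key _ _ g.1 h.1, key _ _ g.2.1 h.2⟩

lemma IsLat.inv {g : H} (hg : IsLat g) : IsLat (Hinv g) := by
  obtain ⟨a, b, c, rfl⟩ := hg
  refine ⟨-a, -b, -c, ?_⟩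
  ext <;> simp only [Hinv] <;> push_cast <;> ring

lemma PhiInv_Phi_of_le {N l : ℕ} (hl : N ≤ l) (g g' x : H) :
    PhiInv N g (Phi l g' x) = Phi (l - N) (Hmul (Hinv (dil (2 ^ (l - N)) g)) g') x := by
  obtain ⟨k, rfl⟩ := Nat.exists_eq_add_of_le hl
  have h := Phi_Phi N k g (Hmul (Hinv (dil (2 ^ k) g)) g') x
  rw [Hmul_Hinv_cancel] at h
  rw [Nat.add_sub_cancel_left, ← h, PhiInv_Phi]

/-- Pulling back a step by a similarity gives either a step, or a shortcut located over a point
of the plane whose coordinates differ by an integer. -/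
lemma Step.pullback {c : ℝ} {x y : H} (h : Step c x y) (N : ℕ) {g : H} (hg : IsLat g) :
    Step (2 ^ N * c) (PhiInv N g x) (PhiInv N g y) ∨
    ∃ k : ℤ, (PhiInv N g x).1 - (PhiInv N g x).2.1 = k := by
  rcases h with h | ⟨l, m, g', e, hg', rfl, rfl, hc⟩
  · left; left
    rw [dbox_PhiInv]
    gcongr
  rcases le_or_gt N l with hl | hl
  · left; right
    refine ⟨l - N, m, _, e, (hg.dil (l - N)).inv.mul hg', PhiInv_Phi_of_le hl ..,
      PhiInv_Phi_of_le hl .., ?_⟩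
    obtain ⟨k, rfl⟩ := Nat.exists_eq_add_of_le hl
    rw [Nat.add_sub_cancel_left]
    calc (1 / 2 : ℝ) ^ k * (1 / 4) ^ m = 2 ^ N * ((1 / 2) ^ (N + k) * (1 / 4) ^ m) := by
          rw [pow_add, ← mul_assoc, ← mul_assoc, mul_comm (2 ^ N), half_pow_mul_two_pow, one_mul]
      _ ≤ 2 ^ N * c := by gcongr
  · right
    obtain ⟨k, rfl⟩ := Nat.exists_eq_add_of_lt hl
    obtain ⟨a, b, z, rfl⟩ := hg
    obtain ⟨a', b', z', rfl⟩ := hg'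
    refine ⟨b - a + 2 ^ (k + 1) * (a' - b'), ?_⟩
    have := half_pow_mul_two_pow l
    simp only [PhiInv, Phi, Hmul, Hinv, dil, bp]
    push_cast
    rw [show l + k + 1 = l + (k + 1) by ring, pow_add]
    linear_combination (2 ^ (k + 1) * ((a' : ℝ) - b')) * this

lemma Chain.pullback {n : ℕ} {c : ℝ} {x y : H} (h : Chain n c x y) (N : ℕ) {g : H}
    (hg : IsLat g) :
    sdist (PhiInv N g x) (PhiInv N g y) ≤ 2 ^ N * c ∨
    ∃ β : ℝ × ℝ, (∃ k : ℤ, β.1 - β.2 = k) ∧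
      dist (pl (PhiInv N g x)) β + dist β (pl (PhiInv N g y)) ≤ 2 ^ N * c := by
  induction h with
  | nil x => left; rw [sdist_self, mul_zero]
  | @cons n c c' x y z hs hc ih =>
    rcases hs.pullback N hg with h1 | ⟨k, hk⟩
    · rcases ih with h2 | ⟨β, hβ, h2⟩
      · left
        refine (sdist_triangle _ (PhiInv N g y) _).trans ?_
        rw [mul_add]
        exact add_le_add (Chain.single h1).sdist_le h2
      · right
        refine ⟨β, hβ, ?_⟩
        have h3 := dist_pl_PhiInv_le (N := N) (g := g) hs.dist_pl_le
        have h4 := dist_triangle (pl (PhiInv N g x)) (pl (PhiInv N g y)) β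
        linarith
    · right
      refine ⟨pl (PhiInv N g x), ⟨k, hk⟩, ?_⟩
      rw [dist_self, zero_add]
      exact dist_pl_PhiInv_le (Chain.cons hs hc).dist_pl_le

/-- A compact piece of the tile which stays away from the shortcuts of large scale. -/
def core : Set H := cball (3 / 4, 1 / 4, 1 / 2) (1 / 8) ∩ tile

lemma isCompact_core : IsCompact core := isCompact_tile.inter_left (isClosed_cball _ _)

lemma eighth_le_of_mem_core {p : H} (hp : p ∈ core) {β : ℝ × ℝ} {k : ℤ} (hβ : β.1 - β.2 = k) :
    1 / 8 ≤ dist (pl p) β := by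
  have h1 := (dist_pl_le_dbox _ p).trans hp.1
  have h2 : dist (pl p) β = max |p.1 - β.1| |p.2.1 - β.2| := by
    rw [Prod.dist_eq, Real.dist_eq, Real.dist_eq]; rfl
  rw [dist_pl_le_iff] at h1
  obtain ⟨h3, h4⟩ := h1
  rw [abs_le] at h3 h4
  by_contra! hlt
  rw [h2, max_lt_iff, abs_lt, abs_lt] at hlt
  have e1 : (0 : ℝ) < k := by simp only at *; linarith
  have e2 : (k : ℝ) < 1 := by simp only at *; linarith
  have e3 : 0 < k := by exact_mod_cast e1
  have e4 : k < 1 := by exact_mod_cast e2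
  omega

lemma sdist_Phi_core (N : ℕ) {g : H} (hg : IsLat g) {u v : H} (hu : u ∈ core) (hv : v ∈ core) :
    sdist (Phi N g u) (Phi N g v) = (1 / 2) ^ N * sdist u v := by
  refine le_antisymm (sdist_Phi_le N hg u v) ?_
  refine le_csInf (sdist_set_nonempty _ _) ?_
  rintro c ⟨n, h⟩
  suffices hs : sdist u v ≤ 2 ^ N * c by
    calc (1 / 2) ^ N * sdist u v ≤ (1 / 2) ^ N * (2 ^ N * c) := by gcongr
      _ = c := by rw [← mul_assoc, half_pow_mul_two_pow, one_mul]
  have h1 := h.pullback N hg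
  rw [PhiInv_Phi, PhiInv_Phi] at h1
  rcases h1 with h1 | ⟨β, ⟨k, hk⟩, h1⟩
  · exact h1
  · have h2 := eighth_le_of_mem_core hu hk
    have h3 := eighth_le_of_mem_core hv hk
    rw [dist_comm] at h3
    have h4 := dbox_triangle u (3 / 4, 1 / 4, 1 / 2) v
    have h5 : dbox u (3 / 4, 1 / 4, 1 / 2) ≤ 1 / 8 := by rw [dbox_comm]; exact hu.1
    have h6 : dbox (3 / 4, 1 / 4, 1 / 2) v ≤ 1 / 8 := hv.1
    linarith [sdist_le_dbox u v]

lemma core_mem_nhds : core ∈ 𝓝 ((3 / 4, 1 / 4, 1 / 2) : H) := by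
  refine Filter.inter_mem ?_ ?_
  · refine mem_of_superset ((isOpen_oball (3 / 4, 1 / 4, 1 / 2) (1 / 8)).mem_nhds ?_)
      fun q hq => show dbox _ q ≤ _ from le_of_lt hq
    simp only [Set.mem_ofPred_eq, dbox_self]
    norm_num
  · refine mem_of_superset (IsOpen.mem_nhds (isOpen_Ioo.prod (isOpen_Ioo.prod isOpen_Ioo)) ?_)
      interior_tile_aux
    refine ⟨⟨?_, ?_⟩, ⟨?_, ?_⟩, ?_, ?_⟩ <;> norm_num

lemma volume_core_pos : 0 < volume core := by
  exact MeasureTheory.Measure.measure_pos_of_mem_nhds _ core_mem_nhds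

/-! ### Ahlfors regularity and big pieces -/

/-- The shortcut distance on the tile. -/
noncomputable def td (x y : tile) : ℝ := sdist x y

lemma lt_two_of_lt_ediamOf {r : ℝ} (h : ENNReal.ofReal r < ediamOf td Set.univ) : r < 2 := by
  have h2 : ediamOf td Set.univ ≤ ENNReal.ofReal 2 := ediamOf_le fun x _ y _ =>
    ENNReal.ofReal_le_ofReal ((sdist_le_dbox _ _).trans (dbox_le_two_of_tile x.2 y.2))
  exact ((ENNReal.ofReal_lt_ofReal_iff (by norm_num)).1 (h.trans_le h2))

lemma exists_scale {r : ℝ} (hr : 0 < r) (hr2 : r < 2) :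
    ∃ N : ℕ, 2 * (1 / 2 : ℝ) ^ N < r ∧ r ≤ 4 * (1 / 2) ^ N := by
  classical
  have hex : ∃ N : ℕ, 2 * (1 / 2 : ℝ) ^ N < r := by
    obtain ⟨N, hN⟩ := exists_pow_lt_of_lt_one (half_pos hr) (by norm_num : (1 / 2 : ℝ) < 1)
    exact ⟨N, by linarith⟩
  refine ⟨Nat.find hex, Nat.find_spec hex, ?_⟩
  have h0 : Nat.find hex ≠ 0 := by
    intro h
    have := Nat.find_spec hex
    rw [h] at this
    norm_num at this
    linarith
  obtain ⟨k, hk⟩ := Nat.exists_eq_succ_of_ne_zero h0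
  have := Nat.find_min hex (m := k) (by omega)
  rw [hk, pow_succ]
  linarith

/-- The part of the tile covered by the copy `Phi N g '' W`. -/
def piece (N : ℕ) (g : H) (W : Set H) : Set tile := {x | ∃ u ∈ W, Phi N g u = x}

lemma le_hausdorffOf_piece {N : ℕ} {g : H} (hg : Addr N g) {W : Set H} (hW : W ⊆ tile)
    (hWc : IsCompact W) :
    ENNReal.ofReal (((1 / 2) ^ N) ^ 4 * ((volume W).toReal / 6144)) ≤
      hausdorffOf td 4 (piece N g W) := by
  have himg : Subtype.val '' piece N g W = Phi N g '' W := by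
    ext y
    constructor
    · rintro ⟨x, ⟨u, hu, hux⟩, rfl⟩
      exact ⟨u, hu, hux⟩
    · rintro ⟨u, hu, rfl⟩
      exact ⟨⟨_, hg.mem_tile (hW hu)⟩, ⟨u, hu, rfl⟩, rfl⟩
  have h := volume_le_hausdorffOf (d := td) (π := Subtype.val) (piece N g W) fun x y => rfl
  rw [himg, volume_Phi_image N g hWc] at h
  rw [show ((1 / 2 : ℝ) ^ N) ^ 4 * ((volume W).toReal / 6144) =
    (((1 / 2) ^ N) ^ 4 * (volume W).toReal) / 6144 by ring,
    ENNReal.ofReal_div_of_pos (by norm_num), ENNReal.ofReal_mul (by positivity),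
    ENNReal.ofReal_toReal hWc.measure_lt_top.ne]
  exact ENNReal.div_le_of_le_mul' h

lemma piece_subset_ballOf {N : ℕ} {g : H} {W : Set H} (hW : W ⊆ tile) {x : tile} {p : H}
    (hp : p ∈ tile) (hpx : Phi N g p = x) {r : ℝ} (hr : 2 * (1 / 2 : ℝ) ^ N < r) :
    piece N g W ⊆ ballOf td x r := by
  rintro y ⟨u, hu, huy⟩
  refine lt_of_le_of_lt (sdist_le_dbox _ _) ?_
  rw [← hpx, ← huy, dbox_Phi]
  have := dbox_le_two_of_tile hp (hW hu)
  calc (1 / 2 : ℝ) ^ N * dbox p u ≤ (1 / 2) ^ N * 2 := by gcongr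
    _ < r := by linarith

lemma pow_four_div_le {r s : ℝ} (hr : 0 ≤ r) (h : r ≤ 4 * s) : r ^ 4 / 256 ≤ s ^ 4 := by
  have : r ^ 4 ≤ (4 * s) ^ 4 := by gcongr
  linarith [mul_pow 4 s 4]

lemma ahlforsRegularOf_td : AhlforsRegularOf td 4 := by
  set v := (volume tile).toReal with hv
  have hv0 : 0 < v := ENNReal.toReal_pos volume_tile_pos.ne' volume_tile_lt_top.ne
  have hC0 : (0 : ℝ) < max 34560 (256 * 6144 / v) := lt_max_of_lt_left (by norm_num)
  refine ⟨max 34560 (256 * 6144 / v), le_max_of_le_left (by norm_num), fun x r hr hrd => ?_⟩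
  obtain ⟨N, hN1, hN2⟩ := exists_scale hr (lt_two_of_lt_ediamOf hrd)
  have hr4 : r ^ (4 : ℝ) = r ^ 4 := by exact_mod_cast Real.rpow_natCast r 4
  rw [hr4]
  constructor
  · obtain ⟨g, hg, p, hp, hpx⟩ := exists_addr N x.2
    refine le_trans ?_ ((le_hausdorffOf_piece hg subset_rfl isCompact_tile).trans
      (hausdorffOf_mono (piece_subset_ballOf subset_rfl hp hpx hN1)))
    refine ENNReal.ofReal_le_ofReal ?_
    have h1 : (max 34560 (256 * 6144 / v))⁻¹ ≤ v / (256 * 6144) := by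
      rw [inv_le_comm₀ hC0 (by positivity), inv_div]
      exact le_max_right _ _
    calc (max 34560 (256 * 6144 / v))⁻¹ * r ^ 4 ≤ v / (256 * 6144) * r ^ 4 := by gcongr
      _ = (r ^ 4 / 256) * (v / 6144) := by ring
      _ ≤ _ := by gcongr; exact pow_four_div_le hr.le hN2
  · obtain ⟨y₁, y₂, hy⟩ := exists_three_balls (x : H) hr
    refine (hausdorffOf_le (R := 2 * r) (π := Subtype.val) (ballOf td x r)
      (fun a b => sdist_le_dbox _ _)
      (fun i => if i = 0 then x else if i = 1 then y₁ else y₂) (by positivity)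
      fun y hyr => ?_).trans ?_
    · rcases hy y hyr with h | h | h
      · exact ⟨0, by decide, by simpa using h⟩
      · exact ⟨1, by decide, by simpa using h⟩
      · exact ⟨2, by decide, by simpa using h⟩
    · refine ENNReal.ofReal_le_ofReal ?_
      calc 2160 * (2 * r) ^ 4 = 34560 * r ^ 4 := by ring
        _ ≤ _ := by gcongr; exact le_max_left _ _

lemma isClosedIn_piece {N : ℕ} {g : H} {W : Set H} (hW : IsCompact W) :
    IsClosedIn td (piece N g W) := by
  intro x hx
  have hcl : IsClosed (Phi N g '' W) := (hW.image (continuous_Phi N g)).isClosed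
  choose y hy hxy using fun n : ℕ => hx (1 / (n + 1)) (by positivity)
  have hz : Tendsto (fun n : ℕ => (1 : ℝ) / (n + 1)) atTop (𝓝 0) :=
    tendsto_one_div_add_atTop_nhds_zero_nat
  have h1 : Tendsto (fun n : ℕ => 2 * ((1 : ℝ) / (n + 1)) + √(1 / (n + 1))) atTop (𝓝 0) := by
    have := (hz.const_mul 2).add (Real.continuous_sqrt.continuousAt.tendsto.comp hz)
    simpa only [Function.comp_def, mul_zero, Real.sqrt_zero, add_zero] using this
  have h2 : Tendsto (fun n => dbox (x : H) (y n)) atTop (𝓝 0) :=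
    squeeze_zero (fun n => dbox_nonneg _ _) (fun n => dbox_le_of_sdist_lt (hxy n)) h1
  have h3 : Tendsto (fun n => (y n : H)) atTop (𝓝 (x : H)) :=
    tendsto_of_dbox tendsto_const_nhds h2
  obtain ⟨u, hu, hux⟩ := hcl.mem_of_tendsto h3 (Eventually.of_forall fun n =>
    let ⟨u, hu, huy⟩ := hy n; ⟨u, hu, huy⟩)
  exact ⟨u, hu, hux⟩

lemma isBPI_td : IsBPI td 4 := by
  classical
  set v := (volume core).toReal with hv
  have hv0 : 0 < v := ENNReal.toReal_pos volume_core_pos.ne' isCompact_core.measure_lt_top.ne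
  have hct : core ⊆ tile := Set.inter_subset_right
  refine ⟨ahlforsRegularOf_td, 2, v / (256 * 6144), by norm_num, by positivity, ?_⟩
  intro x₁ x₂ r₁ r₂ hr₁ hd₁ hr₂ hd₂
  obtain ⟨N, hN1, hN2⟩ := exists_scale hr₁ (lt_two_of_lt_ediamOf hd₁)
  obtain ⟨M, hM1, hM2⟩ := exists_scale hr₂ (lt_two_of_lt_ediamOf hd₂)
  obtain ⟨g, hg, p, hp, hpx⟩ := exists_addr N x₁.2
  obtain ⟨h, hh, q, hq, hqx⟩ := exists_addr M x₂.2
  have hr4 : r₁ ^ (4 : ℝ) = r₁ ^ 4 := by exact_mod_cast Real.rpow_natCast r₁ 4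
  refine ⟨piece N g core, piece_subset_ballOf hct hp hpx hN1, isClosedIn_piece isCompact_core,
    ?_, fun a => if ha : Phi M h (PhiInv N g a) ∈ tile then ⟨_, ha⟩ else a, ?_, ?_⟩
  · refine le_trans (ENNReal.ofReal_le_ofReal ?_) (le_hausdorffOf_piece hg hct isCompact_core)
    rw [hr4]
    calc v / (256 * 6144) * r₁ ^ 4 = (r₁ ^ 4 / 256) * (v / 6144) := by ring
      _ ≤ _ := by gcongr; exact pow_four_div_le hr₁.le hN2
  · rintro a ⟨u, hu, hua⟩
    refine piece_subset_ballOf hct hq hqx hM1 ⟨u, hu, ?_⟩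
    simp only
    rw [← hua, PhiInv_Phi, dif_pos (hh.mem_tile (hct hu))]
  · rintro a ⟨u, hu, hua⟩ b ⟨w, hw, hwb⟩
    simp only [td]
    rw [← hua, ← hwb]
    simp only [PhiInv_Phi]
    rw [dif_pos (hh.mem_tile (hct hu)), dif_pos (hh.mem_tile (hct hw))]
    simp only
    rw [sdist_Phi_core N hg.isLat hu hw, sdist_Phi_core M hh.isLat hu hw]
    have h0 := sdist_nonneg u w
    have hs : (0 : ℝ) < (1 / 2) ^ N := by positivity
    have ht : (0 : ℝ) < (1 / 2) ^ M := by positivity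
    have e : r₂ / r₁ * ((1 / 2) ^ N * sdist u w) = r₂ * (1 / 2) ^ N / r₁ * sdist u w := by ring
    rw [e]
    constructor
    · rw [← mul_assoc]
      refine mul_le_mul_of_nonneg_right ?_ h0
      rw [inv_mul_le_iff₀ (by norm_num), div_le_iff₀ hr₁]
      nlinarith
    · rw [← mul_assoc]
      refine mul_le_mul_of_nonneg_right ?_ h0
      rw [mul_div_assoc', le_div_iff₀ hr₁]
      nlinarith

/-! ### The four-dimensional Hausdorff content -/

/-- The open box ball. -/
def oball (p : H) (r : ℝ) : Set H := {q | dbox p q < r}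

/-- The cost of covering a set by one open ball. -/
noncomputable def ballCost (S : Set H) : ℝ≥0∞ :=
  ⨅ (c : H) (r : ℝ) (_ : 0 < r) (_ : S ⊆ oball c r), ENNReal.ofReal (r ^ 4)

lemma ballCost_le {S : Set H} {c : H} {r : ℝ} (hr : 0 < r) (h : S ⊆ oball c r) :
    ballCost S ≤ ENNReal.ofReal (r ^ 4) :=
  (iInf₂_le c r).trans (iInf₂_le hr h)

lemma ballCost_empty : ballCost ∅ = 0 := by
  refine le_antisymm (ENNReal.le_of_forall_pos_le_add fun ε hε _ => ?_) bot_le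
  have h : (0 : ℝ) < min 1 ε := lt_min one_pos (by exact_mod_cast hε)
  refine (ballCost_le (c := 0) h (Set.empty_subset _)).trans ?_
  rw [zero_add, ← ENNReal.ofReal_coe_nnreal]
  refine ENNReal.ofReal_le_ofReal ?_
  calc (min 1 (ε : ℝ)) ^ 4 ≤ (min 1 (ε : ℝ)) ^ 1 :=
        pow_le_pow_of_le_one h.le (min_le_left _ _) (by norm_num)
    _ ≤ ε := by rw [pow_one]; exact min_le_right _ _

/-- The four-dimensional Hausdorff content. -/
noncomputable def cont : OuterMeasure H := OuterMeasure.ofFunction ballCost ballCost_empty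

lemma cont_le_ofReal {S : Set H} {c : H} {r : ℝ} (hr : 0 < r) (h : S ⊆ oball c r) :
    cont S ≤ ENNReal.ofReal (r ^ 4) :=
  (OuterMeasure.ofFunction_le S).trans (ballCost_le hr h)

lemma cont_le_tsum {S : Set H} {c : ℕ → H} {r : ℕ → ℝ} (hr : ∀ n, 0 < r n)
    (h : S ⊆ ⋃ n, oball (c n) (r n)) : cont S ≤ ∑' n, ENNReal.ofReal (r n ^ 4) :=
  (measure_mono h).trans ((measure_iUnion_le _).trans
    (ENNReal.tsum_le_tsum fun n => cont_le_ofReal (hr n) subset_rfl))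

lemma exists_cover_of_cont_lt {S : Set H} {v : ℝ≥0∞} (h : cont S < v) :
    ∃ (c : ℕ → H) (r : ℕ → ℝ), (∀ n, 0 < r n) ∧ S ⊆ ⋃ n, oball (c n) (r n) ∧
      ∑' n, ENNReal.ofReal (r n ^ 4) < v := by
  rw [cont, OuterMeasure.ofFunction_apply] at h
  obtain ⟨t, ht⟩ := iInf_lt_iff.1 h
  obtain ⟨hS, ht⟩ := iInf_lt_iff.1 ht
  obtain ⟨ε', hε', hsum⟩ := ENNReal.exists_pos_sum_of_countable (tsub_pos_of_lt ht).ne' ℕ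
  have hfin : ∀ n, ballCost (t n) ≠ ∞ := fun n =>
    ne_top_of_le_ne_top ht.ne_top (ENNReal.le_tsum n)
  have key : ∀ n, ∃ (c : H) (r : ℝ), 0 < r ∧ t n ⊆ oball c r ∧
      ENNReal.ofReal (r ^ 4) < ballCost (t n) + ε' n := by
    intro n
    have h1 : ballCost (t n) < ballCost (t n) + ε' n :=
      ENNReal.lt_add_right (hfin n) (by exact_mod_cast (hε' n).ne')
    nth_rewrite 1 [ballCost] at h1
    obtain ⟨c, h1⟩ := iInf_lt_iff.1 h1
    obtain ⟨r, h1⟩ := iInf_lt_iff.1 h1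
    obtain ⟨hr, h1⟩ := iInf_lt_iff.1 h1
    obtain ⟨hsub, h1⟩ := iInf_lt_iff.1 h1
    exact ⟨c, r, hr, hsub, h1⟩
  choose c r hr hsub hcr using key
  refine ⟨c, r, hr, hS.trans (Set.iUnion_mono hsub), ?_⟩
  calc ∑' n, ENNReal.ofReal (r n ^ 4) ≤ ∑' n, (ballCost (t n) + ε' n) :=
        ENNReal.tsum_le_tsum fun n => (hcr n).le
    _ = ∑' n, ballCost (t n) + ∑' n, (ε' n : ℝ≥0∞) := ENNReal.tsum_add
    _ < v := by
        have := ENNReal.add_lt_add_left ht.ne_top hsum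
        rwa [add_tsub_cancel_of_le ht.le] at this

lemma cont_image_le {ψ : H → H} {lam : ℝ} (hl : 0 < lam)
    (hψ : ∀ x y, dbox (ψ x) (ψ y) ≤ lam * dbox x y) (S : Set H) :
    cont (ψ '' S) ≤ ENNReal.ofReal (lam ^ 4) * cont S := by
  have hl4 : ENNReal.ofReal (lam ^ 4) ≠ 0 := by
    rw [Ne, ENNReal.ofReal_eq_zero, not_le]; positivity
  rw [← ENNReal.div_le_iff' hl4 ENNReal.ofReal_ne_top]
  refine le_of_forall_gt fun v hv => ?_
  obtain ⟨c, r, hr, hS, hv⟩ := exists_cover_of_cont_lt hv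
  refine lt_of_le_of_lt ?_ hv
  rw [ENNReal.div_le_iff' hl4 ENNReal.ofReal_ne_top, ← ENNReal.tsum_mul_left]
  refine (cont_le_tsum (c := fun n => ψ (c n)) (r := fun n => lam * r n)
    (fun n => mul_pos hl (hr n)) ?_).trans (le_of_eq ?_)
  · rintro _ ⟨x, hx, rfl⟩
    obtain ⟨n, hn⟩ := Set.mem_iUnion.1 (hS hx)
    refine Set.mem_iUnion.2 ⟨n, lt_of_le_of_lt (hψ _ _) ?_⟩
    exact mul_lt_mul_of_pos_left hn hl
  · congr 1
    ext n
    rw [mul_pow, ENNReal.ofReal_mul (by positivity)]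

lemma hausdorffOf_eq_zero_of_cont_eq_zero {S : Set H} (h : cont S = 0) :
    hausdorffOf dbox 4 S = 0 := by
  refine le_antisymm (iSup₂_le fun ε hε => ?_) bot_le
  refine ENNReal.le_of_forall_pos_le_add fun η hη _ => ?_
  rw [zero_add]
  have hv : 0 < min (η / 16 : ℝ≥0∞) ((ε / 2) ^ 4) := by
    refine lt_min (ENNReal.div_pos (by exact_mod_cast hη.ne') (by simp)) ?_
    exact pos_iff_ne_zero.2 (pow_ne_zero 4 (ENNReal.div_pos hε.ne' (by simp)).ne')
  obtain ⟨c, r, hr, hS, hsum⟩ := exists_cover_of_cont_lt (h.trans_lt hv)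
  have hdiam : ∀ n, ediamOf dbox (oball (c n) (r n)) ≤ 2 * ENNReal.ofReal (r n) := by
    intro n
    rw [← ENNReal.ofReal_ofNat 2, ← ENNReal.ofReal_mul (by norm_num)]
    refine ediamOf_le fun x hx y hy => ENNReal.ofReal_le_ofReal ?_
    have h1 : dbox (c n) x < r n := hx
    have h2 : dbox (c n) y < r n := hy
    linarith [dbox_triangle x (c n) y, dbox_comm x (c n)]
  refine (iInf₂_le (fun n => oball (c n) (r n)) hS).trans ((iInf_le _ fun n => ?_).trans ?_)
  · have h1 : ENNReal.ofReal (r n) ^ 4 ≤ (ε / 2) ^ 4 := by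
      rw [← ENNReal.ofReal_pow (hr n).le]
      exact (ENNReal.le_tsum n).trans (hsum.le.trans (min_le_right _ _))
    have h2 := (ENNReal.pow_le_pow_left_iff (by norm_num)).1 h1
    calc ediamOf dbox (oball (c n) (r n)) ≤ 2 * ENNReal.ofReal (r n) := hdiam n
      _ ≤ 2 * (ε / 2) := by gcongr
      _ = ε := ENNReal.mul_div_cancel (by simp) (by simp)
  · calc ∑' n, ediamOf dbox (oball (c n) (r n)) ^ (4 : ℝ)
        ≤ ∑' n, 16 * ENNReal.ofReal (r n ^ 4) := by
          refine ENNReal.tsum_le_tsum fun n => ?_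
          rw [show (4 : ℝ) = (4 : ℕ) by norm_num, ENNReal.rpow_natCast]
          calc ediamOf dbox (oball (c n) (r n)) ^ 4 ≤ (2 * ENNReal.ofReal (r n)) ^ 4 := by
                gcongr; exact hdiam n
            _ = _ := by rw [mul_pow, ENNReal.ofReal_pow (hr n).le]; norm_num
      _ = 16 * ∑' n, ENNReal.ofReal (r n ^ 4) := ENNReal.tsum_mul_left
      _ ≤ 16 * (η / 16) := by gcongr; exact hsum.le.trans (min_le_left _ _)
      _ = η := ENNReal.mul_div_cancel (by simp) (by simp)

/-! ### Ultralimits of one-Lipschitz maps -/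

lemma exists_tendsto_ultrafilter {X : Type*} [TopologicalSpace X] (U : Ultrafilter ℕ) {u : ℕ → X}
    {K : Set X} (hK : IsCompact K) (h : ∀ᶠ j in U, u j ∈ K) :
    ∃ p ∈ K, Tendsto u U (𝓝 p) := by
  obtain ⟨p, hp, hle⟩ := hK.ultrafilter_le_nhds (U.map u) (le_principal_iff.2 h)
  exact ⟨p, hp, hle⟩

/-- One-Lipschitz maps which do not decrease the content of balls too much, and which collapse
definite vertical segments near every point and at every scale. -/
structure Good (c₀ : ℝ≥0∞) (g : H → H) : Prop where
  zero : g 0 = 0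
  lip : ∀ p q, dbox (g p) (g q) ≤ dbox p q
  content : ∀ x R, 0 < R → c₀ * ENNReal.ofReal (R ^ 4) ≤ cont (g '' cball x R)
  pairs : ∀ x R (m : ℕ), 0 < R → ∃ p ∈ cball x R, ∃ t ∈ Set.Icc (R ^ 2 * (1 / 4) ^ m / 1024) (R ^ 2),
    dbox (g p) (g (Hmul p (zel t))) ≤ 8 * (1 / 2) ^ m * √t

/-- Sequences of partially defined maps whose ultralimits satisfy `Good`. -/
structure GoodSeq (U : Ultrafilter ℕ) (c₀ : ℝ≥0∞) (E : ℕ → Set H) (G : ℕ → H → H) : Prop where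
  zero : ∃ b : ℕ → H, (∀ᶠ j in U, b j ∈ E j) ∧ Tendsto b U (𝓝 0) ∧ ∀ᶠ j in U, G j (b j) = 0
  lip : ∀ᶠ j in U, ∀ b ∈ E j, ∀ b' ∈ E j, dbox (G j b) (G j b') ≤ dbox b b'
  dense : ∀ p, ∃ b : ℕ → H, (∀ᶠ j in U, b j ∈ E j) ∧ Tendsto b U (𝓝 p)
  content : ∀ x R, 0 < R →
    ∀ᶠ j in U, c₀ * ENNReal.ofReal (R ^ 4) ≤ cont (G j '' (E j ∩ cball x R))
  pairs : ∀ x R (m : ℕ), 0 < R → ∃ η : ℕ → ℝ, Tendsto η U (𝓝 0) ∧ ∀ᶠ j in U,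
    ∃ p ∈ cball x R, ∃ t ∈ Set.Icc (R ^ 2 * (1 / 4) ^ m / 1024) (R ^ 2),
      ∃ b ∈ E j, ∃ b' ∈ E j, dbox p b ≤ η j ∧ dbox (Hmul p (zel t)) b' ≤ η j ∧
        dbox (G j b) (G j b') ≤ 8 * (1 / 2) ^ m * √t + η j

section

variable {U : Ultrafilter ℕ} {c₀ : ℝ≥0∞} {E : ℕ → Set H} {G : ℕ → H → H}

/-- The pointwise ultralimit. -/
def IsULim (U : Ultrafilter ℕ) (E : ℕ → Set H) (G : ℕ → H → H) (g : H → H) : Prop :=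
  ∀ p (b : ℕ → H), (∀ᶠ j in U, b j ∈ E j) → Tendsto b U (𝓝 p) →
    Tendsto (fun j => G j (b j)) U (𝓝 (g p))

lemma GoodSeq.exists_isULim (h : GoodSeq U c₀ E G) : ∃ g, IsULim U E G g := by
  obtain ⟨b₀, hb₀E, hb₀, hb₀z⟩ := h.zero
  choose b hbE hb using h.dense
  have key : ∀ p, ∃ q, Tendsto (fun j => G j (b p j)) U (𝓝 q) := by
    intro p
    have h1 : ∀ᶠ j in U, dbox (b₀ j) (b p j) < dbox 0 p + 1 :=
      (tendsto_dbox hb₀ (hb p)).eventually_lt_const (lt_add_one _)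
    obtain ⟨q, _, hq⟩ := exists_tendsto_ultrafilter U (u := fun j => G j (b p j))
      (isCompact_cball 0 (dbox 0 p + 1)) (by
        filter_upwards [h1, hb₀E, hbE p, hb₀z, h.lip] with j h1 h2 h3 h4 h5
        have := h5 _ h2 _ h3
        rw [h4] at this
        exact this.trans h1.le)
    exact ⟨q, hq⟩
  choose g hg using key
  refine ⟨g, fun p b' hb'E hb' => tendsto_of_dbox (hg p) ?_⟩
  have h1 : Tendsto (fun j => dbox (b p j) (b' j)) U (𝓝 0) := by
    simpa only [dbox_self] using tendsto_dbox (hb p) hb'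
  refine squeeze_zero' (Eventually.of_forall fun j => dbox_nonneg _ _) ?_ h1
  filter_upwards [hbE p, hb'E, h.lip] with j h2 h3 h4 using h4 _ h2 _ h3

lemma tendsto_zel {t : ℕ → ℝ} {s : ℝ} (h : Tendsto t U (𝓝 s)) :
    Tendsto (fun j => zel (t j)) U (𝓝 (zel s)) := by
  have : Continuous zel := by unfold zel; fun_prop
  exact (this.tendsto s).comp h

lemma GoodSeq.good (h : GoodSeq U c₀ E G) {g : H → H} (hg : IsULim U E G g) : Good c₀ g where
  zero := by
    obtain ⟨b, hbE, hb, hbz⟩ := h.zero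
    refine tendsto_nhds_unique (hg 0 b hbE hb) (tendsto_const_nhds.congr' ?_)
    filter_upwards [hbz] with j hj using hj.symm
  lip p q := by
    obtain ⟨b, hbE, hb⟩ := h.dense p
    obtain ⟨b', hbE', hb'⟩ := h.dense q
    refine le_of_tendsto_of_tendsto (tendsto_dbox (hg p b hbE hb) (hg q b' hbE' hb'))
      (tendsto_dbox hb hb') ?_
    filter_upwards [hbE, hbE', h.lip] with j h1 h2 h3 using h3 _ h1 _ h2
  content x R hR := by
    by_contra! hlt
    obtain ⟨c, r, hr, hS, hsum⟩ := exists_cover_of_cont_lt hlt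
    have hopen : IsOpen (⋃ n, oball (c n) (r n)) := isOpen_iUnion fun n => isOpen_oball _ _
    have h1 : ∀ᶠ j in U, ∃ b, b ∈ E j ∧ b ∈ cball x R ∧ G j b ∉ ⋃ n, oball (c n) (r n) := by
      filter_upwards [h.content x R hR] with j hj
      by_contra! hno
      refine (hj.trans (cont_le_tsum (c := c) hr ?_)).not_gt hsum
      rintro _ ⟨b, ⟨hbE, hb⟩, rfl⟩
      exact hno b hbE hb
    choose! b hb using fun j (hj : ∃ b, b ∈ E j ∧ b ∈ cball x R ∧
      G j b ∉ ⋃ n, oball (c n) (r n)) => hj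
    obtain ⟨p, hp, hlim⟩ := exists_tendsto_ultrafilter U (u := b) (isCompact_cball x R)
      (h1.mono fun j hj => (hb j hj).2.1)
    have h2 := hg p b (h1.mono fun j hj => (hb j hj).1) hlim
    have h3 := h2.eventually (hopen.mem_nhds (hS ⟨p, hp, rfl⟩))
    obtain ⟨j, hj1, hj2⟩ := (h1.and h3).exists
    exact (hb j hj1).2.2 hj2
  pairs x R m hR := by
    obtain ⟨η, hη, hev⟩ := h.pairs x R m hR
    choose! p hp t ht b hb b' hb' h1 h2 h3 using fun j (hj : ∃ p ∈ cball x R,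
      ∃ t ∈ Set.Icc (R ^ 2 * (1 / 4) ^ m / 1024) (R ^ 2),
      ∃ b ∈ E j, ∃ b' ∈ E j, dbox p b ≤ η j ∧ dbox (Hmul p (zel t)) b' ≤ η j ∧
        dbox (G j b) (G j b') ≤ 8 * (1 / 2) ^ m * √t + η j) => hj
    obtain ⟨q, hq, hpq⟩ := exists_tendsto_ultrafilter U (u := p) (isCompact_cball x R)
      (hev.mono hp)
    obtain ⟨s, hs, hts⟩ := exists_tendsto_ultrafilter U (u := t) isCompact_Icc (hev.mono ht)
    have hbq : Tendsto b U (𝓝 q) := tendsto_of_dbox hpq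
      (squeeze_zero' (Eventually.of_forall fun _ => dbox_nonneg _ _) (hev.mono h1) hη)
    have hbq' : Tendsto b' U (𝓝 (Hmul q (zel s))) :=
      tendsto_of_dbox (tendsto_Hmul hpq (tendsto_zel hts))
        (squeeze_zero' (Eventually.of_forall fun _ => dbox_nonneg _ _) (hev.mono h2) hη)
    refine ⟨q, hq, s, hs, ?_⟩
    have hlim : Tendsto (fun j => 8 * (1 / 2) ^ m * √(t j) + η j) U
        (𝓝 (8 * (1 / 2) ^ m * √s + 0)) :=
      ((Real.continuous_sqrt.continuousAt.tendsto.comp hts).const_mul _).add hη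
    rw [add_zero] at hlim
    exact le_of_tendsto_of_tendsto (tendsto_dbox (hg q b (hev.mono hb) hbq)
      (hg _ b' (hev.mono hb') hbq')) hlim (hev.mono h3)

lemma Good.goodSeq {g : ℕ → H → H} (h : ∀ j, Good c₀ (g j)) :
    GoodSeq U c₀ (fun _ => Set.univ) g where
  zero := ⟨fun _ => 0, by simp, tendsto_const_nhds, by simp [(h _).zero]⟩
  lip := Eventually.of_forall fun j b _ b' _ => (h j).lip b b'
  dense p := ⟨fun _ => p, by simp, tendsto_const_nhds⟩
  content x R hR := Eventually.of_forall fun j => by simpa using (h j).content x R hR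
  pairs x R m hR := ⟨fun _ => 0, tendsto_const_nhds, Eventually.of_forall fun j => by
    obtain ⟨p, hp, t, ht, hpt⟩ := (h j).pairs x R m hR
    exact ⟨p, hp, t, ht, p, trivial, _, trivial, (dbox_self _).le, (dbox_self _).le, by simpa using hpt⟩⟩

lemma Good.exists_limit (U : Ultrafilter ℕ) {g : ℕ → H → H} (h : ∀ j, Good c₀ (g j)) :
    ∃ g', Good c₀ g' ∧ ∀ p, Tendsto (fun j => g j p) U (𝓝 (g' p)) := by
  have hs := Good.goodSeq (U := U) h
  obtain ⟨g', hg'⟩ := hs.exists_isULim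
  exact ⟨g', hs.good hg', fun p => hg' p (fun _ => p) (by simp) tendsto_const_nhds⟩

/-- The rescaling of a map at a point. -/
noncomputable def resc (g : H → H) (x : H) (lam : ℝ) (p : H) : H :=
  dil lam⁻¹ (Hmul (Hinv (g x)) (g (Hmul x (dil lam p))))

lemma dbox_resc {g : H → H} (x : H) {lam : ℝ} (hl : 0 < lam) (p q : H) :
    dbox (resc g x lam p) (resc g x lam q) =
      lam⁻¹ * dbox (g (Hmul x (dil lam p))) (g (Hmul x (dil lam q))) := by
  rw [resc, resc, dbox_dil (by positivity), dbox_Hmul]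

lemma image_cball {x : H} {lam : ℝ} (hl : 0 < lam) (y : H) (R : ℝ) :
    (fun p => Hmul x (dil lam p)) '' cball y R = cball (Hmul x (dil lam y)) (lam * R) := by
  ext q
  constructor
  · rintro ⟨p, hp, rfl⟩
    have : dbox y p ≤ R := hp
    simp only [cball, Set.mem_ofPred_eq, dbox_Hmul, dbox_dil hl.le]
    gcongr
  · intro hq
    have hq' : dbox (Hmul x (dil lam y)) q ≤ lam * R := hq
    refine ⟨dil lam⁻¹ (Hmul (Hinv x) q), ?_, ?_⟩
    · have e : q = Hmul x (dil lam (dil lam⁻¹ (Hmul (Hinv x) q))) := by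
        rw [dil_dil_inv hl.ne', Hmul_Hinv_cancel]
      rw [e, dbox_Hmul, dbox_dil hl.le] at hq'
      exact le_of_mul_le_mul_left hq' hl
    · simp only [dil_dil_inv hl.ne', Hmul_Hinv_cancel]

lemma Good.resc {g : H → H} (h : Good c₀ g) (x : H) {lam : ℝ} (hl : 0 < lam) :
    Good c₀ (resc g x lam) where
  zero := by simp [Heis.resc]
  lip p q := by
    rw [dbox_resc x hl, inv_mul_le_iff₀ hl]
    refine (h.lip _ _).trans ?_
    rw [dbox_Hmul, dbox_dil hl.le]
  content y R hR := by
    have h1 := h.content (Hmul x (dil lam y)) (lam * R) (by positivity)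
    rw [← image_cball hl, Set.image_image] at h1
    have h2 := cont_image_le (ψ := fun q => Hmul (g x) (dil lam q)) hl
      (fun a b => by rw [dbox_Hmul, dbox_dil hl.le]) (Heis.resc g x lam '' cball y R)
    rw [Set.image_image] at h2
    simp only [Heis.resc, dil_dil_inv hl.ne', Hmul_Hinv_cancel] at h2
    have h3 := h1.trans h2
    have hl4 : ENNReal.ofReal (lam ^ 4) ≠ 0 := by
      rw [Ne, ENNReal.ofReal_eq_zero, not_le]; positivity
    rw [mul_pow, ENNReal.ofReal_mul (by positivity), mul_left_comm] at h3
    exact (ENNReal.mul_le_mul_iff_right hl4 ENNReal.ofReal_ne_top).1 h3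
  pairs y R m hR := by
    obtain ⟨q, hq, t, ⟨ht1, ht2⟩, hqt⟩ := h.pairs (Hmul x (dil lam y)) (lam * R) m (by positivity)
    rw [← image_cball hl] at hq
    obtain ⟨p, hp, rfl⟩ := hq
    have hl2 : 0 < lam ^ 2 := by positivity
    have ht0 : 0 ≤ t := le_trans (by positivity) ht1
    refine ⟨p, hp, t / lam ^ 2, ⟨?_, ?_⟩, ?_⟩
    · rw [le_div_iff₀ hl2]
      calc R ^ 2 * (1 / 4) ^ m / 1024 * lam ^ 2 = (lam * R) ^ 2 * (1 / 4) ^ m / 1024 := by ring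
        _ ≤ t := ht1
    · rw [div_le_iff₀ hl2]
      linarith [mul_pow lam R 2]
    · rw [dbox_resc x hl, inv_mul_le_iff₀ hl]
      have e : Hmul x (dil lam (Hmul p (zel (t / lam ^ 2)))) = Hmul (Hmul x (dil lam p)) (zel t) := by
        rw [dil_Hmul, Hmul_assoc]
        congr 2
        ext <;> simp [dil, zel]
        field_simp
      rw [e, Real.sqrt_div ht0, Real.sqrt_sq hl.le]
      refine hqt.trans (le_of_eq ?_)
      field_simp

end

/-! ### Almost maximal maps -/

/-- One-Lipschitz maps from a subset of the tile, with the shortcut distance, to the group. -/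
def Adm (B : Set H) (F : H → H) : Prop :=
  B ⊆ tile ∧ ∀ x ∈ B, ∀ y ∈ B, dbox (F x) (F y) ≤ sdist x y

lemma Adm.cont_le {B : Set H} {F : H → H} (h : Adm B F) : cont (F '' B) ≤ ENNReal.ofReal 81 := by
  rcases B.eq_empty_or_nonempty with rfl | ⟨b, hb⟩
  · simp
  · refine (cont_le_ofReal (c := F b) (r := 3) (by norm_num) ?_).trans (le_of_eq (by norm_num))
    rintro _ ⟨x, hx, rfl⟩
    have h1 := (h.2 b hb x hx).trans ((sdist_le_dbox _ _).trans
      (dbox_le_two_of_tile (h.1 hb) (h.1 hx)))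
    exact lt_of_le_of_lt h1 (by norm_num)

/-- The supremum of the contents of the images of one-Lipschitz maps. -/
noncomputable def maxCont : ℝ≥0∞ := ⨆ (B : Set H) (F : H → H) (_ : Adm B F), cont (F '' B)

lemma Adm.cont_le_maxCont {B : Set H} {F : H → H} (h : Adm B F) : cont (F '' B) ≤ maxCont :=
  le_iSup₂_of_le B F (le_iSup_of_le h le_rfl)

lemma maxCont_ne_top : maxCont ≠ ∞ :=
  ne_top_of_le_ne_top ENNReal.ofReal_ne_top (iSup₂_le fun _ _ => iSup_le fun h => h.cont_le)

/-- The part of `B` in a subtile, rescaled. -/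
def subSet (N : ℕ) (g : H) (B : Set H) : Set H := {p | p ∈ tile ∧ Phi N g p ∈ B}

/-- The restriction of `F` to a subtile, rescaled. -/
noncomputable def subMap (N : ℕ) (g : H) (F : H → H) (p : H) : H := dil (2 ^ N) (F (Phi N g p))

lemma Adm.sub {B : Set H} {F : H → H} (h : Adm B F) (N : ℕ) {g : H} (hg : IsLat g) :
    Adm (subSet N g B) (subMap N g F) := by
  refine ⟨fun p hp => hp.1, fun x hx y hy => ?_⟩
  rw [subMap, subMap, dbox_dil (by positivity)]
  have h1 := (h.2 _ hx.2 _ hy.2).trans (sdist_Phi_le N hg x y)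
  calc 2 ^ N * dbox (F (Phi N g x)) (F (Phi N g y)) ≤ 2 ^ N * ((1 / 2) ^ N * sdist x y) := by
        gcongr
    _ = sdist x y := by rw [← mul_assoc, mul_comm (2 ^ N), half_pow_mul_two_pow, one_mul]

lemma Adm.maxCont_le_dig {B : Set H} {F : H → H} (h : Adm B F) {η : ℝ≥0∞}
    (hη : maxCont ≤ cont (F '' B) + η) (i : Fin 2 × Fin 2 × Fin 4) :
    maxCont ≤ cont (subMap 1 (dig i) F '' subSet 1 (dig i) B) + 16 * η := by
  have h16 : (16 : ℝ≥0∞) * ENNReal.ofReal ((1 / 2) ^ 4) = 1 := by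
    rw [← ENNReal.ofReal_ofNat 16, ← ENNReal.ofReal_mul (by norm_num)]
    norm_num
  have hcov : F '' B ⊆ ⋃ i, dil (1 / 2) '' (subMap 1 (dig i) F '' subSet 1 (dig i) B) := by
    rintro _ ⟨x, hx, rfl⟩
    obtain ⟨i, p, hp, rfl⟩ := Set.mem_iUnion.1 (tile_subset_iUnion (h.1 hx))
    refine Set.mem_iUnion.2 ⟨i, _, ⟨p, ⟨hp, hx⟩, rfl⟩, ?_⟩
    rw [subMap, dil_dil]
    norm_num
  have h1 : 16 * cont (F '' B) ≤ ∑ i, cont (subMap 1 (dig i) F '' subSet 1 (dig i) B) := by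
    calc 16 * cont (F '' B)
        ≤ 16 * ∑ i, ENNReal.ofReal ((1 / 2) ^ 4) *
            cont (subMap 1 (dig i) F '' subSet 1 (dig i) B) := by
          gcongr
          refine (measure_mono hcov).trans ((measure_iUnion_fintype_le _ _).trans ?_)
          exact Finset.sum_le_sum fun i _ => cont_image_le (by norm_num)
            (fun x y => (dbox_dil (by norm_num) x y).le) _
      _ = _ := by rw [← Finset.mul_sum, ← mul_assoc, h16, one_mul]
  rw [← Finset.add_sum_erase _ _ (Finset.mem_univ i)] at h1
  have h2 : ∑ k ∈ Finset.univ.erase i, cont (subMap 1 (dig k) F '' subSet 1 (dig k) B) ≤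
      15 * maxCont := by
    refine (Finset.sum_le_card_nsmul _ _ maxCont fun k _ =>
      (h.sub 1 (IsLat_dig k)).cont_le_maxCont).trans (le_of_eq ?_)
    rw [Finset.card_erase_of_mem (Finset.mem_univ i), nsmul_eq_mul]
    norm_num
  have h3 : 15 * maxCont + maxCont ≤
      15 * maxCont + (cont (subMap 1 (dig i) F '' subSet 1 (dig i) B) + 16 * η) := by
    calc 15 * maxCont + maxCont = 16 * maxCont := by ring
      _ ≤ 16 * (cont (F '' B) + η) := by gcongr
      _ = 16 * cont (F '' B) + 16 * η := mul_add _ _ _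
      _ ≤ (cont (subMap 1 (dig i) F '' subSet 1 (dig i) B) + 15 * maxCont) + 16 * η := by
          gcongr
          exact h1.trans (by gcongr)
      _ = _ := by ring
  exact (ENNReal.add_le_add_iff_left
    (ENNReal.mul_ne_top (by norm_num) maxCont_ne_top)).1 h3

lemma Adm.maxCont_le_sub {B : Set H} {F : H → H} (h : Adm B F) {η : ℝ≥0∞}
    (hη : maxCont ≤ cont (F '' B) + η) {N : ℕ} {g : H} (hg : Addr N g) :
    maxCont ≤ cont (subMap N g F '' subSet N g B) + 16 ^ N * η := by
  induction hg with
  | zero =>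
    refine hη.trans ?_
    rw [pow_zero, one_mul]
    gcongr
    rintro _ ⟨x, hx, rfl⟩
    exact ⟨x, ⟨h.1 hx, by rwa [Phi_zero]⟩, by simp [subMap, Phi_zero]⟩
  | @succ N g i hg ih =>
    have h1 := (h.sub N hg.isLat).maxCont_le_dig ih i
    rw [pow_succ' (16 : ℝ≥0∞), mul_assoc]
    refine h1.trans ?_
    gcongr
    rintro _ ⟨x, ⟨hx, hx', hx''⟩, rfl⟩
    rw [Phi_Phi] at hx''
    refine ⟨x, ⟨hx, hx''⟩, ?_⟩
    rw [subMap, subMap, subMap, Phi_Phi, dil_dil, pow_add, mul_comm]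

lemma cont_subMap_le (N : ℕ) (g : H) (B : Set H) (F : H → H) :
    cont (subMap N g F '' subSet N g B) ≤
      ENNReal.ofReal ((2 ^ N) ^ 4) * cont (F '' (B ∩ Phi N g '' tile)) := by
  refine le_trans (measure_mono ?_) (cont_image_le (ψ := dil (2 ^ N)) (by positivity)
    (fun x y => (dbox_dil (by positivity) x y).le) _)
  rintro _ ⟨x, ⟨hx, hx'⟩, rfl⟩
  exact ⟨_, ⟨_, ⟨hx', x, hx, rfl⟩, rfl⟩, rfl⟩

lemma exists_almost_maximal (h0 : maxCont ≠ 0) (j : ℕ) :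
    ∃ (B : Set H) (F : H → H), Adm B F ∧ ∀ N ≤ 2 * j, ∀ g, Addr N g →
      maxCont / 2 ≤ ENNReal.ofReal ((2 ^ N) ^ 4) * cont (F '' (B ∩ Phi N g '' tile)) := by
  have hpow : ∀ n : ℕ, (16 : ℝ≥0∞) ^ n ≠ ∞ := fun n => ENNReal.pow_ne_top (by norm_num)
  have hη0 : maxCont / 2 / 16 ^ (2 * j) ≠ 0 :=
    (ENNReal.div_pos (ENNReal.div_pos h0 (by norm_num)).ne' (hpow _)).ne'
  have h1 : maxCont - maxCont / 2 / 16 ^ (2 * j) < maxCont :=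
    ENNReal.sub_lt_self maxCont_ne_top h0 hη0
  nth_rewrite 3 [maxCont] at h1
  obtain ⟨B, h1⟩ := lt_iSup_iff.1 h1
  obtain ⟨F, h1⟩ := lt_iSup_iff.1 h1
  obtain ⟨hadm, h1⟩ := lt_iSup_iff.1 h1
  refine ⟨B, F, hadm, fun N hN g hg => ?_⟩
  have h2 := hadm.maxCont_le_sub (tsub_le_iff_right.1 h1.le) hg
  have h3 : 16 ^ N * (maxCont / 2 / 16 ^ (2 * j)) ≤ maxCont / 2 := by
    calc (16 : ℝ≥0∞) ^ N * (maxCont / 2 / 16 ^ (2 * j))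
        ≤ 16 ^ (2 * j) * (maxCont / 2 / 16 ^ (2 * j)) := by
          gcongr
          norm_num
      _ = maxCont / 2 := ENNReal.mul_div_cancel (by simp) (hpow _)
  have h4 : maxCont / 2 + maxCont / 2 ≤
      cont (subMap N g F '' subSet N g B) + maxCont / 2 := by
    rw [ENNReal.add_halves]
    exact h2.trans (by gcongr)
  have h5 := (ENNReal.add_le_add_iff_right
    (ENNReal.div_ne_top maxCont_ne_top (by norm_num))).1 h4
  exact h5.trans (cont_subMap_le N g B F)

/-! ### Blowing up at an interior point of the tile -/

/-- The point at which we blow up. -/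
noncomputable def ctr : H := (1 / 2, 1 / 2, 1 / 2)

/-- The blow-up coordinates. -/
noncomputable def zoom (j : ℕ) (y : H) : H := dil (2 ^ j) (Hmul (Hinv ctr) y)

/-- The inverse of the blow-up coordinates. -/
noncomputable def unzoom (j : ℕ) (p : H) : H := Hmul ctr (dil ((1 / 2) ^ j) p)

lemma zoom_unzoom (j : ℕ) (p : H) : zoom j (unzoom j p) = p := by
  rw [zoom, unzoom, Hinv_Hmul_cancel, dil_dil, mul_comm, half_pow_mul_two_pow, dil_one]

lemma unzoom_zoom (j : ℕ) (y : H) : unzoom j (zoom j y) = y := by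
  rw [zoom, unzoom, dil_dil, half_pow_mul_two_pow, dil_one, Hmul_Hinv_cancel]

lemma dbox_zoom (j : ℕ) (x y : H) : dbox (zoom j x) (zoom j y) = 2 ^ j * dbox x y := by
  rw [zoom, zoom, dbox_dil (by positivity), dbox_Hmul]

lemma tendsto_unzoom (p : H) : Tendsto (fun j => unzoom j p) atTop (𝓝 ctr) := by
  have h : Tendsto (fun j : ℕ => dil ((1 / 2 : ℝ) ^ j) p) atTop (𝓝 (dil 0 p)) :=
    tendsto_dil (tendsto_pow_atTop_nhds_zero_of_lt_one (by norm_num) (by norm_num))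
      tendsto_const_nhds
  have e : dil 0 p = 0 := by ext <;> simp [dil]
  rw [e] at h
  simpa only [unzoom, Hmul_zero] using tendsto_Hmul (tendsto_const_nhds (x := ctr)) h

lemma eventually_unzoom_mem (p : H) : ∀ᶠ j in atTop, unzoom j p ∈ tile :=
  (tendsto_unzoom p).eventually tile_mem_nhds

lemma tendsto_const_mul_half_pow (a : ℝ) :
    Tendsto (fun j : ℕ => a * (1 / 2 : ℝ) ^ j) atTop (𝓝 0) := by
  simpa using (tendsto_pow_atTop_nhds_zero_of_lt_one (r := (1 / 2 : ℝ)) (by norm_num)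
    (by norm_num)).const_mul a

/-- Small balls in blow-up coordinates contain subtiles of comparable size. -/
lemma eventually_exists_subtile (x : H) {R : ℝ} (hR : 0 < R) :
    ∀ᶠ j : ℕ in atTop, ∃ N ≤ 2 * j, ∃ g, Addr N g ∧
      (∀ u ∈ tile, zoom j (Phi N g u) ∈ cball x R) ∧
      2 * (2 ^ j * (1 / 2) ^ N) < R ∧ R ≤ 4 * (2 ^ j * (1 / 2 : ℝ) ^ N) := by
  filter_upwards [eventually_unzoom_mem x,
    (tendsto_const_mul_half_pow R).eventually_lt_const two_pos,
    (tendsto_const_mul_half_pow 4).eventually_lt_const hR] with j h1 h2 h3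
  obtain ⟨N, hN1, hN2⟩ := exists_scale (r := R * (1 / 2) ^ j) (by positivity) h2
  obtain ⟨g, hg, p, hp, hpx⟩ := exists_addr N h1
  have hj := half_pow_mul_two_pow j
  have h2j : (0 : ℝ) < 2 ^ j := by positivity
  have e : R * (1 / 2) ^ j * 2 ^ j = R := by rw [mul_assoc, hj, mul_one]
  have hN1' : 2 * (2 ^ j * (1 / 2) ^ N) < R := by
    have := mul_lt_mul_of_pos_right hN1 h2j
    rw [e] at this
    linarith
  have hN2' : R ≤ 4 * (2 ^ j * (1 / 2) ^ N) := by
    have := mul_le_mul_of_nonneg_right hN2 h2j.le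
    rw [e] at this
    linarith
  refine ⟨N, ?_, g, hg, fun u hu => ?_, hN1', hN2'⟩
  · by_contra! hlt
    have h4 : (1 / 2 : ℝ) ^ N ≤ (1 / 2) ^ (2 * j) :=
      pow_le_pow_of_le_one (by norm_num) (by norm_num) hlt.le
    have h5 : (2 : ℝ) ^ j * (1 / 2) ^ (2 * j) = (1 / 2) ^ j := by
      rw [two_mul, pow_add, ← mul_assoc, mul_comm (2 ^ j), hj, one_mul]
    have h6 : (2 : ℝ) ^ j * (1 / 2) ^ N ≤ 2 ^ j * (1 / 2) ^ (2 * j) := by gcongr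
    linarith
  · change dbox x _ ≤ R
    rw [← zoom_unzoom j x, dbox_zoom, ← hpx, dbox_Phi]
    have h4 := dbox_le_two_of_tile hp hu
    calc 2 ^ j * ((1 / 2) ^ N * dbox p u) ≤ 2 ^ j * ((1 / 2) ^ N * 2) := by gcongr
      _ ≤ R := by linarith

lemma addr_zero (m : ℕ) : Addr m 0 := by
  induction m with
  | zero => exact .zero
  | succ m ih =>
    have h := Addr.succ (0, 0, 0) ih
    have e : Hmul (dil (2 ^ 1) 0) (dig (0, 0, 0)) = 0 := by ext <;> simp [Hmul, dil, dig]
    rwa [e] at h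

lemma bp_mem_tile (e : Bool) : bp e ∈ tile := by
  refine interior_tile_aux ⟨⟨?_, ?_⟩, ⟨?_, ?_⟩, ?_, ?_⟩ <;> cases e <;> norm_num [bp]

lemma dil_Hmul_zel (lam : ℝ) (p : H) (t : ℝ) :
    dil lam (Hmul p (zel t)) = Hmul (dil lam p) (zel (lam ^ 2 * t)) := by
  rw [dil_Hmul]
  congr 1
  ext <;> simp [dil, zel]

lemma Phi_Hmul_zel (N : ℕ) (g p : H) (t : ℝ) :
    Phi N g (Hmul p (zel t)) = Hmul (Phi N g p) (zel (((1 / 2) ^ N) ^ 2 * t)) := by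
  rw [Phi, ← Hmul_assoc, dil_Hmul_zel, Phi]

lemma zoom_Hmul_zel (j : ℕ) (p : H) (t : ℝ) :
    zoom j (Hmul p (zel t)) = Hmul (zoom j p) (zel ((2 ^ j) ^ 2 * t)) := by
  rw [zoom, ← Hmul_assoc, dil_Hmul_zel, zoom]

lemma bp_true : bp true = Hmul (bp false) (zel (1 / 64)) := by
  ext <;> simp [bp, zel, Hmul]

theorem exists_good_of_maxCont (h0 : maxCont ≠ 0) : ∃ c₀ : ℝ≥0∞, c₀ ≠ 0 ∧ ∃ g, Good c₀ g := by
  choose B F hadm hdef using exists_almost_maximal h0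
  have hhalf : maxCont / 2 ≠ 0 := (ENNReal.div_pos h0 (by norm_num)).ne'
  have hne : ∀ j, ∀ y ∈ tile, ∃ b ∈ B j, dbox y b ≤ 2 * (1 / 2) ^ (2 * j) := by
    intro j y hy
    obtain ⟨g, hg, p, hp, rfl⟩ := exists_addr (2 * j) hy
    have h1 := hdef j (2 * j) le_rfl g hg
    have h2 : (B j ∩ Phi (2 * j) g '' tile).Nonempty := by
      by_contra hemp
      rw [Set.not_nonempty_iff_eq_empty.1 hemp, Set.image_empty, measure_empty, mul_zero] at h1
      exact hhalf (le_antisymm h1 bot_le)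
    obtain ⟨_, hb, u, hu, rfl⟩ := h2
    refine ⟨_, hb, ?_⟩
    have h3 := dbox_le_two_of_tile hp hu
    have h4 : (0 : ℝ) < (1 / 2) ^ (2 * j) := by positivity
    rw [dbox_Phi]
    nlinarith
  have hctr : ctr ∈ tile := mem_of_mem_nhds tile_mem_nhds
  choose base hbase hbased using fun j => hne j ctr hctr
  let E : ℕ → Set H := fun j => {p | unzoom j p ∈ B j}
  let G : ℕ → H → H := fun j p => dil (2 ^ j) (Hmul (Hinv (F j (base j))) (F j (unzoom j p)))
  have hpow : ∀ j : ℕ, (2 : ℝ) ^ j * (2 * (1 / 2) ^ (2 * j)) = 2 * (1 / 2) ^ j := fun j => by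
    rw [two_mul j, pow_add]
    linear_combination (2 * (1 / 2 : ℝ) ^ j) * half_pow_mul_two_pow j
  have hG : ∀ j, ∀ b ∈ E j, ∀ b' ∈ E j,
      dbox (G j b) (G j b') ≤ 2 ^ j * sdist (unzoom j b) (unzoom j b') := by
    intro j b hb b' hb'
    simp only [G]
    rw [dbox_dil (by positivity), dbox_Hmul]
    gcongr
    exact (hadm j).2 _ hb _ hb'
  have hnear : ∀ j, ∀ y ∈ tile, ∃ b ∈ E j, dbox (zoom j y) b ≤ 2 * (1 / 2) ^ j := by
    intro j y hy
    obtain ⟨b, hb, hyb⟩ := hne j y hy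
    refine ⟨zoom j b, by simpa only [E, Set.mem_ofPred_eq, unzoom_zoom] using hb, ?_⟩
    rw [dbox_zoom, ← hpow]
    gcongr
  let U : Ultrafilter ℕ := hyperfilter ℕ
  have hU : (U : Filter ℕ) ≤ atTop := Nat.hyperfilter_le_atTop
  have hgs : GoodSeq U (maxCont / 2 / 256) E G := by
    refine ⟨?_, ?_, ?_, ?_, ?_⟩
    · refine ⟨fun j => zoom j (base j), Eventually.of_forall fun j => ?_,
        tendsto_zero_of_dbox ?_, Eventually.of_forall fun j => ?_⟩
      · simpa only [E, Set.mem_ofPred_eq, unzoom_zoom] using hbase j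
      · refine squeeze_zero (fun _ => dbox_nonneg _ _) (fun j => ?_)
          ((tendsto_const_mul_half_pow 2).mono_left hU)
        have e : (0 : H) = zoom j ctr := by simp [zoom]
        rw [e, dbox_zoom, ← hpow]
        gcongr
        exact hbased j
      · simp only [G, unzoom_zoom, Hinv_Hmul_self]
        ext <;> simp [dil]
    · refine Eventually.of_forall fun j b hb b' hb' => (hG j b hb b' hb').trans ?_
      rw [← zoom_unzoom j b, ← zoom_unzoom j b', dbox_zoom, zoom_unzoom, zoom_unzoom]
      gcongr
      exact sdist_le_dbox _ _
    · intro p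
      choose! b hbE hb using fun j (hj : unzoom j p ∈ tile) => hnear j _ hj
      have hev := (eventually_unzoom_mem p).filter_mono hU
      refine ⟨b, hev.mono hbE, tendsto_of_dbox (tendsto_const_nhds (x := p))
        (squeeze_zero' (Eventually.of_forall fun _ => dbox_nonneg _ _) ?_
          ((tendsto_const_mul_half_pow 2).mono_left hU))⟩
      filter_upwards [hev] with j hj
      simpa only [zoom_unzoom] using hb j hj
    · intro x R hR
      filter_upwards [(eventually_exists_subtile x hR).filter_mono hU] with j hj
      obtain ⟨N, hN, g, hg, hsub, hN1, hN2⟩ := hj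
      have h1 := hdef j N hN g hg
      have h2 : cont (F j '' (B j ∩ Phi N g '' tile)) ≤
          ENNReal.ofReal (((1 / 2) ^ j) ^ 4) * cont (G j '' (E j ∩ cball x R)) := by
        refine le_trans (measure_mono ?_) (cont_image_le
          (ψ := fun q => Hmul (F j (base j)) (dil ((1 / 2) ^ j) q)) (by positivity)
          (fun a b => by rw [dbox_Hmul, dbox_dil (by positivity)]) _)
        rintro _ ⟨_, ⟨hb, u, hu, rfl⟩, rfl⟩
        refine ⟨_, ⟨zoom j (Phi N g u), ⟨?_, hsub u hu⟩, rfl⟩, ?_⟩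
        · simpa only [E, Set.mem_ofPred_eq, unzoom_zoom] using hb
        · simp only [G, unzoom_zoom]
          rw [dil_dil, half_pow_mul_two_pow, dil_one, Hmul_Hinv_cancel]
      have h3 : maxCont / 2 ≤ ENNReal.ofReal ((2 ^ N) ^ 4 * ((1 / 2) ^ j) ^ 4) *
          cont (G j '' (E j ∩ cball x R)) := by
        rw [ENNReal.ofReal_mul (by positivity), mul_assoc]
        exact h1.trans (by gcongr)
      have h4 : (2 ^ N) ^ 4 * ((1 / 2) ^ j) ^ 4 * (R ^ 4 / 256) ≤ (1 : ℝ) := by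
        have h5 : R ^ 4 ≤ (4 * (2 ^ j * (1 / 2) ^ N)) ^ 4 := by gcongr
        calc (2 ^ N) ^ 4 * ((1 / 2) ^ j) ^ 4 * (R ^ 4 / 256)
            ≤ (2 ^ N) ^ 4 * ((1 / 2) ^ j) ^ 4 * ((4 * (2 ^ j * (1 / 2) ^ N)) ^ 4 / 256) := by
              gcongr
          _ = ((1 / 2) ^ N * 2 ^ N) ^ 4 * ((1 / 2) ^ j * 2 ^ j) ^ 4 := by ring
          _ = 1 := by rw [half_pow_mul_two_pow, half_pow_mul_two_pow]; norm_num
      calc maxCont / 2 / 256 * ENNReal.ofReal (R ^ 4)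
          = maxCont / 2 * ENNReal.ofReal (R ^ 4 / 256) := by
            rw [ENNReal.ofReal_div_of_pos (by norm_num), ENNReal.ofReal_ofNat,
              ENNReal.div_eq_inv_mul, ENNReal.div_eq_inv_mul (a := ENNReal.ofReal _)]
            ring
        _ ≤ ENNReal.ofReal ((2 ^ N) ^ 4 * ((1 / 2) ^ j) ^ 4) *
              cont (G j '' (E j ∩ cball x R)) * ENNReal.ofReal (R ^ 4 / 256) := by gcongr
        _ = ENNReal.ofReal ((2 ^ N) ^ 4 * ((1 / 2) ^ j) ^ 4 * (R ^ 4 / 256)) *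
              cont (G j '' (E j ∩ cball x R)) := by
            rw [ENNReal.ofReal_mul (q := R ^ 4 / 256) (by positivity)]
            ring
        _ ≤ 1 * cont (G j '' (E j ∩ cball x R)) := by
            gcongr
            exact ENNReal.ofReal_le_one.2 h4
        _ = _ := one_mul _
    · intro x R m hR
      refine ⟨fun j => 4 * (1 / 2) ^ j, (tendsto_const_mul_half_pow 4).mono_left hU, ?_⟩
      filter_upwards [(eventually_exists_subtile x hR).filter_mono hU] with j hj
      obtain ⟨N, -, g, hg, hsub, hN1, hN2⟩ := hj
      have hu : ∀ e, Phi m 0 (bp e) ∈ tile := fun e => (addr_zero m).mem_tile (bp_mem_tile e)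
      obtain ⟨b, hb, hPb⟩ := hnear j _ (hg.mem_tile (hu false))
      obtain ⟨b', hb', hQb⟩ := hnear j _ (hg.mem_tile (hu true))
      have hs : (0 : ℝ) < (1 / 2) ^ j := by positivity
      set a : ℝ := 2 ^ j * (1 / 2) ^ N with ha
      have ha0 : 0 < a := by positivity
      have hm : (1 / 4 : ℝ) ^ m = ((1 / 2) ^ m) ^ 2 := by
        rw [← pow_mul, mul_comm, pow_mul]; norm_num
      have hm0 : (0 : ℝ) < (1 / 2) ^ m := by positivity
      have hm1 : (1 / 2 : ℝ) ^ m ≤ 1 := pow_le_one₀ (by norm_num) (by norm_num)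
      have hsq : √((a * (1 / 2) ^ m / 8) ^ 2) = a * (1 / 2) ^ m / 8 := Real.sqrt_sq (by positivity)
      refine ⟨zoom j (Phi N g (Phi m 0 (bp false))), hsub _ (hu false),
        (a * (1 / 2) ^ m / 8) ^ 2, ⟨?_, ?_⟩, b, hb, b', hb', hPb.trans (by linarith), ?_, ?_⟩
      · rw [hm]
        calc R ^ 2 * ((1 / 2) ^ m) ^ 2 / 1024 ≤ (4 * a) ^ 2 * ((1 / 2) ^ m) ^ 2 / 1024 := by
              gcongr
          _ = (a * (1 / 2) ^ m / 8) ^ 2 := by ring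
      · have : a * (1 / 2) ^ m ≤ a * 1 := by gcongr
        gcongr
        linarith
      · have e : Hmul (zoom j (Phi N g (Phi m 0 (bp false)))) (zel ((a * (1 / 2) ^ m / 8) ^ 2)) =
            zoom j (Phi N g (Phi m 0 (bp true))) := by
          rw [bp_true, Phi_Hmul_zel, Phi_Hmul_zel, zoom_Hmul_zel]
          congr 2
          rw [ha]; ring
        rw [e]
        exact hQb.trans (by linarith)
      · rw [hsq]
        refine (hG j b hb b' hb').trans ?_
        have h1 : dbox (zoom j (unzoom j b)) (zoom j (Phi N g (Phi m 0 (bp false)))) ≤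
            2 * (1 / 2) ^ j := by rwa [zoom_unzoom, dbox_comm]
        have h2 : dbox (zoom j (Phi N g (Phi m 0 (bp true)))) (zoom j (unzoom j b')) ≤
            2 * (1 / 2) ^ j := by rwa [zoom_unzoom]
        rw [dbox_zoom] at h1 h2
        have h3 : sdist (Phi N g (Phi m 0 (bp false))) (Phi N g (Phi m 0 (bp true))) ≤
            (1 / 2) ^ N * (1 / 4) ^ m := by
          refine (sdist_Phi_le N hg.isLat _ _).trans ?_
          gcongr
          simpa only [Phi, zero_Hmul] using sdist_shortcut m
        have h4 : sdist (unzoom j b) (unzoom j b') ≤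
            dbox (unzoom j b) (Phi N g (Phi m 0 (bp false))) + (1 / 2) ^ N * (1 / 4) ^ m +
              dbox (Phi N g (Phi m 0 (bp true))) (unzoom j b') := by
          have := sdist_triangle (unzoom j b) (Phi N g (Phi m 0 (bp false))) (unzoom j b')
          have := sdist_triangle (Phi N g (Phi m 0 (bp false))) (Phi N g (Phi m 0 (bp true)))
            (unzoom j b')
          have := sdist_le_dbox (unzoom j b) (Phi N g (Phi m 0 (bp false)))
          have := sdist_le_dbox (Phi N g (Phi m 0 (bp true))) (unzoom j b')
          linarith
        have h5 := mul_le_mul_of_nonneg_left h4 (show (0 : ℝ) ≤ 2 ^ j by positivity)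
        have h6 : (2 : ℝ) ^ j * ((1 / 2) ^ N * (1 / 4) ^ m) =
            8 * (1 / 2) ^ m * (a * (1 / 2) ^ m / 8) := by rw [hm, ha]; ring
        rw [mul_add, mul_add, h6] at h5
        linarith
  obtain ⟨g, hg⟩ := hgs.exists_isULim
  exact ⟨_, (ENNReal.div_pos hhalf (by norm_num)).ne', g, hgs.good hg⟩

/-! ### Linearization of a horizontal coordinate -/

/-- Horizontal elements. -/
def hor (a b : ℝ) : H := (a, b, 0)

lemma dil_hor (t a b : ℝ) : dil t (hor a b) = hor (t * a) (t * b) := by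
  ext <;> simp [dil, hor]

@[simp] lemma hor_zero : hor 0 0 = 0 := rfl

lemma Hmul_hor_hor_of_parallel (s t a b : ℝ) :
    Hmul (hor (s * a) (s * b)) (hor (t * a) (t * b)) = hor ((s + t) * a) ((s + t) * b) := by
  ext <;> simp [Hmul, hor] <;> ring

lemma dbox_zero_hor_le (a b : ℝ) : dbox 0 (hor a b) ≤ √(a ^ 2 + b ^ 2) := by
  have h1 : |a| ≤ √(a ^ 2 + b ^ 2) := Real.abs_le_sqrt (by linarith [sq_nonneg b])
  have h2 : |b| ≤ √(a ^ 2 + b ^ 2) := Real.abs_le_sqrt (by linarith [sq_nonneg a])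
  have h3 : 0 ≤ √(a ^ 2 + b ^ 2) := Real.sqrt_nonneg _
  rw [dbox_le_iff h3]
  exact ⟨by simpa [hor] using h1, by simpa [hor] using h2, by simp [vert, hor]⟩

/-- A homogeneous real-valued homomorphism bounded by the box norm. -/
structure IsCoord (c : H → ℝ) : Prop where
  mul : ∀ p q, c (Hmul p q) = c p + c q
  dil : ∀ t p, c (dil t p) = t * c p
  le : ∀ p, |c p| ≤ dbox 0 p
  cont : Continuous c

lemma isCoord_fst : IsCoord fun p => p.1 where
  mul p q := rfl
  dil t p := rfl
  le p := by simpa using (near_dbox 0 p).1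
  cont := by fun_prop

lemma isCoord_snd : IsCoord fun p => p.2.1 where
  mul p q := rfl
  dil t p := rfl
  le p := by simpa using (near_dbox 0 p).2.1
  cont := by fun_prop

lemma IsCoord.zero {c : H → ℝ} (hc : IsCoord c) : c 0 = 0 := by
  simpa using hc.dil 0 0

lemma IsCoord.inv_mul {c : H → ℝ} (hc : IsCoord c) (p q : H) :
    c (Hmul (Hinv p) q) = c q - c p := by
  have := hc.mul p (Hmul (Hinv p) q)
  rw [Hmul_Hinv_cancel] at this
  linarith

/-- A class of normalized one-Lipschitz maps closed under rescaling and pointwise ultralimits. -/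
structure IsCls (P : (H → H) → Prop) : Prop where
  zero : ∀ g, P g → g 0 = 0
  lip : ∀ g, P g → ∀ p q, dbox (g p) (g q) ≤ dbox p q
  resc : ∀ g, P g → ∀ x lam, 0 < lam → P (resc g x lam)
  lim : ∀ g : ℕ → H → H, (∀ j, P (g j)) →
    ∃ g', P g' ∧ ∀ p, Tendsto (fun j => g j p) (hyperfilter ℕ) (𝓝 (g' p))

lemma IsCoord.resc {c : H → ℝ} (hc : IsCoord c) (g : H → H) (x : H) (lam : ℝ) (p : H) :
    c (resc g x lam p) = lam⁻¹ * (c (g (Hmul x (Heis.dil lam p))) - c (g x)) := by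
  rw [Heis.resc, hc.dil, hc.inv_mul]

section

variable {P : (H → H) → Prop} {c : H → ℝ}

lemma IsCls.exists_max (hP : IsCls P) (hc : IsCoord c) (hne : ∃ g, P g) :
    ∃ g a b, P g ∧ a ^ 2 + b ^ 2 = 1 ∧
      ∀ g', P g' → ∀ a' b', a' ^ 2 + b' ^ 2 = 1 → c (g' (hor a' b')) ≤ c (g (hor a b)) := by
  let S : Set ℝ := {s | ∃ g a b, P g ∧ a ^ 2 + b ^ 2 = 1 ∧ s = c (g (hor a b))}
  have hbdd : BddAbove S := by
    refine ⟨1, ?_⟩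
    rintro _ ⟨g, a, b, hg, hab, rfl⟩
    calc c (g (hor a b)) ≤ dbox 0 (g (hor a b)) := (le_abs_self _).trans (hc.le _)
      _ = dbox (g 0) (g (hor a b)) := by rw [hP.zero g hg]
      _ ≤ dbox 0 (hor a b) := hP.lip g hg _ _
      _ ≤ √(a ^ 2 + b ^ 2) := dbox_zero_hor_le a b
      _ = 1 := by rw [hab, Real.sqrt_one]
  obtain ⟨g₀, hg₀⟩ := hne
  obtain ⟨u, -, hu, huS⟩ := exists_seq_tendsto_sSup (S := S)
    ⟨_, g₀, 1, 0, hg₀, by norm_num, rfl⟩ hbdd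
  choose g a b hg hab hgu using huS
  obtain ⟨g', hg', hlim⟩ := hP.lim g hg
  have hIcc : ∀ x y : ℝ, x ^ 2 + y ^ 2 = 1 → x ∈ Set.Icc (-1 : ℝ) 1 := fun x y h =>
    abs_le.1 (abs_le_one_iff_mul_self_le_one.2 (by nlinarith [sq_nonneg y]))
  obtain ⟨a', -, ha'⟩ := exists_tendsto_ultrafilter (hyperfilter ℕ) (u := a) isCompact_Icc
    (Eventually.of_forall fun j => hIcc _ _ (hab j))
  obtain ⟨b', -, hb'⟩ := exists_tendsto_ultrafilter (hyperfilter ℕ) (u := b) isCompact_Icc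
    (Eventually.of_forall fun j => hIcc _ (a j) (by rw [add_comm]; exact hab j))
  have hab' : a' ^ 2 + b' ^ 2 = 1 :=
    tendsto_nhds_unique ((ha'.pow 2).add (hb'.pow 2)) (by simp only [hab]; exact tendsto_const_nhds)
  have hor_lim : Tendsto (fun j => hor (a j) (b j)) (hyperfilter ℕ) (𝓝 (hor a' b')) :=
    ha'.prodMk_nhds (hb'.prodMk_nhds tendsto_const_nhds)
  have h1 : Tendsto (fun j => g j (hor (a j) (b j))) (hyperfilter ℕ) (𝓝 (g' (hor a' b'))) := by
    refine tendsto_of_dbox (hlim (hor a' b')) (squeeze_zero (fun _ => dbox_nonneg _ _)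
      (fun j => hP.lip _ (hg j) _ _) ?_)
    simpa only [dbox_self] using tendsto_dbox (tendsto_const_nhds (x := hor a' b')) hor_lim
  have h2 : Tendsto (fun j => c (g j (hor (a j) (b j)))) (hyperfilter ℕ)
      (𝓝 (c (g' (hor a' b')))) := (hc.cont.tendsto _).comp h1
  simp only [← hgu] at h2
  have h3 := tendsto_nhds_unique h2 (hu.mono_left Nat.hyperfilter_le_atTop)
  refine ⟨g', a', b', hg', hab', fun g'' hg'' a'' b'' hab'' => ?_⟩
  rw [h3]
  exact le_csSup hbdd ⟨g'', a'', b'', hg'', hab'', rfl⟩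

variable {l : ℝ}

lemma IsCls.slope_le (hP : IsCls P) (hc : IsCoord c)
    (hl : ∀ g', P g' → ∀ a' b', a' ^ 2 + b' ^ 2 = 1 → c (g' (hor a' b')) ≤ l)
    {g : H → H} (hg : P g) (p : H) (a b : ℝ) :
    c (g (Hmul p (hor a b))) - c (g p) ≤ l * √(a ^ 2 + b ^ 2) := by
  rcases (add_nonneg (sq_nonneg a) (sq_nonneg b)).eq_or_lt with h0 | h0
  · have ha : a = 0 := by nlinarith
    have hb : b = 0 := by nlinarith
    simp [ha, hb]
  · set r := √(a ^ 2 + b ^ 2) with hr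
    have hr0 : 0 < r := Real.sqrt_pos.2 h0
    have hr2 : r ^ 2 = a ^ 2 + b ^ 2 := Real.sq_sqrt h0.le
    have h1 := hl _ (hP.resc g hg p r hr0) (a / r) (b / r) (by
      field_simp; rw [hr2])
    rw [hc.resc, dil_hor, mul_div_cancel₀ _ hr0.ne', mul_div_cancel₀ _ hr0.ne',
      inv_mul_le_iff₀ hr0] at h1
    linarith

lemma IsCls.abs_slope_le (hP : IsCls P) (hc : IsCoord c)
    (hl : ∀ g', P g' → ∀ a' b', a' ^ 2 + b' ^ 2 = 1 → c (g' (hor a' b')) ≤ l)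
    {g : H → H} (hg : P g) (p : H) (a b : ℝ) :
    |c (g (Hmul p (hor a b))) - c (g p)| ≤ l * √(a ^ 2 + b ^ 2) := by
  refine abs_le'.2 ⟨hP.slope_le hc hl hg p a b, ?_⟩
  have h1 := hP.slope_le hc hl hg (Hmul p (hor a b)) (-a) (-b)
  have e : Hmul (Hmul p (hor a b)) (hor (-a) (-b)) = p := by
    ext <;> simp [Hmul, hor]
    ring
  rw [e, neg_sq, neg_sq] at h1
  linarith

lemma IsCls.exists_line (hP : IsCls P) (hc : IsCoord c) (hne : ∃ g, P g) :
    ∃ l a b, a ^ 2 + b ^ 2 = 1 ∧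
      (∀ g', P g' → ∀ a' b', a' ^ 2 + b' ^ 2 = 1 → c (g' (hor a' b')) ≤ l) ∧
      ∃ g, P g ∧ ∀ s, c (g (hor (s * a) (s * b))) = l * s := by
  obtain ⟨g, a, b, hg, hab, hmax⟩ := hP.exists_max hc hne
  set l := c (g (hor a b)) with hl
  have hsqrt : ∀ s : ℝ, 0 ≤ s → √((s * a) ^ 2 + (s * b) ^ 2) = s := fun s hs => by
    rw [mul_pow, mul_pow, ← mul_add, hab, mul_one, Real.sqrt_sq hs]
  have hseg : ∀ s : ℝ, 0 ≤ s → s ≤ 1 → c (g (hor (s * a) (s * b))) = l * s := by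
    intro s hs hs1
    have h1 := hP.slope_le hc hmax hg 0 (s * a) (s * b)
    have h2 := hP.slope_le hc hmax hg (hor (s * a) (s * b)) ((1 - s) * a) ((1 - s) * b)
    rw [hsqrt s hs, zero_Hmul, hP.zero g hg, hc.zero] at h1
    rw [hsqrt _ (by linarith), Hmul_hor_hor_of_parallel] at h2
    simp only [add_sub_cancel, one_mul] at h2
    linarith
  refine ⟨l, a, b, hab, hmax, ?_⟩
  obtain ⟨g', hg', hlim⟩ := hP.lim
    (fun j : ℕ => Heis.resc g (hor (1 / 2 * a) (1 / 2 * b)) (1 / ((j : ℝ) + 1)))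
    (fun j => hP.resc g hg _ _ (by positivity))
  refine ⟨g', hg', fun s => ?_⟩
  refine tendsto_nhds_unique ((hc.cont.tendsto _).comp (hlim _)) (tendsto_const_nhds.congr' ?_)
  have hev : ∀ᶠ j : ℕ in atTop, 2 * |s| ≤ (j : ℝ) :=
    tendsto_natCast_atTop_atTop.eventually_ge_atTop _
  filter_upwards [hev.filter_mono Nat.hyperfilter_le_atTop] with j hj
  have hj0 : (0 : ℝ) < (j : ℝ) + 1 := by positivity
  have h1 : |1 / ((j : ℝ) + 1) * s| ≤ 1 / 2 := by
    rw [abs_mul, abs_of_pos (by positivity), div_mul_eq_mul_div, div_le_iff₀ hj0]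
    linarith
  have h2 := abs_le.1 h1
  simp only [Function.comp_apply]
  rw [hc.resc, dil_hor, ← mul_assoc, ← mul_assoc, Hmul_hor_hor_of_parallel,
    hseg _ (by linarith) (by linarith), hseg _ (by norm_num) (by norm_num)]
  field_simp
  ring

end

lemma eq_zero_of_mul_le {A B T : ℝ} (h : ∀ t, T ≤ |t| → A * t ≤ B) : A = 0 := by
  have hs : ∀ A' : ℝ, 0 < A' → (∀ t, |T| ≤ t → A' * t ≤ B) → False := by
    intro A' hA hB
    have h1 := hB (|T| + (|B| + 1) / A') (le_add_of_nonneg_right (by positivity))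
    rw [mul_add, mul_div_cancel₀ _ hA.ne'] at h1
    nlinarith [le_abs_self B, mul_nonneg hA.le (abs_nonneg T)]
  rcases lt_trichotomy A 0 with h0 | h0 | h0
  · refine (hs (-A) (by linarith) fun t ht => ?_).elim
    have := h (-t) (by rw [abs_neg]; exact (le_abs_self T).trans (ht.trans (le_abs_self t)))
    linarith
  · exact h0
  · exact (hs A h0 fun t ht => h t ((le_abs_self T).trans (ht.trans (le_abs_self t)))).elim

/-- Any two points with different horizontal projections are joined by two horizontal steps of
controlled length. -/
lemma exists_two_steps (p : H) (x y : ℝ) (h : 0 < (x - p.1) ^ 2 + (y - p.2.1) ^ 2) :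
    ∃ a b a' b', Hmul (Hmul p (hor a b)) (hor a' b') = hor x y ∧
      (4 * (a ^ 2 + b ^ 2) = (x - p.1) ^ 2 + (y - p.2.1) ^ 2 +
        16 * (p.2.2 + (p.1 * y - p.2.1 * x) / 2) ^ 2 / ((x - p.1) ^ 2 + (y - p.2.1) ^ 2)) ∧
      a' ^ 2 + b' ^ 2 = a ^ 2 + b ^ 2 := by
  set X := x - p.1 with hX
  set Y := y - p.2.1 with hY
  set ζ := p.2.2 + (p.1 * y - p.2.1 * x) / 2 with hζ
  set k := 2 * ζ / (X ^ 2 + Y ^ 2) with hk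
  have hk' : k * (X ^ 2 + Y ^ 2) = 2 * ζ := div_mul_cancel₀ _ h.ne'
  refine ⟨X / 2 - k * Y, Y / 2 + k * X, X / 2 + k * Y, Y / 2 - k * X, ?_, ?_, by ring⟩
  · ext
    · simp only [Hmul, hor]; linarith
    · simp only [Hmul, hor]; linarith
    · simp only [Hmul, hor]
      have ex : x = X + p.1 := by linarith
      have ey : y = Y + p.2.1 := by linarith
      rw [ex, ey] at hζ
      nlinarith
  · have e : 16 * ζ ^ 2 / (X ^ 2 + Y ^ 2) = 4 * k ^ 2 * (X ^ 2 + Y ^ 2) := by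
      rw [hk]; field_simp; ring
    rw [e]; ring

section

variable {P : (H → H) → Prop} {c : H → ℝ}

/-- Some map in the class has a linear coordinate. -/
theorem IsCls.exists_linear (hP : IsCls P) (hc : IsCoord c) (hne : ∃ g, P g) :
    ∃ g, P g ∧ ∃ α β : ℝ, ∀ p : H, c (g p) = α * p.1 + β * p.2.1 := by
  obtain ⟨l, a, b, hab, hmax, g, hg, hline⟩ := hP.exists_line hc hne
  have hl0 : 0 ≤ l := by
    have h1 := hP.abs_slope_le hc hmax hg 0 1 0
    have h2 := (abs_nonneg _).trans h1
    norm_num at h2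
    exact h2
  refine ⟨g, hg, l * a, l * b, fun p => ?_⟩
  set u := c (g p) with hu
  set B := p.1 * a + p.2.1 * b with hB
  set m := p.1 * b - p.2.1 * a with hm
  set n := p.1 ^ 2 + p.2.1 ^ 2 with hn
  have hn0 : 0 ≤ n := by positivity
  have hBn : B ^ 2 ≤ n := by
    have : n = B ^ 2 + m ^ 2 := by rw [hn, hB, hm]; linear_combination (-p.1^2 - p.2.1^2) * hab
    linarith [sq_nonneg m]
  suffices h : l * (l * B - u) = 0 by
    rcases mul_eq_zero.1 h with h | h
    · have hl : ∀ q x y, c (g (Hmul q (hor x y))) = c (g q) := fun q x y => by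
        have h1 := hP.abs_slope_le hc hmax hg q x y
        rwa [h, zero_mul, abs_nonpos_iff, sub_eq_zero] at h1
      obtain ⟨x, y, x', y', hend, -, -⟩ := exists_two_steps p (p.1 + 1) p.2.1 (by norm_num)
      have h1 := hl 0 (p.1 + 1) p.2.1
      rw [zero_Hmul, hP.zero g hg, hc.zero, ← hend, hl, hl] at h1
      rw [hu, h1, h]
      ring
    · rw [hB] at h; linarith
  have key : ∀ t, 4 * |B| + 1 ≤ |t| →
      2 * (l * (l * B - u)) * t ≤ l ^ 2 * (n + 64 * (|p.2.2| + |m| / 2) ^ 2) := by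
    intro t ht
    have ht1 : 1 ≤ |t| := by linarith [abs_nonneg B]
    have ht2 : 1 ≤ t ^ 2 := by rw [← sq_abs]; nlinarith
    set W := (t * a - p.1) ^ 2 + (t * b - p.2.1) ^ 2 with hW
    have hWe : W = t ^ 2 - 2 * t * B + n := by
      rw [hW, hB, hn]; linear_combination t ^ 2 * hab
    have hWt : t ^ 2 / 4 ≤ W := by
      have h1 : t * B ≤ |t| * |B| := by rw [← abs_mul]; exact le_abs_self _
      have h2 : |t| * (4 * |B|) ≤ |t| * |t| := by gcongr; linarith
      rw [← sq, sq_abs] at h2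
      rw [hWe]; linarith
    have hW0 : 0 < W := by linarith
    obtain ⟨x, y, x', y', hend, hxy, hxy'⟩ := exists_two_steps p (t * a) (t * b) hW0
    have h1 := hP.abs_slope_le hc hmax hg p x y
    have h2 := hP.abs_slope_le hc hmax hg (Hmul p (hor x y)) x' y'
    rw [hend, hline, hxy'] at h2
    have h3 : |l * t - u| ≤ 2 * (l * √(x ^ 2 + y ^ 2)) := by
      have := abs_add_le (l * t - c (g (Hmul p (hor x y)))) (c (g (Hmul p (hor x y))) - u)
      rw [sub_add_sub_cancel] at this
      linarith
    have h4 : (l * t - u) ^ 2 ≤ l ^ 2 * (4 * (x ^ 2 + y ^ 2)) := by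
      rw [← sq_abs]
      calc |l * t - u| ^ 2 ≤ (2 * (l * √(x ^ 2 + y ^ 2))) ^ 2 := by gcongr
        _ = l ^ 2 * (4 * √(x ^ 2 + y ^ 2) ^ 2) := by ring
        _ = _ := by rw [Real.sq_sqrt (by positivity)]
    have h5 : 16 * (p.2.2 + (p.1 * (t * b) - p.2.1 * (t * a)) / 2) ^ 2 / W ≤
        64 * (|p.2.2| + |m| / 2) ^ 2 := by
      have h6 : |p.2.2 + (p.1 * (t * b) - p.2.1 * (t * a)) / 2| ≤
          |t| * (|p.2.2| + |m| / 2) := by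
        have e : (p.1 * (t * b) - p.2.1 * (t * a)) / 2 = t * (m / 2) := by rw [hm]; ring
        rw [e]
        refine (abs_add_le _ _).trans ?_
        rw [abs_mul, abs_div, abs_two, mul_add]
        gcongr
        exact le_mul_of_one_le_left (abs_nonneg _) ht1
      rw [div_le_iff₀ hW0]
      calc 16 * (p.2.2 + (p.1 * (t * b) - p.2.1 * (t * a)) / 2) ^ 2
          ≤ 16 * (|t| * (|p.2.2| + |m| / 2)) ^ 2 := by
            rw [← sq_abs (p.2.2 + _)]; gcongr
        _ = 64 * (|p.2.2| + |m| / 2) ^ 2 * (t ^ 2 / 4) := by rw [mul_pow, sq_abs]; ring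
        _ ≤ _ := by gcongr
    have h7 : l ^ 2 * (4 * (x ^ 2 + y ^ 2)) ≤ l ^ 2 * (W + 64 * (|p.2.2| + |m| / 2) ^ 2) := by
      rw [hxy]; gcongr
    rw [hWe] at h7
    nlinarith [sq_nonneg u]
  have := eq_zero_of_mul_le key
  linarith

end

/-! ### Good maps do not exist -/

lemma isCls_good (c₀ : ℝ≥0∞) : IsCls (Good c₀) where
  zero _ h := h.zero
  lip _ h := h.lip
  resc _ h x _ hl := h.resc x hl
  lim _ h := Good.exists_limit _ h

lemma isCls_good_linear (c₀ : ℝ≥0∞) {c : H → ℝ} (hc : IsCoord c) (α β : ℝ) :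
    IsCls fun g => Good c₀ g ∧ ∀ p : H, c (g p) = α * p.1 + β * p.2.1 where
  zero _ h := h.1.zero
  lip _ h := h.1.lip
  resc g h x lam hl := by
    refine ⟨h.1.resc x hl, fun p => ?_⟩
    rw [hc.resc, h.2, h.2]
    simp only [Hmul, dil]
    field_simp
    ring
  lim g h := by
    obtain ⟨g', hg', hlim⟩ := Good.exists_limit (hyperfilter ℕ) fun j => (h j).1
    refine ⟨g', ⟨hg', fun p => ?_⟩, hlim⟩
    refine tendsto_nhds_unique ((hc.cont.tendsto _).comp (hlim p)) (tendsto_const_nhds.congr ?_)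
    intro j
    exact ((h j).2 p).symm

lemma exists_good_linear {c₀ : ℝ≥0∞} (h : ∃ g, Good c₀ g) :
    ∃ g, Good c₀ g ∧ ∃ a b a' b' : ℝ,
      ∀ p : H, (g p).1 = a * p.1 + b * p.2.1 ∧ (g p).2.1 = a' * p.1 + b' * p.2.1 := by
  obtain ⟨g, hg, a, b, hab⟩ := (isCls_good c₀).exists_linear isCoord_fst h
  obtain ⟨g', hg', a', b', hab'⟩ :=
    (isCls_good_linear c₀ isCoord_fst a b).exists_linear isCoord_snd ⟨g, hg, hab⟩
  exact ⟨g', hg'.1, a, b, a', b', fun p => ⟨hg'.2 p, hab' p⟩⟩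

lemma eq_of_abs_sub_le_sq {φ : ℝ → ℝ} {C : ℝ} (h : ∀ s s', |φ s' - φ s| ≤ C * (s' - s) ^ 2) :
    φ 1 = φ 0 := by
  have h1 : ∀ n : ℕ, |φ 1 - φ 0| ≤ C * (1 / ((n : ℝ) + 1)) := by
    intro n
    have hn : (0 : ℝ) < (n : ℝ) + 1 := by positivity
    have h2 : ∀ k : ℕ, |φ (k / ((n : ℝ) + 1)) - φ 0| ≤ k * (C * (1 / ((n : ℝ) + 1)) ^ 2) := by
      intro k
      induction k with
      | zero => simp
      | succ k ih =>
        have h3 := h (k / ((n : ℝ) + 1)) ((k + 1 : ℕ) / ((n : ℝ) + 1))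
        have e : ((k + 1 : ℕ) : ℝ) / ((n : ℝ) + 1) - k / ((n : ℝ) + 1) = 1 / ((n : ℝ) + 1) := by
          push_cast; ring
        rw [e] at h3
        have h4 := abs_add_le (φ ((k + 1 : ℕ) / ((n : ℝ) + 1)) - φ (k / ((n : ℝ) + 1)))
          (φ (k / ((n : ℝ) + 1)) - φ 0)
        rw [sub_add_sub_cancel] at h4
        push_cast at *
        linarith
    have h5 := h2 (n + 1)
    push_cast at h5
    rw [div_self hn.ne'] at h5
    refine h5.trans (le_of_eq ?_)
    field_simp
  have h6 := ge_of_tendsto' (tendsto_one_div_add_atTop_nhds_zero_nat.const_mul C) h1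
  rw [mul_zero, abs_nonpos_iff, sub_eq_zero] at h6
  exact h6

section

variable {g : H → H} {a b a' b' : ℝ}

lemma map_Hmul_hor (hlip : ∀ p q, dbox (g p) (g q) ≤ dbox p q)
    (hlin : ∀ p : H, (g p).1 = a * p.1 + b * p.2.1 ∧ (g p).2.1 = a' * p.1 + b' * p.2.1)
    (p : H) (x y : ℝ) :
    g (Hmul p (hor x y)) = Hmul (g p) (hor (a * x + b * y) (a' * x + b' * y)) := by
  let φ : ℝ → ℝ := fun s => vert (g p) (g (Hmul p (hor (s * x) (s * y))))
  have hφ : ∀ s s', |φ s' - φ s| ≤ (x ^ 2 + y ^ 2) * (s' - s) ^ 2 := by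
    intro s s'
    have e : φ s' - φ s = vert (g (Hmul p (hor (s * x) (s * y))))
        (g (Hmul p (hor (s' * x) (s' * y)))) := by
      simp only [φ, vert, (hlin _).1, (hlin _).2]
      simp only [Hmul, hor]
      ring
    have h1 := (near_dbox (g (Hmul p (hor (s * x) (s * y))))
      (g (Hmul p (hor (s' * x) (s' * y))))).2.2
    rw [add_zero] at h1
    have e2 : hor (s' * x) (s' * y) =
        Hmul (hor (s * x) (s * y)) (hor ((s' - s) * x) ((s' - s) * y)) := by
      rw [Hmul_hor_hor_of_parallel, add_sub_cancel]
    have h2 : dbox (g (Hmul p (hor (s * x) (s * y)))) (g (Hmul p (hor (s' * x) (s' * y)))) ≤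
        √(((s' - s) * x) ^ 2 + ((s' - s) * y) ^ 2) := by
      refine (hlip _ _).trans ?_
      rw [dbox_Hmul, e2]
      have := dbox_Hmul (hor (s * x) (s * y)) 0 (hor ((s' - s) * x) ((s' - s) * y))
      rw [Hmul_zero] at this
      rw [this]
      exact dbox_zero_hor_le _ _
    rw [e]
    refine h1.trans ((pow_le_pow_left₀ (dbox_nonneg _ _) h2 2).trans (le_of_eq ?_))
    rw [Real.sq_sqrt (by positivity)]
    ring
  have h1 := eq_of_abs_sub_le_sq hφ
  have h0 : φ 0 = 0 := by
    simp only [φ, zero_mul, hor_zero, Hmul_zero, vert]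
    ring
  rw [h0] at h1
  simp only [φ, one_mul, vert, (hlin _).1, (hlin _).2] at h1
  ext
  · rw [(hlin _).1]
    simp only [Hmul, hor, (hlin _).1]
    ring
  · rw [(hlin _).2]
    simp only [Hmul, hor, (hlin _).2]
    ring
  · simp only [Hmul, hor, (hlin _).1, (hlin _).2] at h1 ⊢
    linarith

lemma map_Hmul_zel (hlip : ∀ p q, dbox (g p) (g q) ≤ dbox p q)
    (hlin : ∀ p : H, (g p).1 = a * p.1 + b * p.2.1 ∧ (g p).2.1 = a' * p.1 + b' * p.2.1)
    (p : H) {t : ℝ} (ht : 0 ≤ t) :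
    g (Hmul p (zel t)) = Hmul (g p) (zel ((a * b' - a' * b) * t)) := by
  have hs := Real.sq_sqrt ht
  set s := √t
  have e : Hmul p (zel t) =
      Hmul (Hmul (Hmul (Hmul p (hor s 0)) (hor 0 s)) (hor (-s) 0)) (hor 0 (-s)) := by
    rw [← hs]
    ext <;> simp only [Hmul, hor, zel] <;> ring
  rw [e, map_Hmul_hor hlip hlin, map_Hmul_hor hlip hlin, map_Hmul_hor hlip hlin,
    map_Hmul_hor hlip hlin, ← hs]
  ext <;> simp only [Hmul, hor, zel] <;> ring

lemma map_eq_hor (h0 : g 0 = 0) (hlip : ∀ p q, dbox (g p) (g q) ≤ dbox p q)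
    (hlin : ∀ p : H, (g p).1 = a * p.1 + b * p.2.1 ∧ (g p).2.1 = a' * p.1 + b' * p.2.1)
    (hD : a * b' - a' * b = 0) (p : H) :
    g p = hor (a * p.1 + b * p.2.1) (a' * p.1 + b' * p.2.1) := by
  have hz : ∀ q t, 0 ≤ t → g (Hmul q (zel t)) = g q := fun q t ht => by
    rw [map_Hmul_zel hlip hlin q ht, hD, zero_mul]
    exact Hmul_zero _
  have hh : g (hor p.1 p.2.1) = hor (a * p.1 + b * p.2.1) (a' * p.1 + b' * p.2.1) := by
    have := map_Hmul_hor hlip hlin 0 p.1 p.2.1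
    rwa [h0, zero_Hmul, zero_Hmul] at this
  rw [← hh]
  rcases le_total 0 p.2.2 with h | h
  · rw [← hz (hor p.1 p.2.1) _ h]
    congr 1
    ext <;> simp [Hmul, hor, zel]
  · rw [← hz p _ (neg_nonneg.2 h)]
    congr 1
    ext <;> simp [Hmul, hor, zel]

end

lemma exists_parallel {a b a' b' : ℝ} (hD : a * b' - a' * b = 0) :
    ∃ α β u v : ℝ, a = α * u ∧ a' = α * v ∧ b = β * u ∧ b' = β * v := by
  by_cases ha : a = 0
  · by_cases ha' : a' = 0
    · exact ⟨0, 1, b, b', by simp [ha], by simp [ha'], by simp, by simp⟩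
    · have hb : b = 0 := by simpa [ha, ha'] using hD
      exact ⟨1, b' / a', a, a', by simp, by simp, by simp [ha, hb], by field_simp⟩
  · refine ⟨1, b / a, a, a', by simp, by simp, by field_simp, ?_⟩
    field_simp
    linarith

lemma cont_segment (u v : ℝ) : cont {p | ∃ s ∈ Set.Icc (-1 : ℝ) 1, p = hor (s * u) (s * v)} = 0 := by
  set C := √(u ^ 2 + v ^ 2) + 1
  have hC : 0 < C := by positivity
  have key : ∀ n : ℕ, cont {p | ∃ s ∈ Set.Icc (-1 : ℝ) 1, p = hor (s * u) (s * v)} ≤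
      ENNReal.ofReal (3 * C ^ 4 * (1 / ((n : ℝ) + 1))) := by
    intro n
    set N : ℝ := (n : ℝ) + 1 with hN
    have hN1 : 1 ≤ N := by simp [hN]
    have hsub : {p | ∃ s ∈ Set.Icc (-1 : ℝ) 1, p = hor (s * u) (s * v)} ⊆
        ⋃ k ∈ Finset.Icc (-((n : ℤ) + 1)) ((n : ℤ) + 1), oball (hor (k / N * u) (k / N * v)) (C / N) := by
      rintro _ ⟨s, ⟨hs1, hs2⟩, rfl⟩
      have h1 := Int.floor_le (s * N)
      have h2 := Int.lt_floor_add_one (s * N)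
      refine Set.mem_biUnion (x := ⌊s * N⌋) ?_ ?_
      · simp only [Finset.coe_Icc, Set.mem_Icc]
        constructor
        · rw [Int.le_floor]; push_cast; nlinarith
        · rw [← Int.lt_add_one_iff, Int.floor_lt]; push_cast; nlinarith
      · change dbox _ _ < _
        set k : ℝ := (⌊s * N⌋ : ℝ)
        have e : hor (s * u) (s * v) =
            Hmul (hor (k / N * u) (k / N * v)) (hor ((s - k / N) * u) ((s - k / N) * v)) := by
          rw [Hmul_hor_hor_of_parallel, add_sub_cancel]
        have h3 := dbox_Hmul (hor (k / N * u) (k / N * v)) 0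
          (hor ((s - k / N) * u) ((s - k / N) * v))
        rw [Hmul_zero] at h3
        rw [e, h3]
        have h4 : s - k / N = (s * N - k) / N := by field_simp
        have h5 : 0 ≤ s - k / N := by rw [h4]; apply div_nonneg <;> linarith
        have h6 : s - k / N ≤ 1 / N := by rw [h4]; gcongr; linarith
        refine (dbox_zero_hor_le _ _).trans_lt ?_
        rw [mul_pow, mul_pow, ← mul_add, Real.sqrt_mul (sq_nonneg _), Real.sqrt_sq h5]
        calc (s - k / N) * √(u ^ 2 + v ^ 2) ≤ 1 / N * √(u ^ 2 + v ^ 2) := by gcongr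
          _ < 1 / N * C := by gcongr; exact lt_add_one _
          _ = C / N := by ring
    calc _ ≤ _ := measure_mono hsub
      _ ≤ ∑ k ∈ Finset.Icc (-((n : ℤ) + 1)) ((n : ℤ) + 1),
            cont (oball (hor (k / N * u) (k / N * v)) (C / N)) := measure_biUnion_finset_le _ _
      _ ≤ ∑ k ∈ Finset.Icc (-((n : ℤ) + 1)) ((n : ℤ) + 1), ENNReal.ofReal ((C / N) ^ 4) :=
          Finset.sum_le_sum fun k _ => cont_le_ofReal (by positivity) subset_rfl
      _ = ENNReal.ofReal ((2 * N + 1) * (C / N) ^ 4) := by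
          rw [Finset.sum_const, Int.card_Icc, nsmul_eq_mul, ENNReal.ofReal_mul (by positivity)]
          congr 1
          have e : ((n : ℤ) + 1 + 1 - -((n : ℤ) + 1)).toNat = 2 * n + 3 := by omega
          have e' : 2 * N + 1 = ((2 * n + 3 : ℕ) : ℝ) := by rw [hN]; push_cast; ring
          rw [e, e', ENNReal.ofReal_natCast]
      _ ≤ _ := by
          apply ENNReal.ofReal_le_ofReal
          calc (2 * N + 1) * (C / N) ^ 4 ≤ (3 * N ^ 3) * (C / N) ^ 4 := by
                gcongr
                nlinarith [mul_nonneg (sub_nonneg.2 hN1) (sub_nonneg.2 hN1), one_le_pow₀ (n := 3) hN1,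
                  pow_le_pow_right₀ hN1 (show 1 ≤ 3 by norm_num)]
            _ = 3 * C ^ 4 * (1 / N) := by field_simp
  have h1 : Tendsto (fun n : ℕ => ENNReal.ofReal (3 * C ^ 4 * (1 / ((n : ℝ) + 1)))) atTop
      (𝓝 (ENNReal.ofReal (3 * C ^ 4 * 0))) :=
    ENNReal.tendsto_ofReal (tendsto_one_div_add_atTop_nhds_zero_nat.const_mul _)
  rw [mul_zero, ENNReal.ofReal_zero] at h1
  exact le_antisymm (ge_of_tendsto' h1 key) bot_le

theorem Good.eq_zero {c₀ : ℝ≥0∞} {g₀ : H → H} (h : Good c₀ g₀) : c₀ = 0 := by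
  obtain ⟨g, hg, a, b, a', b', hlin⟩ := exists_good_linear ⟨g₀, h⟩
  have hD : a * b' - a' * b = 0 := by
    have h1 : ∀ m : ℕ, √|a * b' - a' * b| ≤ 8 * (1 / 2) ^ m := by
      intro m
      obtain ⟨p, -, t, ⟨ht, -⟩, hpt⟩ := hg.pairs 0 1 m one_pos
      have ht0 : 0 < t := lt_of_lt_of_le (by positivity) ht
      rw [map_Hmul_zel hg.lip hlin p ht0.le, dbox_Hmul_zel, abs_mul, abs_of_pos ht0,
        Real.sqrt_mul (abs_nonneg _)] at hpt
      exact le_of_mul_le_mul_right hpt (Real.sqrt_pos.2 ht0)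
    have h2 := ge_of_tendsto' (tendsto_const_mul_half_pow 8) h1
    have h3 := (Real.sqrt_eq_zero (abs_nonneg _)).1 (le_antisymm h2 (Real.sqrt_nonneg _))
    exact abs_eq_zero.1 h3
  obtain ⟨α, β, u, v, rfl, rfl, rfl, rfl⟩ := exists_parallel hD
  set M := |α| + |β| + 1 with hM
  have hM0 : 0 < M := by positivity
  have h1 := hg.content 0 1 one_pos
  have h2 : cont (g '' cball 0 1) ≤ 0 := by
    rw [← cont_segment (M * u) (M * v)]
    refine measure_mono ?_
    rintro _ ⟨p, hp, rfl⟩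
    have h3 : Near 1 0 0 p := (dbox_le_iff zero_le_one).1 hp
    have hx : |p.1| ≤ 1 := by simpa using h3.1
    have hy : |p.2.1| ≤ 1 := by simpa using h3.2.1
    refine ⟨(α * p.1 + β * p.2.1) / M, abs_le.1 ?_, ?_⟩
    · rw [abs_div, abs_of_pos hM0, div_le_one hM0]
      refine (abs_add_le _ _).trans ?_
      rw [abs_mul, abs_mul]
      have := mul_le_of_le_one_right (abs_nonneg α) hx
      have := mul_le_of_le_one_right (abs_nonneg β) hy
      linarith
    · rw [map_eq_hor hg.zero hg.lip hlin hD, ← mul_assoc, ← mul_assoc, div_mul_cancel₀ _ hM0.ne']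
      congr 1 <;> ring
  have h4 := le_antisymm (h1.trans h2) bot_le
  simpa using h4

theorem maxCont_eq_zero : maxCont = 0 := by
  by_contra h0
  obtain ⟨c₀, hc₀, g, hg⟩ := exists_good_of_maxCont h0
  exact hc₀ hg.eq_zero

theorem hausdorffOf_image_eq_zero {A : Set tile} {f : tile → H} {L : ℝ}
    (hf : ∀ x ∈ A, ∀ y ∈ A, dbox (f x) (f y) ≤ L * td x y) : hausdorffOf dbox 4 (f '' A) = 0 := by
  classical
  set M := max L 1 with hM
  have hM0 : 0 < M := lt_max_of_lt_right one_pos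
  let F : H → H := fun p => if h : p ∈ tile then dil M⁻¹ (f ⟨p, h⟩) else 0
  have hF : ∀ x : tile, F x = dil M⁻¹ (f x) := fun x => dif_pos x.2
  have hadm : Adm (Subtype.val '' A) F := by
    refine ⟨Subtype.coe_image_subset _ _, ?_⟩
    rintro _ ⟨x, hx, rfl⟩ _ ⟨y, hy, rfl⟩
    rw [hF, hF, dbox_dil (by positivity), inv_mul_le_iff₀ hM0]
    refine (hf x hx y hy).trans ?_
    exact mul_le_mul_of_nonneg_right (le_max_left _ _) (sdist_nonneg _ _)
  have h0 : cont (F '' (Subtype.val '' A)) = 0 :=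
    le_antisymm (hadm.cont_le_maxCont.trans maxCont_eq_zero.le) bot_le
  apply hausdorffOf_eq_zero_of_cont_eq_zero
  have h1 := cont_image_le (ψ := dil M) hM0 (fun p q => (dbox_dil hM0.le p q).le)
    (F '' (Subtype.val '' A))
  rw [h0, mul_zero] at h1
  refine le_antisymm (le_trans (measure_mono ?_) h1) bot_le
  rintro _ ⟨x, hx, rfl⟩
  exact ⟨_, ⟨_, ⟨x, hx, rfl⟩, rfl⟩, by rw [hF, dil_dil_inv hM0.ne']⟩

/-- Theorem 1.1. There is a compact `K ⊆ ℍ` with nonempty interior and a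
distance `d ≤ d_b` on `K` such that `(K,d)` is an Ahlfors 4-regular BPI space, and every
Lipschitz map from a subset of `(K,d)` to `(ℍ,d_b)` has image of `H⁴_{d_b}`-measure zero. -/
theorem statement2 :
    ∃ K : Set H, IsCompact K ∧ (interior K).Nonempty ∧
      ∃ d : K → K → ℝ, IsDistance d ∧
        (∀ x y : K, d x y ≤ dbox (x : H) (y : H)) ∧
        AhlforsRegularOf d 4 ∧ IsBPI d 4 ∧
        ∀ (A : Set K) (f : K → H) (L : ℝ),
          (∀ x ∈ A, ∀ y ∈ A, dbox (f x) (f y) ≤ L * d x y) →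
          hausdorffOf dbox 4 (f '' A) = 0 := by
  exact ⟨tile, isCompact_tile, ⟨_, mem_interior_iff_mem_nhds.2 tile_mem_nhds⟩, td,
      ⟨fun _ _ => sdist_comm _ _, fun _ => sdist_self _,
        fun _ _ h => Subtype.ext (eq_of_sdist_eq_zero h), fun _ _ _ => sdist_triangle _ _ _⟩,
      fun _ _ => sdist_le_dbox _ _, ahlforsRegularOf_td, isBPI_td,
      fun _ _ _ hf => hausdorffOf_image_eq_zero hf⟩

end Heis
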